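/- arXiv:0705.2205 — 2 statements merged into one kernel-verified Lean document; each statement's English description precedes it below -/
import Mathlib

section
/- For every nondeterministic Büchi word automaton N with n ≥ 1 states over alphabet Σ there exists a deterministic parity word automaton D with at most 2·n^n·n! states and parity index at most 2n+1 such that L(D) = Σ^ω ∖ L(N). -/
/-- The set of states occurring infinitely often in an infinite sequence. -/
def InfOcc {S : Type} (r : ℕ → S) : Set S :=
  {s | ∀ N : ℕ, ∃ n, N ≤ n ∧ r n = s}

/-- `r` is a run of the nondeterministic automaton with transition function `δ`
and initial state `s0` on the infinite word `w`. -/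
def IsRun {A S : Type} (δ : S → A → Set S) (s0 : S) (w : ℕ → A) (r : ℕ → S) : Prop :=
  r 0 = s0 ∧ ∀ j, r (j + 1) ∈ δ (r j) (w j)

/-- The language of a nondeterministic Büchi word automaton:
some run visits the acceptance set `acc` infinitely often. -/
def BuchiLang {A S : Type} (δ : S → A → Set S) (s0 : S) (acc : Set S) : Set (ℕ → A) :=
  {w | ∃ r, IsRun δ s0 w r ∧ (InfOcc r ∩ acc).Nonempty}

/-- The language of a nondeterministic Streett word automaton with pairs
`⟨R i, G i⟩`: some run `r` satisfies, for every `i`,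
`inf(r) ∩ G i = ∅` or `inf(r) ∩ R i ≠ ∅`. -/
def StreettLang {A S : Type} {k : ℕ} (δ : S → A → Set S) (s0 : S)
    (R G : Fin k → Set S) : Set (ℕ → A) :=
  {w | ∃ r, IsRun δ s0 w r ∧ ∀ i, InfOcc r ∩ G i = ∅ ∨ (InfOcc r ∩ R i).Nonempty}

/-- The unique run of a deterministic automaton with transition function `δ`
and initial state `s0` on the infinite word `w`. -/
def DetRun {A S : Type} (δ : S → A → S) (s0 : S) (w : ℕ → A) : ℕ → S
  | 0 => s0
  | j + 1 => δ (DetRun δ s0 w j) (w j)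

/-- `F` is a partition of the state space into `k` (possibly empty) classes. -/
def IsPartition {S : Type} {k : ℕ} (F : Fin k → Set S) : Prop :=
  (∀ i j : Fin k, i ≠ j → F i ∩ F j = ∅) ∧ (⋃ i, F i) = Set.univ

/-- A run is accepted by the parity condition `F 0, …, F (k-1)` iff the least
`i` such that `inf(r) ∩ F i ≠ ∅` is even. -/
def ParityAccept {S : Type} {k : ℕ} (F : Fin k → Set S) (r : ℕ → S) : Prop :=
  ∃ i : Fin k, Even (i : ℕ) ∧ (InfOcc r ∩ F i).Nonempty ∧
    ∀ j : Fin k, j < i → InfOcc r ∩ F j = ∅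

/-- A run is accepted by the Rabin condition with pairs `⟨E i, F i⟩` iff for
some `i`, `inf(r) ∩ E i = ∅` and `inf(r) ∩ F i ≠ ∅`. -/
def RabinAccept {S : Type} {k : ℕ} (E F : Fin k → Set S) (r : ℕ → S) : Prop :=
  ∃ i : Fin k, InfOcc r ∩ E i = ∅ ∧ (InfOcc r ∩ F i).Nonempty

open Filter

/-- `B` precedes `A` in the lexicographic order of characteristic functions: the least element
on which they differ belongs to `A`. -/
def LexBelow (B A : Finset ℕ) : Prop :=
  ∃ i, (∀ j < i, j ∈ A ↔ j ∈ B) ∧ i ∈ A ∧ i ∉ B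

lemma exists_not_lexBelow {S : Type} [Finite S] (A : S → Finset ℕ) (X : Set S)
    (hX : X.Nonempty) : ∃ x ∈ X, ∀ x' ∈ X, ¬ LexBelow (A x) (A x') := by
  classical
  obtain ⟨x, hx, hmax⟩ := Set.exists_max_image X
    (fun x => toLex (fun i : ℕ => decide (i ∈ A x))) X.toFinite hX
  refine ⟨x, hx, fun x' hx' ⟨i, hlt, hi, hi'⟩ => ?_⟩
  refine absurd (hmax x' hx') (not_le.2 ⟨i, fun j hj => ?_, ?_⟩)
  · simp [hlt j hj]
  · simp [hi, hi']

/-- Every state `y` receives under `B` the lexicographically greatest label of its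
`a`-predecessors, and the empty label if it has none. -/
def IsMaxPred {A S : Type} (δ : S → A → Set S) (a : A) (L B : S → Finset ℕ) : Prop :=
  ∀ y, (∃ x, y ∈ δ x a ∧ B y = L x ∧ ∀ x', y ∈ δ x' a → ¬ LexBelow (L x) (L x')) ∨
    (B y = ∅ ∧ ∀ x, y ∉ δ x a)

lemma exists_isMaxPred {A S : Type} [Finite S] (δ : S → A → Set S) (a : A)
    (L : S → Finset ℕ) : ∃ B, IsMaxPred δ a L B := by
  have h : ∀ y, ∃ b : Finset ℕ,
      (∃ x, y ∈ δ x a ∧ b = L x ∧ ∀ x', y ∈ δ x' a → ¬ LexBelow (L x) (L x')) ∨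
        (b = ∅ ∧ ∀ x, y ∉ δ x a) := by
    intro y
    by_cases hy : ∃ x, y ∈ δ x a
    · obtain ⟨x, hx, hmax⟩ := exists_not_lexBelow L {x | y ∈ δ x a} hy
      exact ⟨L x, Or.inl ⟨x, hx, rfl, hmax⟩⟩
    · exact ⟨∅, Or.inr ⟨rfl, fun x hx => hy ⟨x, hx⟩⟩⟩
  exact ⟨fun y => (h y).choose, fun y => (h y).choose_spec⟩

/-- A label assignment inherited from maximal predecessors. -/
noncomputable def maxPred {A S : Type} [Finite S] (δ : S → A → Set S) (a : A)
    (L : S → Finset ℕ) : S → Finset ℕ :=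
  (exists_isMaxPred δ a L).choose

lemma isMaxPred_maxPred {A S : Type} [Finite S] (δ : S → A → Set S) (a : A)
    (L : S → Finset ℕ) : IsMaxPred δ a L (maxPred δ a L) :=
  (exists_isMaxPred δ a L).choose_spec

open Classical in
/-- Accepting states enter a new child, named above `n`, of their innermost node. -/
noncomputable def branch {S : Type} (n : ℕ) (acc : Set S) (B : S → Finset ℕ) (y : S) :
    Finset ℕ :=
  if y ∈ acc ∧ (B y).Nonempty then insert (n + 1 + (B y).sup id) (B y) else B y

/-- The node `r` contains some state. -/
def Live {S : Type} (C : S → Finset ℕ) (r : ℕ) : Prop := ∃ y, r ∈ C y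

/-- The node `r` is the innermost node of some state. -/
def Owned {S : Type} (C : S → Finset ℕ) (r : ℕ) : Prop := ∃ y, r ∈ C y ∧ ∀ i ∈ C y, i ≤ r

open Classical in
/-- Remove all proper descendants of nodes which are not owned. -/
noncomputable def truncate {S : Type} (C : S → Finset ℕ) (y : S) : Finset ℕ :=
  (C y).filter (fun r => ∀ i ∈ C y, i < r → Owned C i)

open Classical in
/-- Rename the live nodes to an initial segment of `ℕ`, preserving their order. -/
noncomputable def compress {S : Type} (D : S → Finset ℕ) (y : S) : Finset ℕ :=
  (D y).image (Nat.count (Live D))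

/-- The events of a step: `2 * r` if the node `r` dies, `2 * r + 1` if all states of the node `r`
have moved to its descendants. -/
def events {S : Type} (C : S → Finset ℕ) : Set ℕ :=
  {v | ∃ r, (v = 2 * r ∧ ¬ Live (truncate C) r) ∨ (v = 2 * r + 1 ∧ Live C r ∧ ¬ Owned C r)}

/-- The most important event of a step. -/
noncomputable def priority {S : Type} (C : S → Finset ℕ) : ℕ := sInf (events C)

lemma mem_truncate {S : Type} {C : S → Finset ℕ} {y : S} {r : ℕ} :
    r ∈ truncate C y ↔ r ∈ C y ∧ ∀ i ∈ C y, i < r → Owned C i := by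
  simp [truncate]

open Classical in
lemma mem_compress {S : Type} {D : S → Finset ℕ} {y : S} {r : ℕ} :
    r ∈ compress D y ↔ ∃ d ∈ D y, Nat.count (Live D) d = r := by
  simp [compress]

lemma exists_not_live {S : Type} [Finite S] (D : S → Finset ℕ) : ∃ r, ¬ Live D r := by
  have : (⋃ y, (D y : Set ℕ)).Finite := Set.finite_iUnion fun y => (D y).finite_toSet
  obtain ⟨r, hr⟩ := this.exists_notMem
  exact ⟨r, fun ⟨y, hy⟩ => hr (Set.mem_iUnion.2 ⟨y, hy⟩)⟩

lemma priority_mem_events {S : Type} [Finite S] (C : S → Finset ℕ) :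
    priority C ∈ events C := by
  obtain ⟨r, hr⟩ := exists_not_live (truncate C)
  exact Nat.sInf_mem ⟨2 * r, r, Or.inl ⟨rfl, hr⟩⟩

lemma live_of_two_mul_lt {S : Type} {C : S → Finset ℕ} {r : ℕ} (h : 2 * r < priority C) :
    Live (truncate C) r := by
  by_contra hr
  exact absurd (Nat.sInf_le (show 2 * r ∈ events C from ⟨r, Or.inl ⟨rfl, hr⟩⟩)) (not_le.2 h)

lemma owned_of_two_mul_add_one_lt {S : Type} {C : S → Finset ℕ} {r : ℕ} {y : S}
    (hy : r ∈ C y) (h : 2 * r + 1 < priority C) : Owned C r := by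
  by_contra hr
  exact absurd
    (Nat.sInf_le (show 2 * r + 1 ∈ events C from ⟨r, Or.inr ⟨rfl, ⟨y, hy⟩, hr⟩⟩)) (not_le.2 h)

open Classical in
lemma count_eq_self {P : ℕ → Prop} {r : ℕ} (h : ∀ j < r, P j) : Nat.count P r = r := by
  induction r with
  | zero => simp
  | succ r ih =>
    rw [Nat.count_succ, ih fun j hj => h j (by omega), if_pos (h r (by omega))]

open Classical in
lemma le_count {P : ℕ → Prop} {r d : ℕ} (h : ∀ j < r, P j) (hd : r ≤ d) :
    r ≤ Nat.count P d :=
  (count_eq_self h).symm.le.trans (Nat.count_monotone P hd)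

open Classical in
lemma count_lt_self {P : ℕ → Prop} {r d : ℕ} (h : ¬ P r) (hd : r < d) :
    Nat.count P d < d := by
  induction d, hd using Nat.le_induction with
  | base => rw [Nat.count_succ, if_neg h]; exact Nat.lt_succ_of_le (Nat.count_le _)
  | succ d hd ih => rw [Nat.count_succ]; split_ifs <;> omega

open Classical in
lemma exists_count_eq {P : ℕ → Prop} {j d : ℕ} (h : j < Nat.count P d) :
    ∃ e < d, P e ∧ Nat.count P e = j := by
  induction d with
  | zero => simp at h
  | succ d ih =>
    by_cases hj : j < Nat.count P d
    · obtain ⟨e, he, hP⟩ := ih hj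
      exact ⟨e, by omega, hP⟩
    · rw [Nat.count_succ] at h
      split_ifs at h with hd
      · exact ⟨d, by omega, hd, by omega⟩
      · omega

lemma subset_branch {S : Type} {n : ℕ} {acc : Set S} {B : S → Finset ℕ} {y : S} {r : ℕ}
    (h : r ∈ B y) : r ∈ branch n acc B y := by
  unfold branch; split_ifs <;> simp [h]

lemma mem_branch {S : Type} {n : ℕ} {acc : Set S} {B : S → Finset ℕ} {y : S} {r : ℕ}
    (h : r ∈ branch n acc B y) :
    r ∈ B y ∨ (y ∈ acc ∧ (B y).Nonempty ∧ r = n + 1 + (B y).sup id) := by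
  unfold branch at h
  split_ifs at h with hy
  · rcases Finset.mem_insert.1 h with h | h
    · exact Or.inr ⟨hy.1, hy.2, h⟩
    · exact Or.inl h
  · exact Or.inl h

lemma mem_branch_of_le {S : Type} {n : ℕ} {acc : Set S} {B : S → Finset ℕ} {y : S} {r : ℕ}
    (hr : r ≤ n) : r ∈ branch n acc B y ↔ r ∈ B y :=
  ⟨fun h => (mem_branch h).resolve_right fun h => by omega, subset_branch⟩

/-- The label assignment after one step, given the inherited one. -/
noncomputable def nextLabel {S : Type} (n : ℕ) (acc : Set S) (B : S → Finset ℕ) :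
    S → Finset ℕ :=
  compress (truncate (branch n acc B))

section Next

variable {S : Type} {n : ℕ} {acc : Set S} {B : S → Finset ℕ}

lemma mem_nextLabel_iff {i : ℕ} (hin : i ≤ n) (hi : 2 * i < priority (branch n acc B)) (y : S) :
    i ∈ nextLabel n acc B y ↔ i ∈ B y := by
  classical
  have hlive : ∀ j < i + 1, Live (truncate (branch n acc B)) j :=
    fun j hj => live_of_two_mul_lt (by omega)
  have hlive' : ∀ j < i, Live (truncate (branch n acc B)) j := fun j hj => hlive j (by omega)
  rw [nextLabel, mem_compress, ← mem_branch_of_le (acc := acc) hin]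
  constructor
  · rintro ⟨d, hd, hdi⟩
    have hdi' : d ≤ i := by
      by_contra hlt
      have := le_count hlive (d := d) (by omega)
      omega
    rw [count_eq_self fun j hj => hlive' j (by omega)] at hdi
    exact hdi ▸ (mem_truncate.1 hd).1
  · intro h
    refine ⟨i, mem_truncate.2 ⟨h, fun j hj hji => ?_⟩, count_eq_self hlive'⟩
    exact owned_of_two_mul_add_one_lt hj (by omega)

lemma zero_mem_nextLabel {y : S} (h : 0 ∈ B y) : 0 ∈ nextLabel n acc B y := by
  rw [nextLabel, mem_compress]
  exact ⟨0, mem_truncate.2 ⟨subset_branch h, by simp⟩, by simp⟩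

lemma zero_lt_priority [Finite S] {y : S} (h : 0 ∈ B y) : 0 < priority (branch n acc B) := by
  obtain ⟨r, ⟨hr, hdead⟩ | ⟨hr, -⟩⟩ := priority_mem_events (branch n acc B)
  · rcases Nat.eq_zero_or_pos r with rfl | hr'
    · exact absurd ⟨y, mem_truncate.2 ⟨subset_branch h, by simp⟩⟩ hdead
    · omega
  · omega

lemma priority_le (hB : ∀ y, ∀ r ∈ B y, r < n) : priority (branch n acc B) ≤ 2 * n := by
  refine Nat.sInf_le ⟨n, Or.inl ⟨rfl, fun ⟨y, hy⟩ => ?_⟩⟩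
  exact absurd (hB y n ((mem_branch_of_le le_rfl).1 (mem_truncate.1 hy).1)) (lt_irrefl _)

lemma exists_mem_nextLabel [Finite S] {r j : ℕ} {y : S}
    (hr : 2 * r ≤ priority (branch n acc B))
    (hj : j ∈ branch n acc B y) (hrj : r ≤ j) :
    ∃ j' ∈ nextLabel n acc B y, r ≤ j' ∧ j' ≤ j ∧
      (priority (branch n acc B) = 2 * r → j' < j) := by
  classical
  have hex : ∃ j, j ∈ branch n acc B y ∧ r ≤ j := ⟨j, hj, hrj⟩
  obtain ⟨hm, hrm⟩ := Nat.find_spec hex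
  have hmin : ∀ i ∈ branch n acc B y, r ≤ i → Nat.find hex ≤ i :=
    fun i hi hri => Nat.find_min' hex ⟨hi, hri⟩
  generalize Nat.find hex = m at hm hrm hmin
  have hmj := hmin j hj hrj
  have hlive : ∀ i < r, Live (truncate (branch n acc B)) i :=
    fun i hi => live_of_two_mul_lt (by omega)
  have hmt : m ∈ truncate (branch n acc B) y := by
    refine mem_truncate.2 ⟨hm, fun i hi him => owned_of_two_mul_add_one_lt hi ?_⟩
    have : i < r := by
      by_contra h
      exact absurd (hmin i hi (by omega)) (by omega)
    omega
  refine ⟨_, mem_compress.2 ⟨m, hmt, rfl⟩, le_count hlive hrm,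
    (Nat.count_le _).trans hmj, fun hp => ?_⟩
  obtain ⟨r', ⟨hr', hdead⟩ | ⟨hr', -⟩⟩ := priority_mem_events (branch n acc B)
  · obtain rfl : r' = r := by omega
    have hne : r' ≠ m := fun h => hdead ⟨y, h ▸ hmt⟩
    exact (count_lt_self hdead (by omega)).trans_le hmj
  · omega

lemma le_of_mem_nextLabel_of_priority_eq [Finite S] {r i : ℕ} {y : S} (hrn : r ≤ n)
    (hp : priority (branch n acc B) = 2 * r + 1) (hr : r ∈ B y)
    (hi : i ∈ nextLabel n acc B y) : i ≤ r := by
  classical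
  obtain ⟨r', ⟨hr', -⟩ | ⟨hr', -, hown⟩⟩ := priority_mem_events (branch n acc B)
  · omega
  obtain rfl : r' = r := by omega
  rw [nextLabel, mem_compress] at hi
  obtain ⟨d, hd, rfl⟩ := hi
  refine (Nat.count_le _).trans (not_lt.1 fun hlt => hown ?_)
  exact (mem_truncate.1 hd).2 _ (subset_branch hr) hlt

lemma le_of_mem_nextLabel {r i : ℕ} {y : S} (hy : y ∉ acc) (hB : ∀ i ∈ B y, i ≤ r)
    (hi : i ∈ nextLabel n acc B y) : i ≤ r := by
  classical
  rw [nextLabel, mem_compress] at hi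
  obtain ⟨d, hd, rfl⟩ := hi
  rcases mem_branch (mem_truncate.1 hd).1 with h | h
  · exact (Nat.count_le _).trans (hB d h)
  · exact absurd h.1 hy

lemma exists_lt_mem_of_priority_eq [Finite S] {r : ℕ} {y : S}
    (hp : priority (branch n acc B) = 2 * r + 1) (hr : r ∈ B y) (hy : y ∉ acc) :
    ∃ i ∈ B y, r < i := by
  obtain ⟨r', ⟨hr', -⟩ | ⟨hr', -, hown⟩⟩ := priority_mem_events (branch n acc B)
  · omega
  obtain rfl : r' = r := by omega
  by_contra! hle
  refine hown ⟨y, subset_branch hr, fun i hi => ?_⟩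
  rcases mem_branch hi with h | h
  · exact hle i h
  · exact absurd h.1 hy

end Next

lemma exists_path_of_finite {S : Type} [Finite S] (R : ℕ → S → S → Prop) (X : ℕ → Set S)
    (hX : ∀ᶠ u in atTop, (X u).Nonempty)
    (hR : ∀ t, ∀ y ∈ X (t + 1), ∃ x ∈ X t, R t x y) :
    ∃ r : ℕ → S, ∀ t, r t ∈ X t ∧ R t (r t) (r (t + 1)) := by
  have hpath : ∀ u, ∀ y ∈ X u, ∃ q : ℕ → S, q u = y ∧ (∀ t ≤ u, q t ∈ X t) ∧
      ∀ t < u, R t (q t) (q (t + 1)) := by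
    intro u
    induction u with
    | zero => exact fun y hy => ⟨fun _ => y, rfl, fun t ht => by simpa [Nat.le_zero.1 ht], by simp⟩
    | succ u ih =>
      intro y hy
      obtain ⟨x, hx, hxy⟩ := hR u y hy
      obtain ⟨q, hqu, hqX, hqR⟩ := ih x hx
      refine ⟨fun t => if t = u + 1 then y else q t, by simp, fun t ht => ?_, fun t ht => ?_⟩
      · by_cases h : t = u + 1
        · simpa [h] using hy
        · simpa [h] using hqX t (by omega)
      · have h : t ≠ u + 1 := by omega
        by_cases h' : t = u
        · subst h'
          simpa [hqu] using hxy
        · simpa [h, h'] using hqR t (by omega)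
  have hU : (hyperfilter ℕ : Filter ℕ) ≤ atTop := Nat.hyperfilter_le_atTop
  have hex : ∀ u, ∃ q : ℕ → S, (X u).Nonempty →
      (∀ t ≤ u, q t ∈ X t) ∧ ∀ t < u, R t (q t) (q (t + 1)) := by
    intro u
    by_cases h : (X u).Nonempty
    · obtain ⟨y, hy⟩ := h
      obtain ⟨q, -, hq⟩ := hpath u y hy
      exact ⟨q, fun _ => hq⟩
    · obtain ⟨y, -⟩ := hX.exists.choose_spec
      exact ⟨fun _ => y, fun h' => absurd h' h⟩
  choose q hq using hex
  have hlim : ∀ t, ∃ s, ∀ᶠ u in (hyperfilter ℕ : Filter ℕ), q u t = s := fun t =>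
    Ultrafilter.eventually_exists_iff.1 (Eventually.of_forall fun u => ⟨q u t, rfl⟩)
  choose r hr using hlim
  refine ⟨r, fun t => ?_⟩
  obtain ⟨u, ⟨⟨hu, h⟩, h'⟩, hXu⟩ := ((((eventually_gt_atTop t).filter_mono hU).and (hr t)).and
    (hr (t + 1))).and (hX.filter_mono hU) |>.exists
  rw [← h, ← h']
  exact ⟨(hq u hXu).1 t hu.le, (hq u hXu).2 t hu⟩

/-- `L` is the sequence of label assignments, and `p` the sequence of priorities, produced by
the word `w`. -/
structure IsLabelRun {A S : Type} (n : ℕ) (δ : S → A → Set S) (s0 : S) (acc : Set S)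
    (w : ℕ → A) (L B : ℕ → S → Finset ℕ) (p : ℕ → ℕ) : Prop where
  isMaxPred : ∀ t, IsMaxPred δ (w t) (L t) (B t)
  label_succ : ∀ t, L (t + 1) = nextLabel n acc (B t)
  priority_succ : ∀ t, p (t + 1) = priority (branch n acc (B t))
  lt_card : ∀ t y, ∀ r ∈ L t y, r < n
  zero_mem : 0 ∈ L 0 s0
  eq_init : ∀ y, (L 0 y).Nonempty → y = s0

namespace IsLabelRun

variable {A S : Type} {n : ℕ} {δ : S → A → Set S} {s0 : S} {acc : Set S}
  {w : ℕ → A} {L B : ℕ → S → Finset ℕ} {p : ℕ → ℕ}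

lemma inherited_lt (h : IsLabelRun n δ s0 acc w L B p) (t : ℕ) (y : S) :
    ∀ r ∈ B t y, r < n := by
  intro r hr
  rcases h.isMaxPred t y with ⟨x, -, hx, -⟩ | ⟨hy, -⟩
  · exact h.lt_card t x r (hx ▸ hr)
  · simp [hy] at hr

lemma priority_succ_le (h : IsLabelRun n δ s0 acc w L B p) (t : ℕ) : p (t + 1) ≤ 2 * n :=
  h.priority_succ t ▸ priority_le (h.inherited_lt t)

lemma mem_succ_iff (h : IsLabelRun n δ s0 acc w L B p) {t i : ℕ} (hi : 2 * i < p (t + 1))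
    (y : S) : i ∈ L (t + 1) y ↔ i ∈ B t y := by
  have := h.priority_succ_le t
  rw [h.label_succ]
  exact mem_nextLabel_iff (by omega) (h.priority_succ t ▸ hi) y

lemma inherited_nonempty (h : IsLabelRun n δ s0 acc w L B p) {t : ℕ} {y : S}
    (hy : (L (t + 1) y).Nonempty) : (B t y).Nonempty := by
  classical
  obtain ⟨r, hr⟩ := hy
  rw [h.label_succ, nextLabel, mem_compress] at hr
  obtain ⟨d, hd, -⟩ := hr
  rcases mem_branch (mem_truncate.1 hd).1 with h | h
  exacts [⟨d, h⟩, h.2.1]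

theorem mem_buchiLang [Finite S] (h : IsLabelRun n δ s0 acc w L B p) {r : ℕ}
    (hev : ∀ᶠ t in atTop, 2 * r + 1 ≤ p t) (hfr : ∃ᶠ t in atTop, p t = 2 * r + 1) :
    ∃ ρ, IsRun δ s0 w ρ ∧ ∃ᶠ t in atTop, ρ t ∈ acc := by
  obtain ⟨N, hN⟩ := eventually_atTop.1 hev
  obtain ⟨ρ, hρ⟩ := exists_path_of_finite
    (fun t x y => y ∈ δ x (w t) ∧ B t y = L t x)
    (fun t => {y | (L t y).Nonempty ∧ (N ≤ t → r ∈ L t y)})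
    (by
      filter_upwards [eventually_gt_atTop N] with t ht
      obtain ⟨t, rfl⟩ := Nat.exists_eq_succ_of_ne_zero (show t ≠ 0 by omega)
      have hlt : 2 * r < p (t + 1) := hN (t + 1) ht.le
      have := h.priority_succ t
      obtain ⟨y, hy⟩ := live_of_two_mul_lt (this ▸ hlt)
      have hle := h.priority_succ_le t
      have hr := (h.mem_succ_iff hlt y).2
        ((mem_branch_of_le (by omega)).1 (mem_truncate.1 hy).1)
      exact ⟨y, ⟨r, hr⟩, fun _ => hr⟩)
    (by
      rintro t y ⟨hne, hr⟩
      have hB := h.inherited_nonempty hne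
      rcases h.isMaxPred t y with ⟨x, hx, hxy, -⟩ | ⟨hy, -⟩
      · refine ⟨x, ⟨hxy ▸ hB, fun ht => ?_⟩, hx, hxy⟩
        exact hxy ▸ (h.mem_succ_iff (hN (t + 1) (by omega)) y).1 (hr (by omega))
      · simp [hy] at hB)
  refine ⟨ρ, ⟨h.eq_init _ (hρ 0).1.1, fun t => (hρ t).2.1⟩, ?_⟩
  by_contra hacc
  obtain ⟨M, hM⟩ := eventually_atTop.1 (not_frequently.1 hacc)
  obtain ⟨t₀, ht₀, hpt₀⟩ := frequently_atTop.1 hfr (N + M + 1)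
  have hmem : ∀ t, N ≤ t → r ∈ B t (ρ (t + 1)) := fun t ht =>
    (hρ t).2.2 ▸ (hρ t).1.2 ht
  have hrn : r ≤ n := by
    have := h.priority_succ_le (t₀ - 1)
    rw [show t₀ - 1 + 1 = t₀ by omega] at this
    omega
  have hle : ∀ t, t₀ ≤ t → ∀ i ∈ L t (ρ t), i ≤ r := by
    intro t ht
    induction t, ht using Nat.le_induction with
    | base =>
      obtain ⟨t, rfl⟩ := Nat.exists_eq_succ_of_ne_zero (show t₀ ≠ 0 by omega)
      intro i hi
      rw [Nat.succ_eq_add_one, h.label_succ] at hi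
      exact le_of_mem_nextLabel_of_priority_eq hrn (h.priority_succ t ▸ hpt₀)
        (hmem t (by omega)) hi
    | succ t ht ih =>
      intro i hi
      rw [h.label_succ] at hi
      exact le_of_mem_nextLabel (hM _ (by omega)) ((hρ t).2.2 ▸ ih) hi
  obtain ⟨t₁, ht₁, hpt₁⟩ := frequently_atTop.1 hfr (t₀ + 1)
  obtain ⟨t, rfl⟩ := Nat.exists_eq_succ_of_ne_zero (show t₁ ≠ 0 by omega)
  obtain ⟨i, hi, hri⟩ := exists_lt_mem_of_priority_eq (h.priority_succ t ▸ hpt₁)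
    (hmem t (by omega)) (hM _ (by omega))
  rw [(hρ t).2.2] at hi
  exact absurd (hle t (by omega) i hi) (by omega)

variable {ρ : ℕ → S}

lemma not_lexBelow (h : IsLabelRun n δ s0 acc w L B p) (hρ : IsRun δ s0 w ρ) (t : ℕ) :
    ¬ LexBelow (B t (ρ (t + 1))) (L t (ρ t)) := by
  rcases h.isMaxPred t (ρ (t + 1)) with ⟨x, -, hx, hmax⟩ | ⟨-, hy⟩
  · exact hx ▸ hmax _ (hρ.2 t)
  · exact absurd (hρ.2 t) (hy _)

lemma zero_mem_run (h : IsLabelRun n δ s0 acc w L B p) (hρ : IsRun δ s0 w ρ) (t : ℕ) :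
    0 ∈ L t (ρ t) ∧ 0 ∈ B t (ρ (t + 1)) := by
  have hB : ∀ t, 0 ∈ L t (ρ t) → 0 ∈ B t (ρ (t + 1)) := fun t ht => by
    by_contra h0
    exact h.not_lexBelow hρ t ⟨0, by simp, ht, h0⟩
  have hL : 0 ∈ L t (ρ t) := by
    induction t with
    | zero => exact hρ.1 ▸ h.zero_mem
    | succ t ih => exact h.label_succ t ▸ zero_mem_nextLabel (hB t ih)
  exact ⟨hL, hB t hL⟩

lemma eventually_stable [Finite S] (h : IsLabelRun n δ s0 acc w L B p)
    (hρ : IsRun δ s0 w ρ) {r : ℕ}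
    (hev : ∀ᶠ t in atTop, 2 * r ≤ p t) :
    ∀ᶠ t in atTop, ∀ j < r, j ∈ L t (ρ t) ↔ j ∈ B t (ρ (t + 1)) := by
  have hev' : ∀ᶠ t in atTop, 2 * r ≤ p (t + 1) := (tendsto_add_atTop_nat 1).eventually hev
  suffices hst : ∀ k ≤ r, ∀ᶠ t in atTop, ∀ j < k, j ∈ L t (ρ t) ↔ j ∈ B t (ρ (t + 1)) from
    hst r le_rfl
  intro k hk
  induction k with
  | zero => simp
  | succ k ih =>
    obtain ⟨N, hN⟩ := eventually_atTop.1 ((ih (by omega)).and hev')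
    have hmono : ∀ t, N ≤ t → k ∈ L t (ρ t) → k ∈ B t (ρ (t + 1)) := by
      intro t ht hkt
      by_contra hkB
      exact h.not_lexBelow hρ t ⟨k, (hN t ht).1, hkt, hkB⟩
    have hsucc : ∀ t, N ≤ t → (k ∈ L (t + 1) (ρ (t + 1)) ↔ k ∈ B t (ρ (t + 1))) :=
      fun t ht => h.mem_succ_iff (by have := (hN t ht).2; omega) _
    by_cases hex : ∃ t, N ≤ t ∧ k ∈ L t (ρ t)
    · obtain ⟨M, hM, hkM⟩ := hex
      have hall : ∀ t, M ≤ t → k ∈ L t (ρ t) := by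
        intro t ht
        induction t, ht using Nat.le_induction with
        | base => exact hkM
        | succ t ht ih => exact (hsucc t (by omega)).2 (hmono t (by omega) ih)
      filter_upwards [eventually_ge_atTop M] with t ht j hj
      rcases Nat.lt_succ_iff_lt_or_eq.1 hj with hj | rfl
      · exact (hN t (by omega)).1 j hj
      · exact iff_of_true (hall t ht) (hmono t (by omega) (hall t ht))
    · push Not at hex
      filter_upwards [eventually_ge_atTop N] with t ht j hj
      rcases Nat.lt_succ_iff_lt_or_eq.1 hj with hj | rfl
      · exact (hN t ht).1 j hj
      · exact iff_of_false (hex t ht) fun hB => hex (t + 1) (by omega) ((hsucc t ht).2 hB)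

theorem not_frequently_priority_even [Finite S] (h : IsLabelRun n δ s0 acc w L B p)
    (hρ : IsRun δ s0 w ρ) (hacc : ∃ᶠ t in atTop, ρ t ∈ acc) {r : ℕ}
    (hev : ∀ᶠ t in atTop, 2 * r ≤ p t) : ¬ ∃ᶠ t in atTop, p t = 2 * r := by
  intro hfr
  obtain ⟨N, hN⟩ := eventually_atTop.1 (hev.and (h.eventually_stable hρ hev))
  have hstep : ∀ t, N ≤ t → ∀ j ∈ L t (ρ t), r ≤ j → ∃ j' ∈ L (t + 1) (ρ (t + 1)),
      r ≤ j' ∧ j' ≤ j ∧ (p (t + 1) = 2 * r → j' < j) := by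
    intro t ht j hj hrj
    have hmax := h.not_lexBelow hρ t
    have hB : ∃ i ∈ B t (ρ (t + 1)), r ≤ i ∧ i ≤ j := by
      classical
      by_contra! hno
      have hex : ∃ i, i ∈ L t (ρ t) ∧ r ≤ i := ⟨j, hj, hrj⟩
      obtain ⟨hm, hrm⟩ := Nat.find_spec hex
      have hmj : Nat.find hex ≤ j := Nat.find_min' hex ⟨hj, hrj⟩
      refine hmax ⟨Nat.find hex, fun i hi => ?_, hm, fun hB => ?_⟩
      · by_cases hir : i < r
        · exact (hN t ht).2 i hir
        · refine iff_of_false (fun hL => Nat.find_min hex hi ⟨hL, by omega⟩) fun hB => ?_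
          exact absurd (hno i hB (by omega)) (by omega)
      · exact absurd (hno _ hB hrm) (by omega)
    obtain ⟨i, hi, hri, hij⟩ := hB
    obtain ⟨j', hj', hrj', hj'i, hlt⟩ := exists_mem_nextLabel (acc := acc) (n := n)
      (h.priority_succ t ▸ (hN (t + 1) (by omega)).1) (subset_branch hi) hri
    rw [← h.priority_succ, ← h.label_succ] at *
    exact ⟨j', hj', hrj', hj'i.trans hij, fun hp => (hlt hp).trans_le hij⟩
  have hpersist : ∀ t, N ≤ t → ∀ u, t ≤ u → ∀ j ∈ L t (ρ t), r ≤ j →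
      ∃ j' ∈ L u (ρ u), r ≤ j' ∧ j' ≤ j := by
    intro t ht u hu j hj hrj
    induction u, hu using Nat.le_induction with
    | base => exact ⟨j, hj, hrj, le_rfl⟩
    | succ u hu ih =>
      obtain ⟨j₁, hj₁, hrj₁, hle⟩ := ih
      obtain ⟨j₂, hj₂, hrj₂, hle', -⟩ := hstep u (by omega) j₁ hj₁ hrj₁
      exact ⟨j₂, hj₂, hrj₂, hle'.trans hle⟩
  have hnone : ∀ m, ∀ t, N ≤ t → ∀ j ∈ L t (ρ t), r ≤ j → m ≤ j := by
    intro m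
    induction m with
    | zero => simp
    | succ m ih =>
      intro t ht j hj hrj
      obtain ⟨u, hu, hpu⟩ := frequently_atTop.1 hfr (t + 1)
      obtain ⟨u, rfl⟩ := Nat.exists_eq_succ_of_ne_zero (show u ≠ 0 by omega)
      obtain ⟨j₁, hj₁, hrj₁, hle⟩ := hpersist t ht u (by omega) j hj hrj
      obtain ⟨j₂, hj₂, hrj₂, -, hlt⟩ := hstep u (by omega) j₁ hj₁ hrj₁
      have := ih (u + 1) (by omega) j₂ hj₂ hrj₂
      have := hlt hpu
      omega
  obtain ⟨t, ht, hta⟩ := frequently_atTop.1 hacc (N + 1)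
  obtain ⟨t, rfl⟩ := Nat.exists_eq_succ_of_ne_zero (show t ≠ 0 by omega)
  have hB := (h.zero_mem_run hρ t).2
  have hfresh : n + 1 + (B t (ρ (t + 1))).sup id ∈ branch n acc (B t) (ρ (t + 1)) := by
    unfold branch
    rw [if_pos ⟨hta, 0, hB⟩]
    exact Finset.mem_insert_self _ _
  have hp := (hN (t + 1) (by omega)).1
  have := h.priority_succ_le t
  obtain ⟨j, hj, hrj, -⟩ := exists_mem_nextLabel (h.priority_succ t ▸ hp) hfresh (by omega)
  rw [← h.label_succ] at hj
  exact absurd (hnone (j + 1) (t + 1) (by omega) j hj hrj) (by omega)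

end IsLabelRun

/-- The labels are the ancestor sets of a tree of nodes with root `0`, and each nonroot node is
larger than its parent. -/
structure IsTree {S : Type} (L : S → Finset ℕ) : Prop where
  zero_mem : ∀ x, (L x).Nonempty → 0 ∈ L x
  mem_of_le : ∀ x y r j, r ∈ L x → r ∈ L y → j ≤ r → j ∈ L x → j ∈ L y

/-- The invariant of the states of the deterministic automaton: label assignments describing a
tree with nodes `0, …, k - 1`, all of them owned, with a priority that is at most `2 * k`. -/
structure WellFormed {S : Type} (L : S → Finset ℕ) (p : ℕ) : Prop extends IsTree L where
  owned : ∀ x r j, r ∈ L x → j ≤ r → Owned L j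
  live : ∀ j, 2 * j < p → Live L j
  eq_empty : p = 0 → ∀ x, L x = ∅

lemma IsTree.of_forall_exists {S : Type} {L B : S → Finset ℕ} (h : IsTree L)
    (hB : ∀ y, B y = ∅ ∨ ∃ x, B y = L x) : IsTree B where
  zero_mem y hy := by
    rcases hB y with h' | ⟨x, hx⟩
    · simp [h'] at hy
    · exact hx ▸ h.zero_mem x (hx ▸ hy)
  mem_of_le y z r j := by
    rcases hB y with h' | ⟨x, hx⟩
    · simp [h']
    rcases hB z with h' | ⟨x', hx'⟩
    · simp [h']
    · rw [hx, hx']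
      exact h.mem_of_le x x' r j

lemma le_sup_id {s : Finset ℕ} {r : ℕ} (h : r ∈ s) : r ≤ s.sup id :=
  Finset.le_sup (f := id) h

lemma sup_id_mem {s : Finset ℕ} (h : s.Nonempty) : s.sup id ∈ s := by
  obtain ⟨i, hi, hi'⟩ := Finset.exists_mem_eq_sup s h id
  exact hi' ▸ hi

lemma isTree_branch {S : Type} {n : ℕ} {acc : Set S} {B : S → Finset ℕ} (h : IsTree B)
    (hB : ∀ y, ∀ r ∈ B y, r < n) : IsTree (branch n acc B) where
  zero_mem y hy := by
    obtain ⟨r, hr⟩ := hy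
    exact subset_branch (h.zero_mem y ((mem_branch hr).elim (fun h => ⟨r, h⟩) fun h => h.2.1))
  mem_of_le y z r j hry hrz hjr hjy := by
    rcases mem_branch hry with hry' | ⟨-, hy, hry'⟩ <;>
      rcases mem_branch hrz with hrz' | ⟨-, hz, hrz'⟩
    · have := hB y r hry'
      rw [mem_branch_of_le (by omega)] at hjy ⊢
      exact h.mem_of_le y z r j hry' hrz' hjr hjy
    · have := hB y r hry'
      omega
    · have := hB z r hrz'
      omega
    · rcases mem_branch hjy with hjy' | ⟨-, -, hjy'⟩
      · have hsup : (B y).sup id = (B z).sup id := by omega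
        exact subset_branch (h.mem_of_le y z ((B y).sup id) j (sup_id_mem hy)
          (hsup ▸ sup_id_mem hz) (le_sup_id hjy') hjy')
      · rw [hjy', ← hry']
        exact hrz

lemma isTree_truncate {S : Type} {C : S → Finset ℕ} (h : IsTree C) : IsTree (truncate C) where
  zero_mem y hy := by
    obtain ⟨r, hr⟩ := hy
    exact mem_truncate.2 ⟨h.zero_mem y ⟨r, (mem_truncate.1 hr).1⟩, by simp⟩
  mem_of_le y z r j hy hz hjr hj := by
    rw [mem_truncate] at *
    refine ⟨h.mem_of_le y z r j hy.1 hz.1 hjr hj.1, fun i hi hij => hz.2 i hi (by omega)⟩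

lemma owned_truncate {S : Type} {C : S → Finset ℕ} (h : IsTree C) {r : ℕ}
    (hr : Live (truncate C) r) : Owned (truncate C) r := by
  obtain ⟨x, hx⟩ := hr
  have hx' := mem_truncate.1 hx
  by_cases hown : Owned C r
  · obtain ⟨y, hy, hmax⟩ := hown
    refine ⟨y, mem_truncate.2 ⟨hy, fun i hi hir => hx'.2 i ?_ hir⟩,
      fun i hi => hmax i (mem_truncate.1 hi).1⟩
    exact h.mem_of_le y x r i hy hx'.1 hir.le hi
  · exact ⟨x, hx, fun i hi => not_lt.1 fun hri => hown ((mem_truncate.1 hi).2 r hx'.1 hri)⟩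

lemma isTree_compress {S : Type} {D : S → Finset ℕ} (h : IsTree D) : IsTree (compress D) where
  zero_mem y hy := by
    rw [mem_compress]
    obtain ⟨r, hr⟩ := hy
    obtain ⟨d, hd, -⟩ := mem_compress.1 hr
    exact ⟨0, h.zero_mem y ⟨d, hd⟩, by simp⟩
  mem_of_le y z r j hy hz hjr hj := by
    classical
    rw [mem_compress] at *
    obtain ⟨d, hd, hdr⟩ := hy
    obtain ⟨d', hd', rfl⟩ := hz
    obtain ⟨e, he, rfl⟩ := hj
    obtain rfl : d = d' := Nat.count_injective (p := Live D) ⟨y, hd⟩ ⟨z, hd'⟩ hdr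
    refine ⟨e, h.mem_of_le y z d e hd hd' (not_lt.1 fun hlt => ?_) he, rfl⟩
    exact absurd (Nat.count_strict_mono (p := Live D) ⟨y, hd⟩ hlt) (by omega)

lemma owned_compress {S : Type} {D : S → Finset ℕ} (h : ∀ r, Live D r → Owned D r)
    {x : S} {r j : ℕ} (hr : r ∈ compress D x) (hj : j ≤ r) : Owned (compress D) j := by
  classical
  obtain ⟨d, hd, rfl⟩ := mem_compress.1 hr
  have hlt : j < Nat.count (Live D) (d + 1) := by
    rw [Nat.count_succ, if_pos ⟨x, hd⟩]
    omega
  obtain ⟨e, -, he, rfl⟩ := exists_count_eq hlt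
  obtain ⟨y, hy, hmax⟩ := h e he
  refine ⟨y, mem_compress.2 ⟨e, hy, rfl⟩, fun i hi => ?_⟩
  obtain ⟨d', hd', rfl⟩ := mem_compress.1 hi
  exact Nat.count_monotone _ (hmax d' hd')

lemma WellFormed.next {S : Type} [Finite S] {n : ℕ} {acc : Set S} {B : S → Finset ℕ} (h : IsTree B)
    (hB : ∀ y, ∀ r ∈ B y, r < n) :
    WellFormed (nextLabel n acc B) (priority (branch n acc B)) where
  toIsTree := isTree_compress (isTree_truncate (isTree_branch h hB))
  owned _ _ _ hr hj := owned_compress (fun _ => owned_truncate (isTree_branch h hB)) hr hj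
  live j hj := by
    obtain ⟨y, hy⟩ := live_of_two_mul_lt hj
    exact ⟨y, mem_compress.2 ⟨j, hy, count_eq_self fun i hi => live_of_two_mul_lt (by omega)⟩⟩
  eq_empty hp x := by
    by_contra hx
    obtain ⟨r, hr⟩ := Finset.nonempty_iff_ne_empty.2 hx
    obtain ⟨d, hd, -⟩ := mem_compress.1 hr
    have h0 := (isTree_truncate (isTree_branch h hB)).zero_mem x ⟨d, hd⟩
    have := zero_lt_priority (n := n) (acc := acc)
      ((mem_branch_of_le (Nat.zero_le n)).1 (mem_truncate.1 h0).1)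
    omega

/-- The number of nodes of a tree. -/
noncomputable def nodeCount {S : Type} [Fintype S] (L : S → Finset ℕ) : ℕ :=
  Finset.univ.sup fun x => (L x).sup (· + 1)

lemma lt_nodeCount_iff {S : Type} [Fintype S] {L : S → Finset ℕ} {j : ℕ} :
    j < nodeCount L ↔ ∃ x, ∃ r ∈ L x, j ≤ r := by
  simp [nodeCount, Finset.lt_sup_iff]

namespace WellFormed

variable {S : Type} {L : S → Finset ℕ} {p : ℕ}

lemma owned_of_lt [Fintype S] (h : WellFormed L p) {j : ℕ} (hj : j < nodeCount L) : Owned L j := by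
  obtain ⟨x, r, hr, hjr⟩ := lt_nodeCount_iff.1 hj
  exact h.owned x r j hr hjr

lemma priority_le [Fintype S] (h : WellFormed L p) : p ≤ 2 * nodeCount L := by
  by_contra hlt
  obtain ⟨x, hx⟩ := h.live (nodeCount L) (by omega)
  exact absurd (lt_nodeCount_iff.2 ⟨x, _, hx, le_rfl⟩) (lt_irrefl _)

lemma nodeCount_add_card_le [Fintype S] (h : WellFormed L p) (s : Finset S)
    (hs : ∀ x ∈ s, L x = ∅) :
    nodeCount L + s.card ≤ Fintype.card S := by
  classical
  choose f hf hmax using fun j : Fin (nodeCount L) => h.owned_of_lt j.2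
  have hinj : Function.Injective f := fun i j hij => by
    have h₁ := hmax i j (hij ▸ hf j)
    have h₂ := hmax j i (hij ▸ hf i)
    exact Fin.ext (by omega)
  have hdisj : Disjoint (Finset.univ.image f) s := by
    rw [Finset.disjoint_left]
    intro x hx hxs
    obtain ⟨j, -, rfl⟩ := Finset.mem_image.1 hx
    simpa [hs _ hxs] using hf j
  have := Finset.card_le_univ (Finset.univ.image f ∪ s)
  rwa [Finset.card_union_of_disjoint hdisj, Finset.card_image_of_injective _ hinj,
    Finset.card_univ, Fintype.card_fin] at this

lemma nodeCount_le [Fintype S] (h : WellFormed L p) : nodeCount L ≤ Fintype.card S := by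
  simpa using h.nodeCount_add_card_le ∅ (by simp)

lemma lt_card [Fintype S] (h : WellFormed L p) {x : S} {r : ℕ} (hr : r ∈ L x) :
    r < Fintype.card S :=
  (lt_nodeCount_iff.2 ⟨x, r, hr, le_rfl⟩).trans_le h.nodeCount_le

lemma pos (h : WellFormed L p) {x : S} (hx : (L x).Nonempty) : 0 < p :=
  Nat.pos_of_ne_zero fun hp => hx.ne_empty (h.eq_empty hp x)

lemma nodeCount_pos [Fintype S] {x : S} (hx : (L x).Nonempty) : 0 < nodeCount L :=
  lt_nodeCount_iff.2 ⟨x, _, hx.choose_spec, Nat.zero_le _⟩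

end WellFormed

open Classical in
/-- The parent of the node `r`. -/
noncomputable def parent {S : Type} (L : S → Finset ℕ) (r : ℕ) : ℕ :=
  ((Finset.range r).filter fun j => ∃ x, r ∈ L x ∧ j ∈ L x).sup id

lemma parent_succ_le {S : Type} (L : S → Finset ℕ) (i : ℕ) : parent L (i + 1) ≤ i := by
  classical
  refine Finset.sup_le fun j hj => ?_
  have := Finset.mem_range.1 (Finset.mem_filter.1 hj).1
  exact Nat.lt_succ_iff.1 this

lemma IsTree.parent_spec {S : Type} {L : S → Finset ℕ} (h : IsTree L) {x : S} {r j : ℕ}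
    (hr : r ∈ L x) (hj : j ∈ L x) (hjr : j < r) :
    parent L r ∈ L x ∧ j ≤ parent L r ∧ parent L r < r := by
  classical
  have hmem : j ∈ (Finset.range r).filter fun j => ∃ x, r ∈ L x ∧ j ∈ L x :=
    Finset.mem_filter.2 ⟨Finset.mem_range.2 hjr, x, hr, hj⟩
  have hpar : parent L r ∈ (Finset.range r).filter fun j => ∃ x, r ∈ L x ∧ j ∈ L x := by
    exact sup_id_mem ⟨j, hmem⟩
  obtain ⟨hlt, y, hry, hy⟩ := Finset.mem_filter.1 hpar
  have hlt := Finset.mem_range.1 hlt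
  exact ⟨h.mem_of_le y x r _ hry hr hlt.le hy, le_sup_id hmem, hlt⟩

lemma IsTree.subset {S : Type} {L L' : S → Finset ℕ} (h : IsTree L) (h' : IsTree L')
    (hpar : ∀ r, 0 < r → Live L r → Live L' r → parent L r = parent L' r)
    {x : S} (hne : (L x).Nonempty) (hne' : (L' x).Nonempty)
    (hsup : (L x).sup id = (L' x).sup id) : L x ⊆ L' x := by
  have key : ∀ r, r ∈ L x → r ∈ L' x → ∀ j ≤ r, j ∈ L x → j ∈ L' x := by
    intro r
    induction r using Nat.strong_induction_on with
    | _ r ih =>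
      intro hr hr' j hjr hj
      rcases hjr.eq_or_lt with rfl | hlt
      · exact hr'
      obtain ⟨hm, hle, hmr⟩ := h.parent_spec hr hj hlt
      have hm' := (h'.parent_spec hr' (h'.zero_mem x hne') (by omega)).1
      rw [← hpar r (by omega) ⟨x, hr⟩ ⟨x, hr'⟩] at hm'
      exact ih _ hmr hm hm' j hle hj
  exact fun j hj => key _ (sup_id_mem hne) (hsup ▸ sup_id_mem hne') j (le_sup_id hj) hj

lemma IsTree.ext {S : Type} {L L' : S → Finset ℕ} (h : IsTree L) (h' : IsTree L')
    (hpar : ∀ r, 0 < r → Live L r → Live L' r → parent L r = parent L' r)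
    (hne : ∀ x, (L x).Nonempty ↔ (L' x).Nonempty)
    (hsup : ∀ x, (L x).Nonempty → (L x).sup id = (L' x).sup id) : L = L' := by
  funext x
  by_cases hx : (L x).Nonempty
  · exact Finset.Subset.antisymm (h.subset h' hpar hx ((hne x).1 hx) (hsup x hx))
      (h'.subset h (fun r hr h₁ h₂ => (hpar r hr h₂ h₁).symm) ((hne x).1 hx) hx (hsup x hx).symm)
  · rw [Finset.not_nonempty_iff_eq_empty.1 hx,
      Finset.not_nonempty_iff_eq_empty.1 fun hx' => hx ((hne x).2 hx')]

/-- The triple `f`, `g`, `b` encodes the label assignment `L` and the priority `p`. The function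
`g` lists the parents of the nodes and half of the priority. If all states are labelled, `f` maps
states to their innermost nodes. If only some are, `f` avoids `0`, and the name of one unlabelled
state is stored in `g`. -/
inductive IsCode {S : Type} [Fintype S] {n : ℕ} (e : S ≃ Fin n) (L : S → Finset ℕ) (p : ℕ)
    (f : S → ℕ) (g : ℕ → ℕ) (b : Bool) : Prop
  | empty (hL : ∀ x, L x = ∅) (hf : ∀ x, f x = 0) (hg : g (n - 1) = n - 1)
  | covered (hL : ∀ x, (L x).Nonempty) (hf : ∀ x, f x = (L x).sup id)
      (hp : g (n - 1) = (p - 1) / 2) (hg : ∀ i, i + 1 < n → g i = parent L (i + 1))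
      (hb : b = decide (Odd p))
  | uncovered (x₀ : S) (hx₀ : L x₀ = ∅) (hne : ∃ x, (L x).Nonempty) (hf₀ : f x₀ = nodeCount L)
      (hf : ∀ x, (L x).Nonempty → f x = (L x).sup id + 1)
      (hf' : ∀ x, x ≠ x₀ → L x = ∅ → f x = nodeCount L + 1)
      (he : g (n - 1) = e x₀) (hp : g (n - 2) = (p - 1) / 2)
      (hg : ∀ i, i + 2 < n → g i = parent L (i + 1)) (hb : b = decide (Odd p))

lemma WellFormed.exists_isCode {S : Type} [Fintype S] {n : ℕ} (hn : 2 ≤ n) (e : S ≃ Fin n)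
    {L : S → Finset ℕ} {p : ℕ} (h : WellFormed L p) :
    ∃ f g b, (∀ x, f x < n) ∧ (∀ i, g i ≤ i) ∧ IsCode e L p f g b := by
  classical
  have hcard : Fintype.card S = n := by simpa using Fintype.card_congr e
  have hp := h.priority_le
  by_cases hne : ∃ x, (L x).Nonempty
  · by_cases hcov : ∀ x, (L x).Nonempty
    · have hk := hcard ▸ h.nodeCount_le
      refine ⟨fun x => (L x).sup id,
        fun i => if i + 1 = n then (p - 1) / 2 else parent L (i + 1), _,
        fun x => hcard ▸ h.lt_card (sup_id_mem (hcov x)), fun i => ?_,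
        .covered hcov (fun _ => rfl) ?_ (fun i hi => if_neg (by omega)) rfl⟩
      · dsimp only
        split_ifs
        · omega
        · exact parent_succ_le L i
      · exact if_pos (by omega)
    · push Not at hcov
      obtain ⟨x₀, hx₀⟩ := hcov
      have hk := h.nodeCount_add_card_le {x₀} (by simpa using hx₀)
      rw [hcard, Finset.card_singleton] at hk
      refine ⟨fun x => if x = x₀ then nodeCount L else
          if L x = ∅ then nodeCount L + 1 else (L x).sup id + 1,
        fun i => if i + 1 = n then min (e x₀) i else
          if i + 2 = n then (p - 1) / 2 else parent L (i + 1), _,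
        fun x => ?_, fun i => ?_, .uncovered x₀ hx₀ hne (if_pos rfl) (fun x hx => ?_)
          (fun x hx hx' => ?_) ?_ ?_ (fun i hi => ?_) rfl⟩
      · dsimp only
        split_ifs with h₁ h₂
        · omega
        · have := h.nodeCount_add_card_le {x₀, x} (by simp [hx₀, h₂])
          rw [hcard, Finset.card_pair (Ne.symm h₁)] at this
          omega
        · have := lt_nodeCount_iff.2
            ⟨x, _, sup_id_mem (Finset.nonempty_iff_ne_empty.2 h₂), le_rfl⟩
          omega
      · dsimp only
        split_ifs
        · exact min_le_right _ _
        · omega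
        · exact parent_succ_le L i
      · have : x ≠ x₀ := fun h => by simp [h, hx₀] at hx
        simp [this, hx.ne_empty]
      · simp [hx, hx']
      · have := (e x₀).2
        rw [if_pos (by omega)]
        omega
      · rw [if_neg (by omega), if_pos (by omega)]
      · rw [if_neg (by omega), if_neg (by omega)]
  · push Not at hne
    exact ⟨fun _ => 0, id, true, fun _ => by dsimp only; omega, fun _ => le_rfl,
      .empty hne (fun _ => rfl) rfl⟩

lemma priority_eq_of_code {p p' : ℕ} (hp : 0 < p) (hp' : 0 < p')
    (hdiv : (p - 1) / 2 = (p' - 1) / 2) (hodd : decide (Odd p) = decide (Odd p')) : p = p' := by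
  simp only [decide_eq_decide, Nat.odd_iff] at hodd
  omega

namespace IsCode

variable {S : Type} {n : ℕ} {e : S ≃ Fin n} {L L' : S → Finset ℕ} {p p' : ℕ}
  {f : S → ℕ} {g : ℕ → ℕ} {b : Bool}

lemma eq_of_empty (hL : ∀ x, L x = ∅) (hL' : ∀ x, L' x = ∅) (h : WellFormed L p)
    (h' : WellFormed L' p') : L = L' ∧ p = p' := by
  have hk : ∀ {L : S → Finset ℕ} {p}, (∀ x, L x = ∅) → WellFormed L p → p = 0 := by
    intro L p hL h
    by_contra hp
    obtain ⟨x, hx⟩ := h.live 0 (by omega)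
    simp [hL x] at hx
  exact ⟨funext fun x => (hL x).trans (hL' x).symm, (hk hL h).trans (hk hL' h').symm⟩

lemma exists_eq_zero [Fintype S] {x : S} (h : WellFormed L p) (hx : (L x).Nonempty)
    (hf : ∀ x, f x = (L x).sup id) : ∃ x, f x = 0 := by
  obtain ⟨y, -, hmax⟩ := h.owned_of_lt (WellFormed.nodeCount_pos hx)
  exact ⟨y, by rw [hf]; exact Nat.le_zero.1 (Finset.sup_le hmax)⟩

lemma ne_zero [Fintype S] (hne : ∃ x, (L x).Nonempty) {x₀ : S} (hf₀ : f x₀ = nodeCount L)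
    (hf : ∀ x, (L x).Nonempty → f x = (L x).sup id + 1)
    (hf' : ∀ x, x ≠ x₀ → L x = ∅ → f x = nodeCount L + 1) (x : S) : f x ≠ 0 := by
  obtain ⟨y, hy⟩ := hne
  have := WellFormed.nodeCount_pos hy
  by_cases hx : x = x₀
  · rw [hx]; omega
  · rcases (L x).eq_empty_or_nonempty with h | h
    · rw [hf' x hx h]; omega
    · rw [hf x h]; omega

lemma not_covered_of_empty (hn : 2 ≤ n) (h : WellFormed L p)
    (hf : ∀ x, f x = (L x).sup id) (hp : g (n - 1) = (p - 1) / 2) (hf₀ : ∀ x, f x = 0)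
    (hg : g (n - 1) = n - 1) : False := by
  obtain ⟨x, hx⟩ := h.live 1 (by omega)
  have := le_sup_id hx
  have := hf₀ x
  have := hf x
  omega

lemma uncovered_nonempty_iff [Fintype S] {x₀ : S} (hx₀ : L x₀ = ∅) (hf₀ : f x₀ = nodeCount L)
    (hf : ∀ x, (L x).Nonempty → f x = (L x).sup id + 1)
    (hf' : ∀ x, x ≠ x₀ → L x = ∅ → f x = nodeCount L + 1) (x : S) :
    (L x).Nonempty ↔ x ≠ x₀ ∧ f x ≤ f x₀ := by
  constructor
  · intro hx
    refine ⟨fun h => by simp [h, hx₀] at hx, ?_⟩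
    have := lt_nodeCount_iff.2 ⟨x, _, sup_id_mem hx, le_rfl⟩
    rw [hf x hx, hf₀]
    omega
  · rintro ⟨hx, hle⟩
    by_contra hxe
    rw [hf' x hx (Finset.not_nonempty_iff_eq_empty.1 hxe)] at hle
    omega

theorem unique [Fintype S] (hn : 2 ≤ n) (h : WellFormed L p) (h' : WellFormed L' p')
    (hc : IsCode e L p f g b) (hc' : IsCode e L' p' f g b) : L = L' ∧ p = p' := by
  have hcard : Fintype.card S = n := by simpa using Fintype.card_congr e
  have x : S := e.symm ⟨0, by omega⟩
  cases hc with
  | empty hL hf hg =>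
    cases hc' with
    | empty hL' hf' hg' => exact eq_of_empty hL hL' h h'
    | covered hL' hf' hp' hg' hb' => exact (not_covered_of_empty hn h' hf' hp' hf hg).elim
    | uncovered x₀ hx₀ hne hf₀ hf' hf'' he hp hg' hb =>
      exact absurd (hf x) (ne_zero hne hf₀ hf' hf'' x)
  | covered hL hf hp hg hb =>
    cases hc' with
    | empty hL' hf' hg' => exact (not_covered_of_empty hn h hf hp hf' hg').elim
    | covered hL' hf' hp' hg' hb' =>
      refine ⟨h.toIsTree.ext h'.toIsTree (fun r hr ⟨y, hy⟩ _ => ?_)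
        (fun y => iff_of_true (hL y) (hL' y)) fun y _ => (hf y).symm.trans (hf' y), ?_⟩
      · obtain ⟨r, rfl⟩ := Nat.exists_eq_succ_of_ne_zero hr.ne'
        have hlt := hcard ▸ h.lt_card hy
        exact (hg r hlt).symm.trans (hg' r hlt)
      · exact priority_eq_of_code (h.pos (hL x)) (h'.pos (hL' x)) (hp.symm.trans hp')
          (hb.symm.trans hb')
    | uncovered x₀ hx₀ hne hf₀ hf' hf'' he hp hg' hb =>
      obtain ⟨y, hy⟩ := exists_eq_zero h (hL x) hf
      exact absurd hy (ne_zero hne hf₀ hf' hf'' y)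
  | uncovered x₀ hx₀ hne hf₀ hf hf' he hp hg hb =>
    cases hc' with
    | empty hL' hf₁ hg' => exact absurd (hf₁ x) (ne_zero hne hf₀ hf hf' x)
    | covered hL' hf₁ hp' hg' hb' =>
      obtain ⟨y, hy⟩ := exists_eq_zero h' (hL' x) hf₁
      exact absurd hy (ne_zero hne hf₀ hf hf' y)
    | uncovered x₁ hx₁ hne' hf₁ hf₂ hf₂' he' hp' hg' hb' =>
      obtain rfl : x₀ = x₁ := e.injective (Fin.ext (he.symm.trans he'))
      have hiff : ∀ y, (L y).Nonempty ↔ (L' y).Nonempty := fun y =>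
        (uncovered_nonempty_iff hx₀ hf₀ hf hf' y).trans
          (uncovered_nonempty_iff hx₁ hf₁ hf₂ hf₂' y).symm
      refine ⟨h.toIsTree.ext h'.toIsTree (fun r hr ⟨y, hy⟩ _ => ?_) hiff fun y hy => ?_, ?_⟩
      · obtain ⟨r, rfl⟩ := Nat.exists_eq_succ_of_ne_zero hr.ne'
        have hlt := lt_nodeCount_iff.2 ⟨y, _, hy, le_rfl⟩
        have hk := h.nodeCount_add_card_le {x₀} (by simpa using hx₀)
        rw [hcard, Finset.card_singleton] at hk
        exact (hg r (by omega)).symm.trans (hg' r (by omega))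
      · have h₁ := hf y hy
        have h₂ := hf₂ y ((hiff y).1 hy)
        omega
      · obtain ⟨y, hy⟩ := hne
        exact priority_eq_of_code (h.pos hy) (h'.pos ((hiff y).1 hy)) (hp.symm.trans hp')
          (hb.symm.trans hb')

end IsCode

/-- The states of the deterministic automaton. -/
abbrev TreeState (S : Type) : Type := {q : (S → Finset ℕ) × ℕ // WellFormed q.1 q.2}

lemma exists_injective_code {S : Type} [Fintype S] {n : ℕ} (hn : 2 ≤ n)
    (hcard : Fintype.card S = n) :
    ∃ c : TreeState S → (S → Fin n) × ((i : Fin n) → Fin (i + 1)) × Bool,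
      Function.Injective c := by
  have e : S ≃ Fin n := Fintype.equivFinOfCardEq hcard
  have hex : ∀ q : TreeState S, ∃ c : (S → Fin n) × ((i : Fin n) → Fin (i + 1)) × Bool,
      IsCode e q.1.1 q.1.2 (fun x => c.1 x)
        (fun i => if h : i < n then c.2.1 ⟨i, h⟩ else i) c.2.2 := by
    rintro ⟨⟨L, p⟩, h⟩
    obtain ⟨f, g, b, hf, hg, hc⟩ := h.exists_isCode hn e
    refine ⟨(fun x => ⟨f x, hf x⟩, fun i => ⟨g i, Nat.lt_succ_of_le (hg i)⟩, b), ?_⟩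
    have hg' : ∀ i < n, (if h : i < n then g i else i) = g i := fun i hi => by simp [hi]
    cases hc with
    | empty hL hf hg => exact .empty hL hf ((hg' (n - 1) (by omega)).trans hg)
    | covered hL hf hp hg hb =>
      exact .covered hL hf ((hg' (n - 1) (by omega)).trans hp)
        (fun i hi => (hg' i (by omega)).trans (hg i hi)) hb
    | uncovered x₀ hx₀ hne hf₀ hf hf' he hp hg hb =>
      exact .uncovered x₀ hx₀ hne hf₀ hf hf' ((hg' (n - 1) (by omega)).trans he)
        ((hg' (n - 2) (by omega)).trans hp)
        (fun i hi => (hg' i (by omega)).trans (hg i hi)) hb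
  choose c hc using hex
  refine ⟨c, fun q q' hqq => ?_⟩
  have hq := hc q
  rw [hqq] at hq
  obtain ⟨h₁, h₂⟩ := hq.unique hn q.2 q'.2 (hc q')
  exact Subtype.ext (Prod.ext h₁ h₂)

lemma card_code {S : Type} [Fintype S] [DecidableEq S] {n : ℕ} (hcard : Fintype.card S = n) :
    Fintype.card ((S → Fin n) × ((i : Fin n) → Fin (i + 1)) × Bool) =
      2 * n ^ n * n.factorial := by
  simp only [Fintype.card_prod, Fintype.card_fun, Fintype.card_pi, Fintype.card_fin,
    Fintype.card_bool, hcard]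
  rw [Fin.prod_univ_eq_prod_range (fun i => i + 1) n, Finset.prod_range_add_one_eq_factorial]
  ring

lemma infOcc_inter_nonempty_iff {S : Type} [Finite S] (r : ℕ → S) (X : Set S) :
    (InfOcc r ∩ X).Nonempty ↔ ∃ᶠ t in atTop, r t ∈ X := by
  have hmem : ∀ s, s ∈ InfOcc r ↔ ∃ᶠ t in atTop, r t = s := fun s =>
    frequently_atTop.symm
  constructor
  · rintro ⟨s, hs, hsX⟩
    exact ((hmem s).1 hs).mono fun t ht => ht ▸ hsX
  · intro h
    by_contra hno
    have hall : ∀ s, ∀ᶠ t in atTop, r t = s → s ∉ X := by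
      intro s
      by_cases hsX : s ∈ X
      · have : s ∉ InfOcc r := fun hs => hno ⟨s, hs, hsX⟩
        rw [hmem, not_frequently] at this
        exact this.mono fun t ht hts => absurd hts ht
      · exact Eventually.of_forall fun _ _ => hsX
    exact h ((eventually_all.2 hall).mono fun t ht => ht (r t) rfl)

lemma inter_eq_empty_iff {S : Type} [Finite S] (r : ℕ → S) (X : Set S) :
    InfOcc r ∩ X = ∅ ↔ ∀ᶠ t in atTop, r t ∉ X := by
  rw [← Set.not_nonempty_iff_eq_empty, infOcc_inter_nonempty_iff, not_frequently]

lemma isPartition_fibers {T : Type} {m : ℕ} (q : T → ℕ) (hq : ∀ t, q t < m) :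
    IsPartition fun i : Fin m => {t | q t = i} := by
  refine ⟨fun i j hij => ?_, ?_⟩
  · refine Set.eq_empty_of_forall_notMem fun t ⟨hi, hj⟩ => hij (Fin.ext ?_)
    exact (show q t = i from hi).symm.trans hj
  · exact Set.eq_univ_of_forall fun t => Set.mem_iUnion.2 ⟨⟨q t, hq t⟩, rfl⟩

lemma parityAccept_fibers_iff {T : Type} [Finite T] {m : ℕ} (q : T → ℕ) (hq : ∀ t, q t < m)
    (r : ℕ → T) :
    ParityAccept (fun i : Fin m => {t | q t = i}) r ↔
      ∃ i, Even i ∧ (∃ᶠ t in atTop, q (r t) = i) ∧ ∀ᶠ t in atTop, i ≤ q (r t) := by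
  simp only [ParityAccept, infOcc_inter_nonempty_iff, inter_eq_empty_iff, Set.mem_ofPred_eq]
  constructor
  · rintro ⟨i, hi, hfr, hlt⟩
    refine ⟨i, hi, hfr, ?_⟩
    filter_upwards [eventually_all.2 fun j => eventually_imp_distrib_left.2 (hlt j)] with t ht
    by_contra hlt'
    exact ht ⟨q (r t), hq _⟩ (by simpa [Fin.lt_def] using hlt') rfl
  · rintro ⟨i, hi, hfr, hle⟩
    have him : i < m := by
      obtain ⟨t, ht⟩ := hfr.exists
      exact ht ▸ hq _
    refine ⟨⟨i, him⟩, hi, hfr, fun j hj => hle.mono fun t ht hne => ?_⟩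
    have : (j : ℕ) < i := hj
    omega

lemma exists_frequently_eq_eventually_le {p : ℕ → ℕ} {m : ℕ} (hp : ∀ t, p t < m) :
    ∃ i, (∃ᶠ t in atTop, p t = i) ∧ ∀ᶠ t in atTop, i ≤ p t := by
  classical
  have hex : ∃ i, ∃ᶠ t in atTop, p t = i := by
    by_contra hno
    rw [not_exists] at hno
    have : ∀ᶠ t in atTop, ∀ i : Fin m, p t ≠ i :=
      eventually_all.2 fun i => not_frequently.1 (hno i)
    obtain ⟨t, ht⟩ := this.exists
    exact ht ⟨p t, hp t⟩ rfl
  refine ⟨Nat.find hex, Nat.find_spec hex, ?_⟩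
  have : ∀ᶠ t in atTop, ∀ i : Fin (Nat.find hex), p t ≠ i :=
    eventually_all.2 fun i => not_frequently.1 (Nat.find_min hex i.2)
  exact this.mono fun t ht => not_lt.1 fun hlt => ht ⟨p t, hlt⟩ rfl

lemma mem_buchiLang_iff {A S : Type} [Finite S] {δ : S → A → Set S} {s0 : S} {acc : Set S}
    {w : ℕ → A} : w ∈ BuchiLang δ s0 acc ↔ ∃ r, IsRun δ s0 w r ∧ ∃ᶠ t in atTop, r t ∈ acc := by
  simp [BuchiLang, infOcc_inter_nonempty_iff]

theorem IsLabelRun.notMem_buchiLang_iff {A S : Type} [Finite S] {n : ℕ} {δ : S → A → Set S}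
    {s0 : S} {acc : Set S} {w : ℕ → A} {L B : ℕ → S → Finset ℕ} {p : ℕ → ℕ} {m : ℕ}
    (h : IsLabelRun n δ s0 acc w L B p) (hp : ∀ t, p t < m) :
    w ∉ BuchiLang δ s0 acc ↔
      ∃ i, Even i ∧ (∃ᶠ t in atTop, p t = i) ∧ ∀ᶠ t in atTop, i ≤ p t := by
  rw [mem_buchiLang_iff]
  constructor
  · intro hw
    obtain ⟨i, hfr, hle⟩ := exists_frequently_eq_eventually_le hp
    refine ⟨i, ?_, hfr, hle⟩
    by_contra hodd
    obtain ⟨r, rfl⟩ := Nat.not_even_iff_odd.1 hodd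
    exact hw (h.mem_buchiLang hle hfr)
  · rintro ⟨i, hi, hfr, hle⟩ ⟨ρ, hρ, hacc⟩
    obtain ⟨r, rfl⟩ := hi.exists_two_nsmul
    rw [smul_eq_mul] at hfr hle
    exact h.not_frequently_priority_even hρ hacc hle hfr

lemma IsMaxPred.eq_empty_or_exists {A S : Type} {δ : S → A → Set S} {a : A}
    {L B : S → Finset ℕ} (h : IsMaxPred δ a L B) (y : S) : B y = ∅ ∨ ∃ x, B y = L x :=
  (h y).symm.imp And.left fun ⟨x, hx⟩ => ⟨x, hx.2.1⟩

/-- The transition function of the deterministic automaton. -/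
noncomputable def TreeState.step {A S : Type} [Fintype S] (δ : S → A → Set S) (acc : Set S)
    (q : TreeState S) (a : A) : TreeState S :=
  ⟨(nextLabel (Fintype.card S) acc (maxPred δ a q.1.1),
      priority (branch (Fintype.card S) acc (maxPred δ a q.1.1))),
    .next (q.2.toIsTree.of_forall_exists (isMaxPred_maxPred δ a q.1.1).eq_empty_or_exists)
      fun y r hr => by
        rcases (isMaxPred_maxPred δ a q.1.1).eq_empty_or_exists y with h | ⟨x, hx⟩
        · simp [h] at hr
        · exact q.2.lt_card (hx ▸ hr)⟩

open Classical in
/-- The initial state of the deterministic automaton. -/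
noncomputable def TreeState.init {S : Type} (s0 : S) : TreeState S :=
  ⟨(fun y => if y = s0 then {0} else ∅, 2), by
    have hmem : ∀ {x : S} {r : ℕ}, r ∈ (if x = s0 then ({0} : Finset ℕ) else ∅) ↔
        x = s0 ∧ r = 0 := fun {x r} => by split_ifs with h <;> simp [h]
    refine ⟨⟨fun x ⟨r, hr⟩ => ?_, fun x y r j hx hy _ hj => ?_⟩, fun x r j hr hj => ?_,
      fun j hj => ?_, by simp⟩
    · exact hmem.2 ⟨(hmem.1 hr).1, rfl⟩
    · exact hmem.2 ⟨(hmem.1 hy).1, (hmem.1 hj).2⟩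
    · obtain rfl : j = 0 := by have := (hmem.1 hr).2; omega
      exact ⟨x, hmem.2 ⟨(hmem.1 hr).1, rfl⟩, fun i hi => (hmem.1 hi).2.le⟩
    · exact ⟨s0, hmem.2 ⟨rfl, by omega⟩⟩⟩

lemma isLabelRun_detRun {A S : Type} [Fintype S] (δ : S → A → Set S) (s0 : S) (acc : Set S)
    (w : ℕ → A) :
    IsLabelRun (Fintype.card S) δ s0 acc w
      (fun t => (DetRun (TreeState.step δ acc) (.init s0) w t).1.1)
      (fun t => maxPred δ (w t) (DetRun (TreeState.step δ acc) (.init s0) w t).1.1)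
      (fun t => (DetRun (TreeState.step δ acc) (.init s0) w t).1.2) where
  isMaxPred _ := isMaxPred_maxPred _ _ _
  label_succ _ := rfl
  priority_succ _ := rfl
  lt_card t _ _ hr := (DetRun (TreeState.step δ acc) (.init s0) w t).2.lt_card hr
  zero_mem := by simp [DetRun, TreeState.init]
  eq_init y hy := by
    by_contra hne
    simp [DetRun, TreeState.init, hne] at hy

lemma TreeState.priority_lt {S : Type} [Fintype S] (q : TreeState S) :
    q.1.2 < 2 * Fintype.card S + 1 := by
  have h₁ := q.2.priority_le
  have h₂ := q.2.nodeCount_le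
  omega

/-- A nondeterministic automaton with a single state accepts either no word at all or the words
that never leave the state. -/
lemma exists_dpw_of_subsingleton {A S : Type} [Subsingleton S] (δ : S → A → Set S) (s0 : S)
    (acc : Set S) :
    ∃ (δ' : Bool → A → Bool) (F : Fin 2 → Set Bool), IsPartition F ∧
      {w : ℕ → A | ParityAccept F (DetRun δ' true w)} = (BuchiLang δ s0 acc)ᶜ := by
  classical
  let q : Bool → ℕ := fun b => if b = true ∧ s0 ∈ acc then 1 else 0
  have hq : ∀ b, q b < 2 := fun b => by simp only [q]; split_ifs <;> omega
  let δ' : Bool → A → Bool := fun b a => b && decide (s0 ∈ δ s0 a)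
  refine ⟨δ', fun i => {b | q b = i}, isPartition_fibers q hq, ?_⟩
  ext w
  rw [Set.mem_ofPred_eq, parityAccept_fibers_iff q hq, Set.mem_compl_iff, mem_buchiLang_iff]
  have hrun : ∀ t, DetRun δ' true w t = true ↔ ∀ j < t, s0 ∈ δ s0 (w j) := by
    intro t
    induction t with
    | zero => simp [DetRun]
    | succ t ih =>
      simp only [DetRun, δ', Bool.and_eq_true, decide_eq_true_eq, Nat.lt_succ_iff_lt_or_eq]
      rw [ih]
      exact ⟨fun ⟨h, h'⟩ j hj => hj.elim (h j) fun hj => hj ▸ h',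
        fun h => ⟨fun j hj => h j (.inl hj), h t (.inr rfl)⟩⟩
  by_cases hL : s0 ∈ acc ∧ ∀ j, s0 ∈ δ s0 (w j)
  · refine iff_of_false ?_ (not_not.2 ⟨fun _ => s0, ⟨rfl, hL.2⟩, ?_⟩)
    · rintro ⟨i, hi, hfr, -⟩
      obtain ⟨t, ht⟩ := hfr.exists
      have : q (DetRun δ' true w t) = 1 := if_pos ⟨(hrun t).2 fun j _ => hL.2 j, hL.1⟩
      rw [← ht, this] at hi
      exact absurd hi (by decide)
    · exact Frequently.of_forall fun _ => hL.1
  · refine iff_of_true ⟨0, by simp, ?_, by simp⟩ ?_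
    · refine Eventually.frequently ?_
      by_cases hacc : s0 ∈ acc
      · have : ∃ j, s0 ∉ δ s0 (w j) := by
          by_contra! h
          exact hL ⟨hacc, h⟩
        obtain ⟨j, hj⟩ := this
        filter_upwards [eventually_gt_atTop j] with t ht
        exact if_neg fun h => hj ((hrun t).1 h.1 j ht)
      · exact Eventually.of_forall fun t => if_neg fun h => hacc h.2
    · rintro ⟨ρ, hρ, hacc⟩
      obtain ⟨t, ht⟩ := hacc.exists
      refine hL ⟨Subsingleton.elim (ρ t) s0 ▸ ht, fun j => ?_⟩
      have := hρ.2 j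
      rwa [Subsingleton.elim (ρ (j + 1)) s0, Subsingleton.elim (ρ j) s0] at this

/-- For every nondeterministic Büchi word automaton `N` with
`n ≥ 1` states over alphabet `Σ` there exists a deterministic parity word
automaton `D` with at most `2·n^n·n!` states and parity index at most `2n+1`
such that `L(D) = Σ^ω ∖ L(N)`. -/
theorem nbw_to_dpw_complement (A : Type) [Fintype A] (S : Type) [Fintype S] (n : ℕ)
    (hn : 1 ≤ n) (hcard : Fintype.card S = n)
    (δ : S → A → Set S) (s0 : S) (acc : Set S) :
    ∃ (T : Type) (instT : Fintype T) (δ' : T → A → T) (t0 : T)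
      (m : ℕ) (F : Fin m → Set T),
      @Fintype.card T instT ≤ 2 * n ^ n * n.factorial ∧
      m ≤ 2 * n + 1 ∧
      IsPartition F ∧
      {w : ℕ → A | ParityAccept F (DetRun δ' t0 w)} = (BuchiLang δ s0 acc)ᶜ := by
  classical
  rcases hn.eq_or_lt with rfl | hn
  · have : Subsingleton S := Fintype.card_le_one_iff_subsingleton.1 hcard.le
    obtain ⟨δ', F, hF, hlang⟩ := exists_dpw_of_subsingleton δ s0 acc
    exact ⟨Bool, inferInstance, δ', true, 2, F, by simp, by simp, hF, hlang⟩
  · obtain ⟨c, hc⟩ := exists_injective_code hn hcard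
    let instT : Fintype (TreeState S) := Fintype.ofInjective c hc
    refine ⟨TreeState S, instT, TreeState.step δ acc, .init s0, 2 * n + 1,
      fun i => {q | q.1.2 = i}, ?_, le_rfl, ?_, ?_⟩
    · exact (Fintype.card_le_of_injective c hc).trans (card_code hcard).le
    · exact isPartition_fibers (fun q : TreeState S => q.1.2) fun q => hcard ▸ q.priority_lt
    · ext w
      rw [Set.mem_ofPred_eq, Set.mem_compl_iff,
        (isLabelRun_detRun δ s0 acc w).notMem_buchiLang_iff fun t => TreeState.priority_lt _]
      exact parityAccept_fibers_iff (fun q : TreeState S => q.1.2)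
        (fun q => hcard ▸ q.priority_lt) _
end

section
/- For every nondeterministic Streett word automaton S with n ≥ 1 states and k pairs over alphabet Σ there exists a deterministic parity word automaton D with at most 2·n^n·(k+1)^{n(k+1)}·(n(k+1))! states and parity index at most 2n(k+1)+1 such that L(D) = Σ^ω ∖ L(S). -/
namespace StreettDet

/-- A branch of a Streett–Safra tree, read from the root: each entry is the index the node is
waiting for (`0` if none) together with the name of the node. -/
abbrev Branch := List (ℕ × ℕ)

/-- The indices in `1, …, k` that no node on the branch is waiting for. -/
def avail (k : ℕ) (x : Branch) : Finset ℕ :=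
  Finset.Icc 1 k \ (x.map Prod.fst).toFinset

/-- The largest available index below `j`, or `0` if there is none. -/
def nextIndex (k : ℕ) (x : Branch) (j : ℕ) : ℕ :=
  ((avail k x).filter (· < j)).sup id

/-- A name, not below `N`, for the new node with index `j` under the node `x`. -/
def freshName (N : ℕ) (x : Branch) (j : ℕ) : ℕ :=
  N + Encodable.encode (x, j)

/-- Extends a branch by a new node with index `j`. -/
def addNode (N : ℕ) (x : Branch) (j : ℕ) : Branch :=
  x ++ [(j, freshName N x j)]

/-- Extends a branch by up to `f` new nodes, each waiting for the largest available index. -/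
def expand (k N : ℕ) : ℕ → Branch → Branch
  | 0, x => x
  | f + 1, x =>
    if (avail k x).Nonempty then expand k N f (addNode N x (nextIndex k x (k + 1))) else x

lemma mem_avail {k : ℕ} {x : Branch} {j : ℕ} :
    j ∈ avail k x ↔ (1 ≤ j ∧ j ≤ k) ∧ ∀ e ∈ x, e.1 ≠ j := by
  simp only [avail, Finset.mem_sdiff, Finset.mem_Icc, List.mem_toFinset, List.mem_map, ne_eq]
  constructor
  · rintro ⟨h, h'⟩
    exact ⟨h, fun e he hj => h' ⟨e, he, hj⟩⟩
  · rintro ⟨h, h'⟩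
    exact ⟨h, fun ⟨e, he, hj⟩ => h' e he hj⟩

lemma avail_anti {k : ℕ} {x y : Branch} (h : x <+: y) : avail k y ⊆ avail k x := by
  intro j hj
  rw [mem_avail] at hj ⊢
  exact ⟨hj.1, fun e he => hj.2 e (h.subset he)⟩

lemma card_avail_lt {k : ℕ} {x y : Branch} {e : ℕ × ℕ} (h : x ++ [e] <+: y)
    (he : e.1 ∈ avail k x) : (avail k y).card < (avail k x).card := by
  refine Finset.card_lt_card ⟨avail_anti ((List.prefix_append _ _).trans h), fun hs => ?_⟩
  have := hs he
  rw [mem_avail] at this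
  exact this.2 e (h.subset (by simp)) rfl

lemma nextIndex_le {k : ℕ} {x : Branch} {j : ℕ} : nextIndex k x j ≤ j := by
  refine Finset.sup_le fun i hi => ?_
  exact (Finset.mem_filter.1 hi).2.le

lemma nextIndex_lt {k : ℕ} {x : Branch} {j : ℕ} (hj : j ≠ 0) : nextIndex k x j < j := by
  refine (Finset.sup_lt_iff (Nat.pos_of_ne_zero hj)).2 fun i hi => ?_
  exact (Finset.mem_filter.1 hi).2

lemma nextIndex_mem {k : ℕ} {x : Branch} {j : ℕ} :
    nextIndex k x j = 0 ∨ nextIndex k x j ∈ avail k x := by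
  rcases ((avail k x).filter (· < j)).eq_empty_or_nonempty with h | h
  · left
    simp [nextIndex, h]
  · right
    obtain ⟨i, hi, hs⟩ := Finset.exists_mem_eq_sup _ h id
    rw [nextIndex, hs]
    exact (Finset.mem_filter.1 hi).1

lemma le_nextIndex {k : ℕ} {x : Branch} {i j : ℕ} (hi : i ∈ avail k x) (hij : i < j) :
    i ≤ nextIndex k x j :=
  Finset.le_sup (f := id) (Finset.mem_filter.2 ⟨hi, hij⟩)

lemma nextIndex_top_mem {k : ℕ} {x : Branch} (h : (avail k x).Nonempty) :
    nextIndex k x (k + 1) ∈ avail k x := by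
  obtain ⟨i, hi⟩ := h
  have h1 := (mem_avail.1 hi).1
  have := le_nextIndex hi (Nat.lt_succ_of_le h1.2)
  exact nextIndex_mem.resolve_left (by simp only [Nat.succ_eq_add_one] at this; omega)

lemma le_freshName (N : ℕ) (x : Branch) (j : ℕ) : N ≤ freshName N x j :=
  Nat.le_add_right _ _

lemma lt_freshName {N : ℕ} {x : Branch} {j : ℕ} {e : ℕ × ℕ} (he : e ∈ x) :
    e.2 < freshName N x j := by
  have h : e.2 < Encodable.encode x := by
    induction x with
    | nil => simp at he
    | cons a l ih =>
      rw [Encodable.encode_list_cons, Nat.lt_succ_iff]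
      rcases List.mem_cons.1 he with rfl | he
      · refine le_trans ?_ (Nat.left_le_pair _ _)
        rw [← Prod.mk.eta (p := e), Encodable.encode_prod_val]
        exact Nat.right_le_pair _ _
      · exact (ih he).le.trans (Nat.right_le_pair _ _)
  have h' : Encodable.encode x ≤ Encodable.encode (x, j) := by
    rw [Encodable.encode_prod_val]
    exact Nat.left_le_pair _ _
  unfold freshName
  omega

lemma freshName_inj {N : ℕ} {x y : Branch} {i j : ℕ} (h : freshName N x i = freshName N y j) :
    x = y ∧ i = j := by
  have := Encodable.encode_injective (Nat.add_left_cancel h)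
  simpa using this

lemma prefix_expand (k N f : ℕ) (x : Branch) : x <+: expand k N f x := by
  induction f generalizing x with
  | zero => exact List.prefix_rfl
  | succ f ih =>
    rw [expand]
    split_ifs
    · exact (List.prefix_append _ _).trans (ih _)
    · exact List.prefix_rfl

lemma avail_expand {k N f : ℕ} {x : Branch} (h : (avail k x).card ≤ f) :
    avail k (expand k N f x) = ∅ := by
  induction f generalizing x with
  | zero => exact Finset.card_eq_zero.1 (Nat.le_zero.1 h)
  | succ f ih =>
    rw [expand]
    split_ifs with h'
    · apply ih
      have := card_avail_lt (k := k) (x := x)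
        (e := (nextIndex k x (k + 1), freshName N x (nextIndex k x (k + 1))))
        List.prefix_rfl (nextIndex_top_mem h')
      unfold addNode
      omega
    · exact Finset.not_nonempty_iff_eq_empty.1 h'

lemma card_avail_le (k : ℕ) (x : Branch) : (avail k x).card ≤ k :=
  (Finset.card_le_card Finset.sdiff_subset).trans (by simp)

lemma concat_prefix_expand {k N f : ℕ} {x y : Branch} {e : ℕ × ℕ}
    (h : y ++ [e] <+: expand k N f x) :
    y ++ [e] <+: x ∨ (x <+: y ∧ (avail k y).Nonempty ∧
      e = (nextIndex k y (k + 1), freshName N y (nextIndex k y (k + 1)))) := by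
  induction f generalizing x with
  | zero => exact Or.inl h
  | succ f ih =>
    rw [expand] at h
    split_ifs at h with h'
    · rcases ih h with h1 | h1
      · rw [addNode, List.prefix_concat_iff] at h1
        rcases h1 with h1 | h1
        · obtain ⟨rfl, h1⟩ := List.append_inj' h1 rfl
          refine Or.inr ⟨List.prefix_rfl, h', ?_⟩
          simpa using h1
        · exact Or.inl h1
      · exact Or.inr ⟨(List.prefix_append _ _).trans h1.1, h1.2⟩
    · exact Or.inl h

/-- Every branch either ends at `x` or continues with some entry. -/
lemma prefix_eq_or_concat {α : Type*} {x p : List α} (h : x <+: p) :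
    x = p ∨ ∃ e, x ++ [e] <+: p := by
  obtain ⟨t, rfl⟩ := h
  cases t with
  | nil => simp
  | cons a t => exact Or.inr ⟨a, by simp⟩

lemma concat_prefix_unique {α : Type*} {x p : List α} {e f : α} (h : x ++ [e] <+: p)
    (h' : x ++ [f] <+: p) : e = f := by
  have := List.prefix_of_prefix_length_le h h' (by simp)
  rw [List.prefix_append_right_inj] at this
  simpa using this

lemma eq_of_concat_prefix {α : Type*} {x y p : List α} {e f : α} (h : x ++ [e] <+: p)
    (h' : y ++ [f] <+: p) (hl : x.length = y.length) : x = y ∧ e = f := by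
  have := List.prefix_of_prefix_length_le h h' (by simp [hl])
  have := this.eq_of_length (by simp [hl])
  have := List.append_inj' this rfl
  simpa using this

lemma mem_iff_concat_prefix {α : Type*} {p : List α} {e : α} :
    e ∈ p ↔ ∃ x, x ++ [e] <+: p := by
  constructor
  · intro h
    obtain ⟨s, t, rfl⟩ := List.append_of_mem h
    exact ⟨s, by simp⟩
  · rintro ⟨x, h⟩
    exact h.subset (by simp)

lemma prefix_dichotomy {α : Type*} {x y p : List α} (hx : x <+: p) (hy : y <+: p) :
    y <+: x ∨ ∃ e, x ++ [e] <+: y := by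
  rcases List.prefix_or_prefix_of_prefix hx hy with h | h
  · rcases prefix_eq_or_concat h with rfl | h
    · exact Or.inl List.prefix_rfl
    · exact Or.inr h
  · exact Or.inl h

section Update

variable {S : Type} (k N : ℕ) (RR GG : ℕ → Set S) (s : S)

open Classical in
/-- The effect on a branch of moving to the state `s`: the first node waiting for an index `j`
such that `s` lies in `RR j` or `GG j` is replaced by a new node, which waits for the next index
in the former case and for the same one in the latter. -/
noncomputable def update : Branch → Branch → Branch
  | x, [] => x
  | x, e :: p =>
    if s ∈ RR e.1 then addNode N x (nextIndex k x e.1)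
    else if s ∈ GG e.1 then addNode N x e.1
    else update (x ++ [e]) p

variable {k N RR GG s}

lemma update_cases (x p : Branch) :
    (update k N RR GG s x p = x ++ p ∧ ∀ e ∈ p, s ∉ RR e.1 ∧ s ∉ GG e.1) ∨
    ∃ q e r j, p = q ++ e :: r ∧ (∀ f ∈ q, s ∉ RR f.1 ∧ s ∉ GG f.1) ∧
      update k N RR GG s x p = addNode N (x ++ q) j ∧
      ((s ∈ RR e.1 ∧ j = nextIndex k (x ++ q) e.1) ∨ (s ∉ RR e.1 ∧ s ∈ GG e.1 ∧ j = e.1)) := by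
  induction p generalizing x with
  | nil => left; simp [update]
  | cons e p ih =>
    by_cases h1 : s ∈ RR e.1
    · right
      exact ⟨[], e, p, nextIndex k x e.1, rfl, by simp, by simp [update, h1], Or.inl ⟨h1, by simp⟩⟩
    by_cases h2 : s ∈ GG e.1
    · right
      exact ⟨[], e, p, _, rfl, by simp, by simp [update, h1, h2], Or.inr ⟨h1, h2, rfl⟩⟩
    have hu : update k N RR GG s x (e :: p) = update k N RR GG s (x ++ [e]) p := by
      simp [update, h1, h2]
    rw [hu]
    rcases ih (x ++ [e]) with h | ⟨q, f, r, j, rfl, hq, h, h'⟩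
    · left
      refine ⟨by simp [h.1], ?_⟩
      simpa [h1, h2] using h.2
    · right
      refine ⟨e :: q, f, r, j, rfl, ?_, by simpa using h, by simpa using h'⟩
      simpa [h1, h2] using hq

/-- A node of an updated branch is an unaffected old node, or the new node. -/
lemma concat_prefix_update {p x : Branch} {e : ℕ × ℕ}
    (h : x ++ [e] <+: update k N RR GG s [] p) :
    (∀ f ∈ x, s ∉ RR f.1 ∧ s ∉ GG f.1) ∧
    ((x ++ [e] <+: p ∧ s ∉ RR e.1 ∧ s ∉ GG e.1) ∨
      ∃ f j, x ++ [f] <+: p ∧ update k N RR GG s [] p = x ++ [e] ∧ e = (j, freshName N x j) ∧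
      ((s ∈ RR f.1 ∧ j = nextIndex k x f.1) ∨ (s ∉ RR f.1 ∧ s ∈ GG f.1 ∧ j = f.1))) := by
  rcases update_cases (k := k) (N := N) (RR := RR) (GG := GG) (s := s) [] p with
    ⟨h1, h2⟩ | ⟨q, f, r, j, rfl, hq, h1, h2⟩
  · rw [h1, List.nil_append] at h
    exact ⟨fun f hf => h2 f (h.subset (by simp [hf])), Or.inl ⟨h, h2 e (h.subset (by simp))⟩⟩
  · rw [h1, List.nil_append, addNode, List.prefix_concat_iff] at h
    rcases h with h | h
    · obtain ⟨rfl, h⟩ := List.append_inj' h rfl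
      simp only [List.cons.injEq, and_true] at h
      refine ⟨hq, Or.inr ⟨f, j, by simp, ?_, h, by simpa using h2⟩⟩
      rw [h1, h]
      rfl
    · refine ⟨fun f hf => hq f (h.subset (by simp [hf])), Or.inl ⟨h.trans (by simp), ?_⟩⟩
      exact hq e (h.subset (by simp))

/-- A node none of whose ancestors is affected persists, or is replaced itself. -/
lemma update_of_concat_prefix {p x : Branch} {e : ℕ × ℕ} (h : x ++ [e] <+: p)
    (hx : ∀ f ∈ x, s ∉ RR f.1 ∧ s ∉ GG f.1) :
    (s ∈ RR e.1 ∧ update k N RR GG s [] p = addNode N x (nextIndex k x e.1)) ∨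
    (s ∉ RR e.1 ∧ s ∈ GG e.1 ∧ update k N RR GG s [] p = addNode N x e.1) ∨
    (s ∉ RR e.1 ∧ s ∉ GG e.1 ∧ x ++ [e] <+: update k N RR GG s [] p) := by
  rcases update_cases (k := k) (N := N) (RR := RR) (GG := GG) (s := s) [] p with
    ⟨h1, h2⟩ | ⟨q, f, r, j, rfl, hq, h1, h2⟩
  · refine Or.inr (Or.inr ?_)
    have := h2 e (h.subset (by simp))
    rw [h1]
    exact ⟨this.1, this.2, by simpa using h⟩
  · rw [List.nil_append] at h1 h2
    have hqf : q ++ [f] <+: q ++ f :: r := by simp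
    have hf : s ∈ RR f.1 ∨ s ∈ GG f.1 := by tauto
    rcases lt_trichotomy x.length q.length with hl | hl | hl
    · have := List.prefix_of_prefix_length_le h ((List.prefix_append q [f]).trans hqf)
        (by simp; omega)
      have h3 := hq e (this.subset (by simp))
      refine Or.inr (Or.inr ⟨h3.1, h3.2, ?_⟩)
      rw [h1]
      exact this.trans (List.prefix_append _ _)
    · obtain ⟨rfl, rfl⟩ := eq_of_concat_prefix h hqf hl
      rcases h2 with ⟨h2, rfl⟩ | ⟨h2, h3, rfl⟩
      · exact Or.inl ⟨h2, h1⟩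
      · exact Or.inr (Or.inl ⟨h2, h3, h1⟩)
    · have := List.prefix_of_prefix_length_le hqf ((List.prefix_append x [e]).trans h)
        (by simp; omega)
      have := hx f (this.subset (by simp))
      tauto

end Update

/-- Branches are compared lexicographically. -/
def key (x : Branch) : List ℕ := x.flatMap fun e => [e.1, e.2]

lemma le_of_key_le {x p q : Branch} {e f : ℕ × ℕ} (hp : x ++ [e] <+: p) (hq : x ++ [f] <+: q)
    (h : key p ≤ key q) : e.1 < f.1 ∨ (e.1 = f.1 ∧ e.2 ≤ f.2) := by
  obtain ⟨p', rfl⟩ := hp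
  obtain ⟨q', rfl⟩ := hq
  rw [← not_lt] at h
  induction x with
  | nil =>
    simp only [key, List.nil_append, List.cons_append, List.flatMap_cons,
      List.cons_lt_cons_iff] at h
    omega
  | cons a x ih =>
    simp only [key, List.cons_append, List.flatMap_cons, List.nil_append,
      List.cons_lt_cons_iff, lt_irrefl, true_and, false_or] at h
    exact ih h

section Tree

variable {S : Type}

/-- The structural conditions on Streett–Safra trees. -/
structure IsTree (k : ℕ) (π : S → Branch) : Prop where
  root : ∀ s e, [e] <+: π s → e = (0, 0)
  index : ∀ s x e, x ≠ [] → x ++ [e] <+: π s →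
    (avail k x).Nonempty ∧ (e.1 = 0 ∨ e.1 ∈ avail k x)
  name_lt : ∀ s x e, x ++ [e] <+: π s → ∀ f ∈ x, f.2 < e.2
  unique : ∀ s t x y e f, x ++ [e] <+: π s → y ++ [f] <+: π t → e.2 = f.2 → x = y ∧ e = f
  leaf : ∀ s, π s ≠ [] → avail k (π s) = ∅
  wait : ∀ s x e, x ≠ [] → x ++ [e] <+: π s → ∃ t f, f.1 ≠ 0 ∧ x ++ [f] <+: π t

/-- Every node has a leaf below it that is reached through nodes waiting for an index. -/
lemma IsTree.exists_leaf {k : ℕ} {π : S → Branch} (h : IsTree k π) {x : Branch} (hx : x ≠ [])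
    {s : S} (hs : x <+: π s) : ∃ t z, π t = x ++ z ∧ ∀ e ∈ z, e.1 ≠ 0 := by
  induction hn : (avail k x).card using Nat.strong_induction_on generalizing x s with
  | _ n ih =>
    rcases prefix_eq_or_concat hs with h1 | ⟨e, he⟩
    · exact ⟨s, [], by simp [h1], by simp⟩
    · obtain ⟨t, f, hf, hft⟩ := h.wait s x e hx he
      have := (h.index t x f hx hft).2.resolve_left hf
      obtain ⟨t', z, hz, hz'⟩ := ih _ (by rw [← hn]; exact card_avail_lt List.prefix_rfl this)
        (by simp) hft rfl
      refine ⟨t', f :: z, by simp [hz], ?_⟩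
      simpa [hf] using hz'

variable [Fintype S]

/-- The names occurring on the branches of a tree; the branch of a state is empty if the state is
not reachable. -/
def names (π : S → Branch) : Finset ℕ :=
  Finset.univ.biUnion fun s => ((π s).map Prod.snd).toFinset

lemma mem_names {π : S → Branch} {a : ℕ} : a ∈ names π ↔ ∃ s x j, x ++ [(j, a)] <+: π s := by
  simp only [names, Finset.mem_biUnion, Finset.mem_univ, true_and, List.mem_toFinset,
    List.mem_map]
  constructor
  · rintro ⟨s, ⟨j, b⟩, h, rfl⟩
    obtain ⟨x, hx⟩ := mem_iff_concat_prefix.1 h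
    exact ⟨s, x, j, hx⟩
  · rintro ⟨s, x, j, h⟩
    exact ⟨s, (j, a), h.subset (by simp), rfl⟩

lemma mem_names_of_prefix {π : S → Branch} {s : S} {x : Branch} {e : ℕ × ℕ}
    (h : x ++ [e] <+: π s) : e.2 ∈ names π :=
  mem_names.2 ⟨s, x, e.1, h⟩

lemma mem_names_of_mem {π : S → Branch} {s : S} {e : ℕ × ℕ} (h : e ∈ π s) : e.2 ∈ names π := by
  obtain ⟨x, hx⟩ := mem_iff_concat_prefix.1 h
  exact mem_names_of_prefix hx

/-- The names of the nodes form an initial segment of `ℕ`. -/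
def IsCompact (π : S → Branch) : Prop :=
  ∀ a ∈ names π, ∀ b < a, b ∈ names π

/-- The rank of a name. -/
def rank (π : S → Branch) (a : ℕ) : ℕ := Nat.count (· ∈ names π) a

/-- Replaces the name of a node by its rank. -/
def renumber (π : S → Branch) (x : Branch) : Branch := x.map fun e => (e.1, rank π e.2)

/-- Replaces all names by their ranks. -/
def compress (π : S → Branch) (s : S) : Branch := renumber π (π s)

lemma rank_le (π : S → Branch) (a : ℕ) : rank π a ≤ a := Nat.count_le _

lemma rank_eq_iff {π : S → Branch} {a : ℕ} : rank π a = a ↔ ∀ b < a, b ∈ names π :=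
  Nat.count_iff_forall

lemma rank_inj {π : S → Branch} {a b : ℕ} (ha : a ∈ names π) (hb : b ∈ names π)
    (h : rank π a = rank π b) : a = b :=
  Nat.count_injective ha hb h

lemma renumber_inj {π : S → Branch} {x y : Branch} (hx : ∀ e ∈ x, e.2 ∈ names π)
    (hy : ∀ e ∈ y, e.2 ∈ names π) (h : renumber π x = renumber π y) : x = y := by
  induction x generalizing y with
  | nil => exact (by simpa [renumber] using h.symm : y = []).symm
  | cons e x ih =>
    cases y with
    | nil => simp [renumber] at h
    | cons f y =>
      simp only [renumber, List.map_cons, List.cons.injEq, Prod.mk.injEq] at h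
      rw [ih (fun e he => hx e (by simp [he])) (fun e he => hy e (by simp [he])) h.2,
        Prod.ext h.1.1 (rank_inj (hx e (by simp)) (hy f (by simp)) h.1.2)]

lemma avail_renumber (k : ℕ) (π : S → Branch) (x : Branch) :
    avail k (renumber π x) = avail k x := by
  simp [avail, renumber, Function.comp_def]

lemma concat_prefix_renumber {π : S → Branch} {p y : Branch} {e : ℕ × ℕ}
    (h : y ++ [e] <+: renumber π p) :
    ∃ x f, x ++ [f] <+: p ∧ y = renumber π x ∧ e = (f.1, rank π f.2) := by
  obtain ⟨l, hl, h⟩ := List.prefix_map_iff.1 h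
  obtain ⟨x, z, rfl, rfl, hz⟩ := List.append_eq_map_iff.1 h
  obtain ⟨f, z', rfl, rfl, hz'⟩ := List.map_eq_cons_iff.1 hz
  obtain rfl : z' = [] := by simpa using hz'
  exact ⟨x, f, hl, rfl, rfl⟩

lemma renumber_concat_prefix {π : S → Branch} {p x : Branch} {e : ℕ × ℕ} (h : x ++ [e] <+: p) :
    renumber π x ++ [(e.1, rank π e.2)] <+: renumber π p := by
  have := List.IsPrefix.map (fun e : ℕ × ℕ => (e.1, rank π e.2)) h
  simpa [renumber] using this

lemma IsTree.compress {k : ℕ} {π : S → Branch} (h : IsTree k π) : IsTree k (compress π) where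
  root s e he := by
    obtain ⟨x, f, hf, hx, rfl⟩ := concat_prefix_renumber (y := []) he
    obtain rfl : x = [] := by simpa [renumber] using hx.symm
    obtain rfl := h.root s f hf
    simp [rank]
  index s y e hy he := by
    obtain ⟨x, f, hf, rfl, rfl⟩ := concat_prefix_renumber he
    rw [avail_renumber]
    exact h.index s x f (by rintro rfl; exact hy rfl) hf
  name_lt s y e he g hg := by
    obtain ⟨x, f, hf, rfl, rfl⟩ := concat_prefix_renumber he
    obtain ⟨f', hf', rfl⟩ := List.mem_map.1 hg
    exact Nat.count_strict_mono (mem_names_of_mem (hf.subset (by simp [hf'])))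
      (h.name_lt s x f hf f' hf')
  unique s t y z e g he hg heg := by
    obtain ⟨x, f, hf, rfl, rfl⟩ := concat_prefix_renumber he
    obtain ⟨x', f', hf', rfl, rfl⟩ := concat_prefix_renumber hg
    obtain ⟨rfl, rfl⟩ := h.unique s t x x' f f' hf hf'
      (rank_inj (mem_names_of_prefix hf) (mem_names_of_prefix hf') heg)
    exact ⟨rfl, rfl⟩
  leaf s hs := by
    rw [StreettDet.compress, avail_renumber]
    exact h.leaf s (by intro h'; exact hs (by simp [StreettDet.compress, renumber, h']))
  wait s y e hy he := by
    obtain ⟨x, f, hf, rfl, rfl⟩ := concat_prefix_renumber he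
    obtain ⟨t, g, hg, hg'⟩ := h.wait s x f (by rintro rfl; exact hy rfl) hf
    exact ⟨t, (g.1, rank π g.2), hg, renumber_concat_prefix hg'⟩

lemma isCompact_compress (π : S → Branch) : IsCompact (compress π) := by
  intro a ha b hb
  obtain ⟨s, y, j, h⟩ := mem_names.1 ha
  obtain ⟨x, f, hf, rfl, he⟩ := concat_prefix_renumber h
  obtain ⟨rfl, rfl⟩ := Prod.mk.inj he
  have hn : ∀ hf : (Set.ofPred (· ∈ names π)).Finite, b < hf.toFinset.card := by
    intro hfin
    refine hb.trans_le ?_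
    rw [rank, Nat.count_eq_card_filter_range]
    refine Finset.card_le_card fun c hc => ?_
    simpa using (Finset.mem_filter.1 hc).2
  have h1 := Nat.nth_mem b hn
  have h2 := Nat.count_nth hn
  obtain ⟨t, z, i, hz⟩ := mem_names.1 h1
  have := mem_names_of_prefix (π := compress π) (s := t) (renumber_concat_prefix (π := π) hz)
  rw [← h2]
  exact this

/-- Sends the name of a node to a leaf below it and the number of indices available at it. -/
lemma IsTree.exists_charge [Nonempty S] {k : ℕ} {π : S → Branch} (h : IsTree k π) :
    ∃ c : ℕ → S × ℕ, Set.InjOn c (names π) ∧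
      ∀ s x e, x ++ [e] <+: π s → (c e.2).2 = (avail k (x ++ [e])).card := by
  have key : ∀ a : names π, ∃ t x e z, π t = x ++ [e] ++ z ∧ e.2 = a.1 ∧
      ∀ f ∈ z, f.1 ≠ 0 := by
    rintro ⟨a, ha⟩
    obtain ⟨s, x, j, hx⟩ := mem_names.1 ha
    obtain ⟨t, z, hz, hz'⟩ := h.exists_leaf (by simp) hx
    exact ⟨t, x, (j, a), z, hz, rfl, hz'⟩
  choose t x e z hπ he hz using key
  classical
  refine ⟨fun a => if ha : a ∈ names π then
    (t ⟨a, ha⟩, (avail k (x ⟨a, ha⟩ ++ [e ⟨a, ha⟩])).card) else (Classical.arbitrary S, 0), ?_, ?_⟩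
  · intro a ha b hb hab
    rw [Finset.mem_coe] at ha hb
    simp only [ha, hb, dite_true, Prod.mk.injEq] at hab
    obtain ⟨h1, h2⟩ := hab
    have main : ∀ a b : names π, t a = t b →
        (avail k (x a ++ [e a])).card = (avail k (x b ++ [e b])).card →
        x a ++ [e a] <+: x b ++ [e b] → a.1 = b.1 := by
      intro a b h1 h2 h3
      have hb : x b ++ [e b] <+: π (t a) := by rw [h1, hπ]; exact List.prefix_append _ _
      rcases prefix_eq_or_concat h3 with h4 | ⟨f, hf⟩
      · rw [← he, ← he, (List.append_inj' h4 rfl).2 |> List.cons_eq_cons.1 |>.1]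
      · exfalso
        have h5 := hf.trans hb
        have h6 : f ∈ z a := by
          rw [hπ, List.prefix_append_right_inj] at h5
          exact h5.subset (by simp)
        have := (h.index _ _ f (by simp) (hf.trans hb)).2.resolve_left (hz a f h6)
        have := card_avail_lt hf this
        omega
    have ha' : x ⟨a, ha⟩ ++ [e ⟨a, ha⟩] <+: π (t ⟨b, hb⟩) := by
      rw [← h1, hπ]; exact List.prefix_append _ _
    have hb' : x ⟨b, hb⟩ ++ [e ⟨b, hb⟩] <+: π (t ⟨b, hb⟩) := by
      rw [hπ]; exact List.prefix_append _ _
    rcases List.prefix_or_prefix_of_prefix ha' hb' with h3 | h3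
    · exact main ⟨a, ha⟩ ⟨b, hb⟩ h1 h2 h3
    · exact (main ⟨b, hb⟩ ⟨a, ha⟩ h1.symm h2.symm h3).symm
  · intro s y f hf
    have hm := mem_names_of_prefix hf
    simp only [hm, dite_true]
    have : x ⟨_, hm⟩ ++ [e ⟨_, hm⟩] <+: π (t ⟨_, hm⟩) := by
      rw [hπ]; exact List.prefix_append _ _
    obtain ⟨h1, h2⟩ := h.unique _ _ _ _ _ _ this hf (he _)
    rw [h1, h2]

/-- A tree has at most `n (k + 1)` nodes. -/
lemma IsTree.card_names_le [Nonempty S] {k : ℕ} {π : S → Branch} (h : IsTree k π) :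
    (names π).card ≤ Fintype.card S * (k + 1) := by
  obtain ⟨c, hc, hc'⟩ := h.exists_charge
  rw [← Finset.card_univ, ← Finset.card_range (k + 1), ← Finset.card_product]
  refine Finset.card_le_card_of_injOn c (fun a ha => ?_) hc
  obtain ⟨s, x, j, hx⟩ := mem_names.1 (Finset.mem_coe.1 ha)
  have := hc' s x _ hx
  simp only at this
  simp [this, Nat.lt_succ_of_le (card_avail_le _ _)]

/-- A tree has at most `n k` inner nodes. -/
lemma IsTree.card_inner_le [Nonempty S] {k : ℕ} {π : S → Branch} (h : IsTree k π) {A : Finset ℕ}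
    (hA : ∀ a ∈ A, ∃ s x e f, x ++ [e] ++ [f] <+: π s ∧ e.2 = a) :
    A.card ≤ Fintype.card S * k := by
  obtain ⟨c, hc, hc'⟩ := h.exists_charge
  have hk : k = (Finset.Icc 1 k).card := by simp
  rw [← Finset.card_univ, hk, ← Finset.card_product]
  have hsub : ∀ a ∈ A, a ∈ names π := by
    intro a ha
    obtain ⟨s, x, e, f, hx, rfl⟩ := hA a ha
    exact mem_names_of_prefix ((List.prefix_append _ _).trans hx)
  refine Finset.card_le_card_of_injOn c (fun a ha => ?_) (hc.mono hsub)
  obtain ⟨s, x, e, f, hx, rfl⟩ := hA a (Finset.mem_coe.1 ha)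
  have h1 := hc' s x e ((List.prefix_append _ _).trans hx)
  have h2 := (h.index s _ f (by simp) hx).1.card_pos
  simp only [Finset.coe_product, Finset.coe_univ, Set.mem_prod, Set.mem_univ, true_and,
    Finset.coe_Icc, Set.mem_Icc, h1]
  exact ⟨h2, card_avail_le _ _⟩

lemma IsTree.name_lt_card [Nonempty S] {k : ℕ} {π : S → Branch} (h : IsTree k π) (hc : IsCompact π)
    {a : ℕ} (ha : a ∈ names π) : a < Fintype.card S * (k + 1) := by
  have : Finset.range (a + 1) ⊆ names π := by
    intro b hb
    rcases Nat.lt_succ_iff_lt_or_eq.1 (Finset.mem_range.1 hb) with hb | rfl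
    · exact hc a ha b hb
    · exact ha
  have := (Finset.card_le_card this).trans h.card_names_le
  simpa using this

/-- Expanding the leaves of a partial tree whose nodes are nodes of `π` or new yields a tree. -/
lemma isTree_expand {k N : ℕ} {π τ ρ : S → Branch}
    (hu : ∀ s t x y e f, x ++ [e] <+: π s → y ++ [f] <+: π t → e.2 = f.2 → x = y ∧ e = f)
    (hN : ∀ a ∈ names π, a < N)
    (root : ∀ s e, [e] <+: τ s → e = (0, 0))
    (index : ∀ s x e, x ≠ [] → x ++ [e] <+: τ s →
      (avail k x).Nonempty ∧ (e.1 = 0 ∨ e.1 ∈ avail k x))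
    (name_lt : ∀ s x e, x ++ [e] <+: τ s → ∀ f ∈ x, f.2 < e.2)
    (source : ∀ s x e, x ++ [e] <+: τ s →
      (∃ t, x ++ [e] <+: π t) ∨ e.2 = freshName N x e.1)
    (wait : ∀ s x e, x ≠ [] → x ++ [e] <+: τ s → ∃ t f, f.1 ≠ 0 ∧ x ++ [f] <+: τ t)
    (hρ : ∀ s, (τ s = [] ∧ ρ s = []) ∨ (τ s ≠ [] ∧ ρ s = expand k N k (τ s))) :
    IsTree k ρ := by
  have cases : ∀ s x e, x ++ [e] <+: ρ s → x ++ [e] <+: τ s ∨ (x ≠ [] ∧ (avail k x).Nonempty ∧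
      e = (nextIndex k x (k + 1), freshName N x (nextIndex k x (k + 1)))) := by
    intro s x e h
    rcases hρ s with ⟨-, h1⟩ | ⟨h0, h1⟩
    · rw [h1] at h
      simp at h
    · rw [h1] at h
      rcases concat_prefix_expand h with h | ⟨h2, h⟩
      · exact Or.inl h
      · refine Or.inr ⟨?_, h⟩
        rintro rfl
        exact h0 (List.prefix_nil.1 h2)
  have lift : ∀ s x, x <+: τ s → x <+: ρ s := by
    intro s x h
    rcases hρ s with ⟨h0, h1⟩ | ⟨h0, h1⟩
    · rwa [h1, ← h0]
    · rw [h1]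
      exact h.trans (prefix_expand _ _ _ _)
  have source' : ∀ s x e, x ++ [e] <+: ρ s →
      (∃ t, x ++ [e] <+: π t) ∨ e.2 = freshName N x e.1 := by
    intro s x e h
    rcases cases s x e h with h | ⟨-, -, rfl⟩
    · exact source s x e h
    · exact Or.inr rfl
  refine ⟨fun s e h => ?_, fun s x e hx h => ?_, fun s x e h => ?_,
    fun s t x y e f he hf hef => ?_, fun s h => ?_, fun s x e hx h => ?_⟩
  · rcases cases s [] e h with h | h
    · exact root s e h
    · exact absurd rfl h.1
  · rcases cases s x e h with h | ⟨-, h1, rfl⟩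
    · exact index s x e hx h
    · exact ⟨h1, Or.inr (nextIndex_top_mem h1)⟩
  · rcases cases s x e h with h | ⟨-, h1, rfl⟩
    · exact name_lt s x e h
    · exact fun f hf => lt_freshName hf
  · rcases source' s x e he with ⟨s', h1⟩ | h1 <;> rcases source' t y f hf with ⟨t', h2⟩ | h2
    · exact hu s' t' x y e f h1 h2 hef
    · have := hN _ (mem_names_of_prefix h1)
      have := le_freshName N y f.1
      omega
    · have := hN _ (mem_names_of_prefix h2)
      have := le_freshName N x e.1
      omega
    · obtain ⟨h3, h4⟩ := freshName_inj (h1.symm.trans (hef.trans h2))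
      exact ⟨h3, Prod.ext h4 hef⟩
  · rcases hρ s with ⟨-, h1⟩ | ⟨-, h1⟩
    · exact absurd h1 h
    · rw [h1]
      exact avail_expand (card_avail_le _ _)
  · rcases cases s x e h with h | ⟨-, h1, rfl⟩
    · obtain ⟨t, f, hf, h⟩ := wait s x e hx h
      exact ⟨t, f, hf, lift _ _ h⟩
    · refine ⟨s, _, ?_, h⟩
      have := (mem_avail.1 (nextIndex_top_mem h1)).1.1
      simp only
      omega

end Tree

section Step

variable {S : Type} [Fintype S] (k N : ℕ) (RR GG : ℕ → Set S) (E : S → S → Prop) (π : S → Branch)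

/-- Among the updated branches of the predecessors of a state, one is lexicographically minimal. -/
lemma exists_best (s : S) (h : ∃ t, π t ≠ [] ∧ E t s) :
    ∃ t, (π t ≠ [] ∧ E t s) ∧ ∀ u, π u ≠ [] → E u s →
      key (update k N RR GG s [] (π t)) ≤ key (update k N RR GG s [] (π u)) := by
  classical
  obtain ⟨t, ht⟩ := h
  obtain ⟨t, ht, hmin⟩ := Finset.exists_min_image
    (Finset.univ.filter fun t => π t ≠ [] ∧ E t s)
    (fun t => key (update k N RR GG s [] (π t))) ⟨t, by simpa using ht⟩
  exact ⟨t, by simpa using ht, fun u h1 h2 => hmin u (by simp [h1, h2])⟩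

open Classical in
/-- The least updated branch of a predecessor of the state `s`. -/
noncomputable def chosen (s : S) : Branch :=
  if h : ∃ t, π t ≠ [] ∧ E t s then
    update k N RR GG s [] (π (exists_best k N RR GG E π s h).choose)
  else []

/-- No branch through the node continues with a node waiting for an index. -/
def IsGreen (σ : S → Branch) (x : Branch) : Prop :=
  ∀ s e, x ++ [e] <+: σ s → e.1 = 0

/-- The part of a branch up to its first green node. -/
noncomputable def cut (σ : S → Branch) (s : S) : Branch :=
  (σ s).take (sInf {l | 1 ≤ l ∧ ((σ s).length ≤ l ∨ IsGreen σ ((σ s).take l))})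

/-- One step of the construction, before renaming. -/
noncomputable def advance (s : S) : Branch :=
  if cut (chosen k N RR GG E π) s = [] then []
  else expand k N k (cut (chosen k N RR GG E π) s)

/-- The transition function on trees. -/
noncomputable def step : S → Branch := compress (advance k N RR GG E π)

/-- The node with name `c` is removed by the step. -/
def Dead (c : ℕ) : Prop := c ∈ names π ∧ c ∉ names (advance k N RR GG E π)

/-- The node with name `c` is green and survives the step. -/
def Green (c : ℕ) : Prop :=
  c < N ∧ ∃ s x j, x ++ [(j, c)] <+: advance k N RR GG E π s ∧
    IsGreen (chosen k N RR GG E π) (x ++ [(j, c)])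

variable {k N RR GG E π}

lemma chosen_cases (s : S) :
    (∃ t, π t ≠ [] ∧ E t s ∧ chosen k N RR GG E π s = update k N RR GG s [] (π t) ∧
      ∀ u, π u ≠ [] → E u s →
        key (chosen k N RR GG E π s) ≤ key (update k N RR GG s [] (π u))) ∨
    (chosen k N RR GG E π s = [] ∧ ∀ t, π t ≠ [] → ¬ E t s) := by
  by_cases h : ∃ t, π t ≠ [] ∧ E t s
  · left
    have := (exists_best k N RR GG E π s h).choose_spec
    refine ⟨(exists_best k N RR GG E π s h).choose, this.1.1, this.1.2, by simp [chosen, h], ?_⟩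
    simpa [chosen, h] using this.2
  · right
    refine ⟨by rw [chosen, dif_neg h], ?_⟩
    push Not at h
    exact h

omit [Fintype S] in
lemma cut_prefix (σ : S → Branch) (s : S) : cut σ s <+: σ s := List.take_prefix _ _

omit [Fintype S] in
lemma cut_spec (σ : S → Branch) (s : S) :
    (cut σ s = [] → σ s = []) ∧ (cut σ s = σ s ∨ IsGreen σ (cut σ s)) ∧
      ∀ y e, y ≠ [] → y ++ [e] <+: cut σ s → ¬ IsGreen σ y := by
  have hne : {l | 1 ≤ l ∧ ((σ s).length ≤ l ∨ IsGreen σ ((σ s).take l))}.Nonempty :=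
    ⟨(σ s).length + 1, by simp⟩
  obtain ⟨h1, h2⟩ := Nat.sInf_mem hne
  refine ⟨fun h => ?_, ?_, fun y e hy h hg => ?_⟩
  · rw [cut, List.take_eq_nil_iff] at h
    exact h.resolve_left (by omega)
  · rcases h2 with h2 | h2
    · exact Or.inl (List.take_of_length_le h2)
    · exact Or.inr h2
  · have hle := h.length_le
    have : y.length ∈ {l | 1 ≤ l ∧ ((σ s).length ≤ l ∨ IsGreen σ ((σ s).take l))} := by
      refine ⟨List.length_pos_iff.2 hy, Or.inr ?_⟩
      rwa [← List.prefix_iff_eq_take.1 ((List.prefix_append _ _).trans (h.trans (cut_prefix σ s)))]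
    have := Nat.sInf_le this
    have h3 : (cut σ s).length ≤ _ := List.length_take_le _ (σ s)
    simp only [List.length_append, List.length_singleton] at hle
    omega

/-- Nodes that carry an old name are nodes of the cut tree. -/
lemma prefix_cut_of_prefix_advance {s : S} {x : Branch} (hx : ∀ e ∈ x, e.2 < N)
    (h : x <+: advance k N RR GG E π s) : x <+: cut (chosen k N RR GG E π) s := by
  rcases x.eq_nil_or_concat with rfl | ⟨y, e, rfl⟩
  · simp
  · rw [advance] at h
    split_ifs at h with h0
    · simp at h
    · rw [List.concat_eq_append] at h hx ⊢
      rcases concat_prefix_expand h with h | ⟨-, -, rfl⟩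
      · exact h
      · have := hx _ (List.mem_append_right _ (List.mem_singleton_self _))
        have := le_freshName N y (nextIndex k y (k + 1))
        simp only at *
        omega

lemma prefix_advance_of_prefix_cut {s : S} {x : Branch}
    (h : x <+: cut (chosen k N RR GG E π) s) : x <+: advance k N RR GG E π s := by
  rw [advance]
  split_ifs with h0
  · rwa [h0] at h
  · exact h.trans (prefix_expand _ _ _ _)

lemma prefix_chosen_of_prefix_advance {s : S} {x : Branch} (hx : ∀ e ∈ x, e.2 < N)
    (h : x <+: advance k N RR GG E π s) : x <+: chosen k N RR GG E π s :=
  (prefix_cut_of_prefix_advance hx h).trans (cut_prefix _ _)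

/-- A node of a chosen branch is an unaffected node of the tree, or new. -/
lemma concat_prefix_chosen {s : S} {x : Branch} {e : ℕ × ℕ}
    (h : x ++ [e] <+: chosen k N RR GG E π s) :
    (∀ f ∈ x, s ∉ RR f.1 ∧ s ∉ GG f.1) ∧
    ∃ t, π t ≠ [] ∧ E t s ∧ chosen k N RR GG E π s = update k N RR GG s [] (π t) ∧
    ((x ++ [e] <+: π t ∧ s ∉ RR e.1 ∧ s ∉ GG e.1) ∨
      ∃ f j, x ++ [f] <+: π t ∧ chosen k N RR GG E π s = x ++ [e] ∧ e = (j, freshName N x j) ∧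
      ((s ∈ RR f.1 ∧ j = nextIndex k x f.1) ∨ (s ∉ RR f.1 ∧ s ∈ GG f.1 ∧ j = f.1))) := by
  rcases chosen_cases (k := k) (N := N) (RR := RR) (GG := GG) (E := E) (π := π) s with
    ⟨t, h1, h2, h3, -⟩ | ⟨h1, -⟩
  · rw [h3] at h ⊢
    obtain ⟨h4, h5⟩ := concat_prefix_update h
    exact ⟨h4, t, h1, h2, rfl, h5⟩
  · rw [h1] at h
    simp at h

lemma chosen_ne_nil (hπ : IsTree k π) (hR : RR 0 = ∅) (hG : GG 0 = ∅) {s t : S} (ht : π t ≠ [])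
    (hE : E t s) : chosen k N RR GG E π s ≠ [] := by
  rcases chosen_cases (k := k) (N := N) (RR := RR) (GG := GG) (E := E) (π := π) s with
    ⟨u, h1, h2, h3, -⟩ | ⟨-, h1⟩
  · rw [h3]
    obtain ⟨e, he⟩ := (prefix_eq_or_concat (List.nil_prefix (l := π u))).resolve_left
      (fun h => h1 h.symm)
    have := hπ.root u e he
    subst this
    rcases update_of_concat_prefix (k := k) (N := N) (RR := RR) (GG := GG) (s := s) he
      (by simp) with h | h | h
    · simp [hR] at h
    · simp [hG] at h
    · intro h0
      simp [h0] at h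
  · exact absurd hE (h1 t ht)

lemma advance_ne_nil (hπ : IsTree k π) (hR : RR 0 = ∅) (hG : GG 0 = ∅) {s t : S} (ht : π t ≠ [])
    (hE : E t s) : advance k N RR GG E π s ≠ [] := by
  have h1 := chosen_ne_nil (N := N) hπ hR hG ht hE
  have h2 : cut (chosen k N RR GG E π) s ≠ [] := fun h => h1 ((cut_spec _ _).1 h)
  intro h
  have := prefix_advance_of_prefix_cut (List.prefix_refl (cut (chosen k N RR GG E π) s))
  rw [h] at this
  exact h2 (List.prefix_nil.1 this)

lemma step_ne_nil (hπ : IsTree k π) (hR : RR 0 = ∅) (hG : GG 0 = ∅) {s t : S} (ht : π t ≠ [])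
    (hE : E t s) : step k N RR GG E π s ≠ [] := by
  simpa [step, compress, renumber] using advance_ne_nil (N := N) hπ hR hG ht hE

lemma exists_pred_of_step_ne_nil {s : S} (h : step k N RR GG E π s ≠ []) :
    ∃ t, π t ≠ [] ∧ E t s := by
  by_contra h'
  have h1 : chosen k N RR GG E π s = [] := by rw [chosen, dif_neg h']
  have h2 := cut_prefix (chosen k N RR GG E π) s
  rw [h1, List.prefix_nil] at h2
  simp [step, compress, renumber, advance, h2] at h

lemma index_chosen (hπ : IsTree k π) {s : S} {x : Branch} {e : ℕ × ℕ} (hx : x ≠ [])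
    (h : x ++ [e] <+: chosen k N RR GG E π s) :
    (avail k x).Nonempty ∧ (e.1 = 0 ∨ e.1 ∈ avail k x) := by
  obtain ⟨-, t, -, -, -, h | ⟨f, j, hf, -, rfl, ⟨-, rfl⟩ | ⟨-, -, rfl⟩⟩⟩ := concat_prefix_chosen h
  · exact hπ.index t x e hx h.1
  · exact ⟨(hπ.index t x f hx hf).1, nextIndex_mem⟩
  · exact hπ.index t x f hx hf

lemma isTree_advance (hπ : IsTree k π) (hN : ∀ a ∈ names π, a < N) (hR : RR 0 = ∅)
    (hG : GG 0 = ∅) : IsTree k (advance k N RR GG E π) := by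
  set σ := chosen k N RR GG E π with hσ
  refine isTree_expand (N := N) (τ := cut σ) hπ.unique hN ?_ ?_ ?_ ?_ ?_ ?_
  · intro s e h
    obtain ⟨-, t, -, -, -, h | ⟨f, j, hf, -, rfl, h' | h'⟩⟩ :=
      concat_prefix_chosen (x := []) (h.trans (cut_prefix _ _))
    · exact hπ.root t e h.1
    · rw [hπ.root t f hf, hR] at h'
      exact h'.1.elim
    · rw [hπ.root t f hf, hG] at h'
      exact h'.2.1.elim
  · intro s x e hx h
    exact index_chosen hπ hx (h.trans (cut_prefix _ _))
  · intro s x e h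
    obtain ⟨-, t, -, -, -, h | ⟨f, j, -, -, rfl, -⟩⟩ :=
      concat_prefix_chosen (h.trans (cut_prefix _ _))
    · exact hπ.name_lt t x e h.1
    · exact fun f hf => lt_freshName hf
  · intro s x e h
    obtain ⟨-, t, -, -, -, h | ⟨f, j, -, -, rfl, -⟩⟩ :=
      concat_prefix_chosen (h.trans (cut_prefix _ _))
    · exact Or.inl ⟨t, h.1⟩
    · exact Or.inr rfl
  · intro s x e hx h
    have := (cut_spec σ s).2.2 x e hx h
    simp only [IsGreen, not_forall] at this
    obtain ⟨t, f, hf, hf0⟩ := this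
    refine ⟨t, f, hf0, ?_⟩
    rcases prefix_dichotomy ((List.prefix_append x [f]).trans hf) (cut_prefix σ t) with h1 | ⟨g, h1⟩
    · exfalso
      obtain ⟨c1, c2, -⟩ := cut_spec σ t
      have hne : cut σ t ≠ [] := by
        intro h0
        rw [c1 h0] at hf
        simp at hf
      rcases c2 with c2 | c2
      · rw [c2] at h1
        have := (hf.trans h1).length_le
        simp at this
      · rcases prefix_eq_or_concat h1 with h2 | ⟨g, hg⟩
        · rw [h2] at c2
          exact hf0 (c2 t f hf)
        · exact (cut_spec σ s).2.2 _ g hne (hg.trans ((List.prefix_append _ _).trans h)) c2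
    · rwa [concat_prefix_unique hf (h1.trans (cut_prefix σ t))]
  · intro s
    by_cases h : cut σ s = []
    · exact Or.inl ⟨h, by simp [advance, ← hσ, h]⟩
    · exact Or.inr ⟨h, by simp [advance, ← hσ, h]⟩

lemma isTree_step (hπ : IsTree k π) (hN : ∀ a ∈ names π, a < N) (hR : RR 0 = ∅)
    (hG : GG 0 = ∅) : IsTree k (step k N RR GG E π) :=
  (isTree_advance hπ hN hR hG).compress

lemma isCompact_step : IsCompact (step k N RR GG E π) := isCompact_compress _

section Stable

variable {c : ℕ} (hc : IsCompact π) (hd : ∀ b ≤ c, ¬ Dead k N RR GG E π b)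
include hc hd

lemma rank_eq_of_not_dead {a : ℕ} (ha : a ∈ names π) (hac : a ≤ c) :
    rank (advance k N RR GG E π) a = a := by
  rw [rank_eq_iff]
  intro b hb
  by_contra h
  exact hd b (by omega) ⟨hc a ha b hb, h⟩

lemma renumber_eq {x : Branch} (hx : ∀ e ∈ x, e.2 ≤ c ∧ e.2 ∈ names π) :
    renumber (advance k N RR GG E π) x = x := by
  rw [renumber]
  conv_rhs => rw [← List.map_id x]
  refine List.map_congr_left fun e he => ?_
  rw [rank_eq_of_not_dead hc hd (hx e he).2 (hx e he).1]
  rfl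

/-- If no small name is removed, then the nodes with small names stay in place. -/
lemma prefix_step_iff {x : Branch} (hx : ∀ e ∈ x, e.2 ≤ c ∧ e.2 ∈ names π) {s : S} :
    x <+: step k N RR GG E π s ↔ x <+: advance k N RR GG E π s := by
  have hrel := renumber_eq hc hd hx
  constructor
  · intro h
    obtain ⟨l, hl, h⟩ := List.prefix_map_iff.1 h
    change x = renumber _ l at h
    rw [← hrel] at h
    rwa [renumber_inj (fun e he => ?_) (fun e he => mem_names_of_mem (hl.subset he)) h]
    by_contra h'
    exact hd e.2 (hx e he).1 ⟨(hx e he).2, h'⟩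
  · intro h
    rw [← hrel]
    exact h.map _

end Stable

end Step

open CategoryTheory Opposite in
/-- In a finite system in which all states have predecessors there is an infinite path. -/
lemma exists_path {S : Type} [Finite S] {U : ℕ → Set S} {C : ℕ → S → S → Prop}
    (hne : ∀ t, (U t).Nonempty) (h : ∀ t, ∀ s' ∈ U (t + 1), ∃ s ∈ U t, C t s s') :
    ∃ r : ℕ → S, ∀ t, r t ∈ U t ∧ C t (r t) (r (t + 1)) := by
  choose! f hf hC using h
  let F : ℕᵒᵖ ⥤ Type := Functor.ofOpSequence (X := fun t => (U t : Type))
    fun t => ↾fun s => ⟨f t s.1, hf t s.1 s.2⟩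
  have : ∀ j, Finite (F.obj j) := fun j => inferInstanceAs (Finite (U j.unop))
  have : ∀ j, Nonempty (F.obj j) := fun j => (hne j.unop).to_subtype
  obtain ⟨u, hu⟩ := nonempty_sections_of_finite_inverse_system F
  refine ⟨fun t => (show U t from u (op t)).1, fun t => ⟨(show U t from u (op t)).2, ?_⟩⟩
  have h1 := hu (homOfLE (Nat.le_succ t)).op
  have h2 : F.map (homOfLE (Nat.le_succ t)).op =
      ↾fun s : U (t + 1) => (⟨f t s.1, hf t s.1 s.2⟩ : U t) :=
    Functor.ofOpSequence_map_homOfLE_succ _ _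
  rw [h2] at h1
  have h3 := hC t _ (show U (t + 1) from u (op (t + 1))).2
  have h4 : f t (show U (t + 1) from u (op (t + 1))).1 = (show U t from u (op t)).1 :=
    congrArg Subtype.val h1
  rwa [h4] at h3

section Step

variable {S : Type} [Fintype S] {k N : ℕ} {RR GG : ℕ → Set S} {E : S → S → Prop} {π : S → Branch}

/-- A node that carries an old name is an unaffected node of some predecessor. -/
lemma exists_pred_of_prefix_advance (hA : IsTree k (advance k N RR GG E π)) {s : S} {x : Branch}
    {e : ℕ × ℕ} (he : e.2 < N) (h : x ++ [e] <+: advance k N RR GG E π s) :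
    (∀ f ∈ x ++ [e], s ∉ RR f.1 ∧ s ∉ GG f.1) ∧ ∃ t, x ++ [e] <+: π t ∧ E t s ∧
      chosen k N RR GG E π s = update k N RR GG s [] (π t) := by
  have hx : ∀ f ∈ x ++ [e], f.2 < N := by
    intro f hf
    rcases List.mem_append.1 hf with hf | hf
    · exact (hA.name_lt s x e h f hf).trans he
    · rwa [List.mem_singleton.1 hf]
  obtain ⟨h1, t, -, hE, ht, h2 | ⟨f, j, -, -, rfl, -⟩⟩ :=
    concat_prefix_chosen (prefix_chosen_of_prefix_advance hx h)
  · refine ⟨fun f hf => ?_, t, h2.1, hE, ht⟩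
    rcases List.mem_append.1 hf with hf | hf
    · exact h1 f hf
    · rw [List.mem_singleton.1 hf]
      exact h2.2
  · have := le_freshName N x j
    simp only at he
    omega

omit [Fintype S] in
/-- Branches are not cut at nodes that are not green. -/
lemma concat_prefix_cut {σ : S → Branch} {s : S} {x : Branch} {e : ℕ × ℕ}
    (h : x ++ [e] <+: σ s) (hx : x <+: cut σ s) (hg : ¬ IsGreen σ x) : x ++ [e] <+: cut σ s := by
  rcases prefix_eq_or_concat hx with h1 | ⟨f, hf⟩
  · rcases (cut_spec σ s).2.1 with h2 | h2
    · rwa [h2]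
    · rw [← h1] at h2
      exact absurd h2 hg
  · rwa [concat_prefix_unique h (hf.trans (cut_prefix _ _))]

/-- The successor of a green node in its branch is new. -/
lemma index_of_isGreen {s : S} {x : Branch} {e : ℕ × ℕ} (hx : x ≠ [])
    (h : x ++ [e] <+: advance k N RR GG E π s) (hg : IsGreen (chosen k N RR GG E π) x) :
    e.1 = nextIndex k x (k + 1) := by
  rw [advance] at h
  split_ifs at h with h0
  · simp at h
  · rcases concat_prefix_expand h with h | h
    · exact absurd hg ((cut_spec _ _).2.2 x e hx h)
    · rw [h.2.2]

end Step

section Run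

variable {S : Type} [Fintype S]

/-- A run of the construction on a sequence of relations, from a tree of its state space. -/
structure IsTreeRun (k N : ℕ) (RR GG : ℕ → Set S) (E : ℕ → S → S → Prop) (P : ℕ → S → Branch) :
    Prop where
  tree : ∀ t, IsTree k (P t)
  compact : ∀ t, IsCompact (P t)
  lt : ∀ t, ∀ a ∈ names (P t), a < N
  next : ∀ t, P (t + 1) = step k N RR GG (E t) (P t)
  red_zero : RR 0 = ∅
  green_zero : GG 0 = ∅

variable {k N : ℕ} {RR GG : ℕ → Set S} {E : ℕ → S → S → Prop} {P : ℕ → S → Branch}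

lemma IsTreeRun.tree_advance (h : IsTreeRun k N RR GG E P) (t : ℕ) :
    IsTree k (advance k N RR GG (E t) (P t)) :=
  isTree_advance (h.tree t) (h.lt t) h.red_zero h.green_zero

lemma IsTreeRun.name_le (h : IsTreeRun k N RR GG E P) {t : ℕ} {s : S} {x : Branch} {e : ℕ × ℕ}
    (hx : x ++ [e] <+: P t s) : ∀ f ∈ x ++ [e], f.2 ≤ e.2 ∧ f.2 ∈ names (P t) := by
  intro f hf
  refine ⟨?_, mem_names_of_mem (hx.subset hf)⟩
  rcases List.mem_append.1 hf with hf | hf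
  · exact ((h.tree t).name_lt s x e hx f hf).le
  · rw [List.mem_singleton.1 hf]

/-- A sequence of trees in which some name is eventually stable and infinitely often green contains
an accepting run. -/
theorem IsTreeRun.sound (h : IsTreeRun k N RR GG E P) {c t₀ : ℕ}
    (hd : ∀ t ≥ t₀, ∀ b ≤ c, ¬ Dead k N RR GG (E t) (P t) b)
    (hg : ∀ n, ∃ t ≥ n, Green k N RR GG (E t) (P t) c) :
    ∃ r : ℕ → S, P 0 (r 0) ≠ [] ∧ (∀ t, E t (r t) (r (t + 1))) ∧
      ∀ j ∈ Finset.Icc 1 k, (∃ n, ∀ t ≥ n, r t ∉ GG j) ∨ (∀ n, ∃ t ≥ n, r t ∈ RR j) := by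
  obtain ⟨t₁, ht₁, hcN, s, y, j, hy, -⟩ := hg t₀
  obtain ⟨-, s₁, hs₁, -, -⟩ := exists_pred_of_prefix_advance (h.tree_advance t₁) hcN hy
  set x := y ++ [(j, c)] with hx
  have hx0 : x ≠ [] := by simp [hx]
  -- the node `x` persists
  have hmove : ∀ t ≥ t₁, (∃ s, x <+: P t s) → ∀ s, x <+: P (t + 1) s ↔
      x <+: advance k N RR GG (E t) (P t) s := by
    rintro t ht ⟨s, hs⟩ s'
    rw [h.next]
    exact prefix_step_iff (h.compact t) (hd t (by omega)) (h.name_le hs)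
  have hnode : ∀ t ≥ t₁, ∃ s, x <+: P t s := by
    intro t ht
    induction t, ht using Nat.le_induction with
    | base => exact ⟨s₁, hs₁⟩
    | succ t ht ih =>
      have h1 : c ∈ names (advance k N RR GG (E t) (P t)) := by
        by_contra h'
        obtain ⟨s, hs⟩ := ih
        exact hd t (by omega) c le_rfl ⟨mem_names_of_prefix hs, h'⟩
      obtain ⟨s, z, i, hz⟩ := mem_names.1 h1
      obtain ⟨-, u, hu, -, -⟩ := exists_pred_of_prefix_advance (h.tree_advance t) hcN hz
      obtain ⟨s', hs'⟩ := ih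
      obtain ⟨rfl, he⟩ := (h.tree t).unique _ _ _ _ _ _ hs' hu rfl
      rw [← he] at hz
      exact ⟨s, (hmove t ht ⟨s', hs'⟩ s).2 hz⟩
  -- a run through the node
  obtain ⟨r, hr⟩ := exists_path (U := fun t => {s | P t s ≠ [] ∧ (t₁ ≤ t → x <+: P t s)})
    (C := fun t s s' => E t s s' ∧
      chosen k N RR GG (E t) (P t) s' = update k N RR GG s' [] (P t s)) (by
        intro t
        rcases le_or_gt t₁ t with ht | ht
        · obtain ⟨s, hs⟩ := hnode t ht
          exact ⟨s, fun h0 => by simp [h0, hx] at hs, fun _ => hs⟩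
        · by_contra hne
          have hall : ∀ u ≥ t, ∀ s, P u s = [] := by
            intro u hu
            induction u, hu using Nat.le_induction with
            | base =>
              intro s
              by_contra hs
              exact hne ⟨s, hs, fun h' => absurd h' (by omega)⟩
            | succ u hu ih =>
              intro s
              by_contra hs
              rw [h.next] at hs
              obtain ⟨v, hv, -⟩ := exists_pred_of_step_ne_nil hs
              exact hv (ih v)
          simp [hall t₁ ht.le, hx] at hs₁) (by
        rintro t s' ⟨h1, h2⟩
        rcases le_or_gt t₁ t with ht | ht
        · have h3 := (hmove t ht (hnode t ht) s').1 (h2 (by omega))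
          obtain ⟨-, u, hu, hE, hc⟩ := exists_pred_of_prefix_advance (h.tree_advance t) hcN h3
          exact ⟨u, ⟨fun h0 => by simp [h0] at hu, fun _ => hu⟩, hE, hc⟩
        · rw [h.next] at h1
          rcases chosen_cases (k := k) (N := N) (RR := RR) (GG := GG) (E := E t) (π := P t) s' with
            ⟨u, hu, hE, hc, -⟩ | ⟨-, hno⟩
          · exact ⟨u, ⟨hu, fun h' => absurd h' (by omega)⟩, hE, hc⟩
          · obtain ⟨u, hu, hE⟩ := exists_pred_of_step_ne_nil h1
            exact absurd hE (hno u hu))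
  refine ⟨r, (hr 0).1.1, fun t => (hr t).2.1, fun i hi => ?_⟩
  have hxP : ∀ t ≥ t₁, x <+: P t (r t) := fun t ht => (hr t).1.2 ht
  have hxA : ∀ t ≥ t₁, x <+: advance k N RR GG (E t) (P t) (r (t + 1)) := fun t ht =>
    (hmove t ht (hnode t ht) _).1 (hxP (t + 1) (by omega))
  have hblock : ∀ t ≥ t₁, ∀ f ∈ x, r (t + 1) ∉ RR f.1 ∧ r (t + 1) ∉ GG f.1 := fun t ht =>
    (exists_pred_of_prefix_advance (h.tree_advance t) hcN (hxA t ht)).1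
  by_cases hix : i ∈ avail k x
  swap
  · left
    simp only [mem_avail, Finset.mem_Icc.1 hi, and_self, true_and, not_forall, not_not] at hix
    obtain ⟨f, hf, rfl⟩ := hix
    refine ⟨t₁ + 1, fun t ht => ?_⟩
    obtain ⟨t, rfl⟩ : ∃ u, t = u + 1 := ⟨t - 1, by omega⟩
    exact (hblock t (by omega) f hf).2
  · right
    by_contra hfin
    push Not at hfin
    obtain ⟨n, hn⟩ := hfin
    have hgreen : ∀ t ≥ t₁, Green k N RR GG (E t) (P t) c →
        IsGreen (chosen k N RR GG (E t) (P t)) x := by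
      rintro t ht ⟨-, s, z, l, hz, hgr⟩
      obtain ⟨rfl, he⟩ := (h.tree_advance t).unique _ _ _ _ _ _ hz (hxA t ht) rfl
      rwa [hx, ← he]
    have hrel : ∀ t ≥ t₁, ∀ e, x ++ [e] <+: advance k N RR GG (E t) (P t) (r (t + 1)) →
        ∃ f, x ++ [f] <+: P (t + 1) (r (t + 1)) ∧ f.1 = e.1 := by
      intro t ht e he
      have h1 := renumber_concat_prefix (π := advance k N RR GG (E t) (P t)) he
      rw [renumber_eq (h.compact t) (hd t (by omega)) (h.name_le (hxP t ht))] at h1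
      exact ⟨(e.1, rank (advance k N RR GG (E t) (P t)) e.2), by rw [h.next]; exact h1, rfl⟩
    obtain ⟨t₂, ht₂, hg₂⟩ := hg (max n t₁)
    have hchosen : ∀ t > t₂, ∀ e, x ++ [e] <+: P t (r t) → i ≤ e.1 →
        ∃ f, x ++ [f] <+: chosen k N RR GG (E t) (P t) (r (t + 1)) ∧ i ≤ f.1 := by
      intro t ht e he hie
      rw [(hr t).2.2]
      rcases update_of_concat_prefix (k := k) (N := N) (RR := RR) (GG := GG) he
        (hblock t (by omega)) with ⟨h1, h2⟩ | ⟨-, -, h2⟩ | ⟨-, -, h2⟩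
      · rw [h2]
        refine ⟨_, List.prefix_rfl, le_nextIndex hix (lt_of_le_of_ne hie ?_)⟩
        rintro rfl
        exact hn (t + 1) (by omega) h1
      · rw [h2]
        exact ⟨_, List.prefix_rfl, hie⟩
      · exact ⟨e, h2, hie⟩
    have hi1 := (mem_avail.1 hix).1.1
    have hwait : ∀ t ≥ t₂ + 1, ∃ e, x ++ [e] <+: P t (r t) ∧ i ≤ e.1 := by
      intro t ht
      induction t, ht using Nat.le_induction with
      | base =>
        have h1 := hxA t₂ (by omega)
        rcases prefix_eq_or_concat h1 with h2 | ⟨e, he⟩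
        · have := (h.tree_advance t₂).leaf (r (t₂ + 1)) (by rw [← h2]; exact hx0)
          rw [← h2] at this
          simp [this] at hix
        · obtain ⟨f, hf, hfe⟩ := hrel t₂ (by omega) e he
          refine ⟨f, hf, ?_⟩
          rw [hfe, index_of_isGreen hx0 he (hgreen t₂ (by omega) hg₂)]
          exact le_nextIndex hix (Nat.lt_succ_of_le (mem_avail.1 hix).1.2)
      | succ t ht ih =>
        obtain ⟨e, he, hie⟩ := ih
        obtain ⟨f, hf, hif⟩ := hchosen t (by omega) e he hie
        have hng : ¬ IsGreen (chosen k N RR GG (E t) (P t)) x := fun hgr => by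
          have := hgr _ f hf
          omega
        have hcut := concat_prefix_cut hf (prefix_cut_of_prefix_advance (fun e he =>
          h.lt t _ (h.name_le (hxP t (by omega)) e he).2) (hxA t (by omega))) hng
        obtain ⟨g, hg, hgf⟩ := hrel t (by omega) f (prefix_advance_of_prefix_cut hcut)
        exact ⟨g, hg, by omega⟩
    obtain ⟨t, ht, hgt⟩ := hg (t₂ + 1)
    obtain ⟨e, he, hie⟩ := hwait t ht
    obtain ⟨f, hf, hif⟩ := hchosen t ht e he hie
    have := hgreen t (by omega) hgt _ f hf
    omega

lemma eventually_const {f : ℕ → ℕ} {n : ℕ} (hf : ∀ t ≥ n, f (t + 1) ≤ f t) :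
    ∃ m ≥ n, ∀ t ≥ m, f t = f m := by
  obtain ⟨m, hm, hmin⟩ := WellFounded.has_min (measure f).wf (Set.Ici n) ⟨n, Set.self_mem_Ici⟩
  refine ⟨m, hm, fun t ht => le_antisymm ?_ (not_lt.1 (hmin t (le_trans hm ht)))⟩
  induction t, ht using Nat.le_induction with
  | base => exact le_rfl
  | succ t ht ih => exact (hf t (le_trans hm ht)).trans ih

lemma IsTreeRun.exists_extension (h : IsTreeRun k N RR GG E P) {r : ℕ → S}
    (hE : ∀ t, E t (r t) (r (t + 1)))
    (hacc : ∀ j ∈ Finset.Icc 1 k, (∃ n, ∀ t ≥ n, r t ∉ GG j) ∨ (∀ n, ∃ t ≥ n, r t ∈ RR j))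
    {y : Branch} {a : ℕ × ℕ} {t₀ : ℕ} (hx : ∀ t ≥ t₀, y ++ [a] <+: P t (r t))
    (hd : ∀ t ≥ t₀, ∀ b ≤ a.2, ¬ Dead k N RR GG (E t) (P t) b)
    (hg : ¬ ∀ n, ∃ t ≥ n, Green k N RR GG (E t) (P t) a.2) :
    ∃ e, a.2 < e.2 ∧ ∃ t₁, ∀ t ≥ t₁, y ++ [a] ++ [e] <+: P t (r t) ∧
      ∀ b ≤ e.2, ¬ Dead k N RR GG (E t) (P t) b := by
  set x := y ++ [a] with hxdef
  have hx0 : x ≠ [] := by simp [hxdef]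
  push Not at hg
  obtain ⟨n', hn'⟩ := hg
  obtain ⟨n, hnt, hn⟩ : ∃ n ≥ t₀, ∀ t ≥ n, ¬ Green k N RR GG (E t) (P t) a.2 :=
    ⟨max n' t₀, le_max_right _ _, fun t ht => hn' t (by omega)⟩
  have hxA : ∀ t ≥ n, x <+: advance k N RR GG (E t) (P t) (r (t + 1)) := by
    intro t ht
    have h1 := hx (t + 1) (by omega)
    rw [h.next] at h1
    exact (prefix_step_iff (h.compact t) (hd t (by omega)) (h.name_le (hx t (by omega)))).1 h1
  have haN : a.2 < N := h.lt n _ (mem_names_of_prefix (hx n hnt))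
  have hblock : ∀ t ≥ n, ∀ f ∈ x, r (t + 1) ∉ RR f.1 ∧ r (t + 1) ∉ GG f.1 := fun t ht =>
    (exists_pred_of_prefix_advance (h.tree_advance t) haN (hxA t ht)).1
  have hng : ∀ t ≥ n, ¬ IsGreen (chosen k N RR GG (E t) (P t)) x := fun t ht hgr =>
    hn t ht ⟨haN, r (t + 1), y, a.1, hxA t ht, hgr⟩
  have hav : (avail k x).Nonempty := by
    have := hng n le_rfl
    simp only [IsGreen, not_forall] at this
    obtain ⟨s, e, he, -⟩ := this
    exact (index_chosen (h.tree n) hx0 he).1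
  have hent : ∀ t, ∃ e, n ≤ t → x ++ [e] <+: P t (r t) := by
    intro t
    by_cases ht : n ≤ t
    · rcases prefix_eq_or_concat (hx t (by omega)) with h1 | ⟨e, he⟩
      · have := (h.tree t).leaf (r t) (by rw [← h1]; exact hx0)
        rw [← h1] at this
        simp [this] at hav
      · exact ⟨e, fun _ => he⟩
    · exact ⟨(0, 0), fun h' => absurd h' ht⟩
  choose e he using hent
  -- the evolution of the entry after `x`
  have hstep : ∀ t ≥ n, ∃ g : ℕ × ℕ, e (t + 1) = (g.1, rank (advance k N RR GG (E t) (P t)) g.2) ∧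
      g.2 ∈ names (advance k N RR GG (E t) (P t)) ∧
      ((r (t + 1) ∈ RR (e t).1 ∧ g.1 ≤ nextIndex k x (e t).1) ∨
      (r (t + 1) ∉ RR (e t).1 ∧ r (t + 1) ∈ GG (e t).1 ∧ g.1 ≤ (e t).1) ∨
      (r (t + 1) ∉ RR (e t).1 ∧ r (t + 1) ∉ GG (e t).1 ∧
        (g.1 < (e t).1 ∨ (g.1 = (e t).1 ∧ g.2 ≤ (e t).2)))) := by
    intro t ht
    have hP : P t (r t) ≠ [] := fun h0 => by
      have := hx t (by omega)
      rw [h0, List.prefix_nil] at this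
      exact hx0 this
    have hkey : key (chosen k N RR GG (E t) (P t) (r (t + 1))) ≤
        key (update k N RR GG (r (t + 1)) [] (P t (r t))) := by
      rcases chosen_cases (k := k) (N := N) (RR := RR) (GG := GG) (E := E t) (π := P t)
        (r (t + 1)) with ⟨u, -, -, -, hmin⟩ | ⟨-, hno⟩
      · exact hmin _ hP (hE t)
      · exact absurd (hE t) (hno _ hP)
    have hcut : x <+: cut (chosen k N RR GG (E t) (P t)) (r (t + 1)) :=
      prefix_cut_of_prefix_advance (fun e he =>
        h.lt t _ (h.name_le (hx t (by omega)) e he).2) (hxA t ht)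
    obtain ⟨g, hg⟩ : ∃ g, x ++ [g] <+: cut (chosen k N RR GG (E t) (P t)) (r (t + 1)) := by
      rcases prefix_eq_or_concat hcut with h1 | h1
      · exfalso
        rcases (cut_spec (chosen k N RR GG (E t) (P t)) (r (t + 1))).2.1 with h2 | h2
        · rw [← h1] at h2
          rcases chosen_cases (k := k) (N := N) (RR := RR) (GG := GG) (E := E t) (π := P t)
            (r (t + 1)) with ⟨u, hu, -, h3, -⟩ | ⟨h3, -⟩
          · rw [← h2] at h3
            rcases update_cases (k := k) (N := N) (RR := RR) (GG := GG) (s := r (t + 1)) []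
              (P t u) with ⟨h4, -⟩ | ⟨q, -, -, j, -, -, h4, -⟩
            · have := (h.tree t).leaf u hu
              rw [← List.nil_append (P t u), ← h4, ← h3] at this
              simp [this] at hav
            · rw [← h3, hxdef, addNode] at h4
              have h5 : a = (j, freshName N ([] ++ q) j) := by
                simpa using (List.append_inj' h4 rfl).2
              have := le_freshName N ([] ++ q) j
              rw [h5] at haN
              simp only at haN
              omega
          · exact hx0 (h2.trans h3)
        · rw [← h1] at h2
          exact hng t ht h2
      · exact h1
    have hg' := hg.trans (cut_prefix _ _)
    have hgA := prefix_advance_of_prefix_cut hg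
    refine ⟨g, ?_, mem_names_of_prefix hgA, ?_⟩
    · have h1 := renumber_concat_prefix (π := advance k N RR GG (E t) (P t)) hgA
      rw [renumber_eq (h.compact t) (hd t (by omega)) (h.name_le (hx t (by omega)))] at h1
      have h2 := he (t + 1) (by omega)
      rw [h.next] at h2
      exact concat_prefix_unique h2 h1
    · rcases update_of_concat_prefix (k := k) (N := N) (RR := RR) (GG := GG) (he t ht)
        (hblock t ht) with ⟨h1, h2⟩ | ⟨h1, h1', h2⟩ | ⟨h1, h1', h2⟩
      · left
        rw [h2] at hkey
        have := le_of_key_le hg' List.prefix_rfl hkey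
        exact ⟨h1, by simp only at this; omega⟩
      · right; left
        rw [h2] at hkey
        have := le_of_key_le hg' List.prefix_rfl hkey
        exact ⟨h1, h1', by simp only at this; omega⟩
      · right; right
        exact ⟨h1, h1', le_of_key_le hg' h2 hkey⟩
  have hidx : ∀ t ≥ n, (e (t + 1)).1 ≤ (e t).1 := by
    intro t ht
    obtain ⟨g, hg, -, hc⟩ := hstep t ht
    have := nextIndex_le (k := k) (x := x) (j := (e t).1)
    rw [hg]
    simp only
    omega
  obtain ⟨m, hm, hconst⟩ := eventually_const (f := fun t => (e t).1) hidx
  obtain ⟨l, hl, hGG, hRR⟩ : ∃ l ≥ m, (∀ t ≥ l, r (t + 1) ∉ GG (e m).1) ∧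
      ∀ t ≥ l, r (t + 1) ∉ RR (e m).1 := by
    rcases ((h.tree m).index _ _ _ hx0 (he m hm)).2 with h0 | h0
    · exact ⟨m, le_rfl, fun t _ => by simp [h0, h.green_zero], fun t _ => by simp [h0, h.red_zero]⟩
    · have hj := (mem_avail.1 h0).1
      have hRR : ∀ t ≥ m, r (t + 1) ∉ RR (e m).1 := by
        intro t ht hr
        obtain ⟨g, hg, -, hc⟩ := hstep t (le_trans hm ht)
        have h1 := hconst (t + 1) (by omega)
        rw [hconst t ht] at hc
        have := nextIndex_lt (k := k) (x := x) (j := (e m).1) (by omega)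
        rw [hg] at h1
        rcases hc with hc | hc | hc
        · omega
        · exact hc.1 hr
        · exact hc.1 hr
      rcases hacc _ (Finset.mem_Icc.2 hj) with ⟨q, hq⟩ | hq
      · exact ⟨max q m, le_max_right _ _, fun t ht => hq _ (by omega),
          fun t ht => hRR t (by omega)⟩
      · obtain ⟨t, ht, hr⟩ := hq (m + 1)
        obtain ⟨t, rfl⟩ : ∃ u, t = u + 1 := ⟨t - 1, by omega⟩
        exact absurd hr (hRR t (by omega))
  have hname : ∀ t ≥ l, ∃ g : ℕ × ℕ, (e (t + 1)).2 = rank (advance k N RR GG (E t) (P t)) g.2 ∧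
      g.2 ∈ names (advance k N RR GG (E t) (P t)) ∧ g.2 ≤ (e t).2 := by
    intro t ht
    obtain ⟨g, hg, hg', hc⟩ := hstep t (by omega)
    refine ⟨g, by rw [hg], hg', ?_⟩
    have h1 := hconst (t + 1) (by omega)
    rw [hconst t (by omega)] at hc
    rw [hg] at h1
    simp only at h1
    rcases hc with hc | hc | hc
    · exact absurd hc.1 (hRR t ht)
    · exact absurd hc.2.1 (hGG t ht)
    · omega
  obtain ⟨q, hq, hqc⟩ := eventually_const (f := fun t => (e t).2) (n := l) fun t ht => by
    obtain ⟨g, hg, -, hle⟩ := hname t ht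
    simp only [hg]
    exact (rank_le _ _).trans hle
  have heq : ∀ t ≥ q, e t = e q := fun t ht =>
    Prod.ext ((hconst t (by omega)).trans (hconst q (by omega)).symm) (hqc t ht)
  refine ⟨e q, (h.tree q).name_lt _ _ _ (he q (by omega)) a (by simp [hxdef]), q, fun t ht =>
    ⟨by rw [← heq t ht]; exact he t (by omega), fun b hb => ?_⟩⟩
  obtain ⟨g, hg, hmem, hle⟩ := hname t (by omega)
  rw [hqc (t + 1) (by omega)] at hg
  rw [hqc t ht] at hle
  have h1 := rank_le (advance k N RR GG (E t) (P t)) g.2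
  have h2 : g.2 = (e q).2 := by omega
  rw [h2] at hg hmem
  rintro ⟨-, hb'⟩
  rcases hb.lt_or_eq with hb | rfl
  · exact hb' (rank_eq_iff.1 hg.symm b hb)
  · exact hb' hmem

/-- If there is an accepting run, then some name is eventually stable and infinitely often green. -/
theorem IsTreeRun.complete (h : IsTreeRun k N RR GG E P) {r : ℕ → S} (h0 : P 0 (r 0) ≠ [])
    (hE : ∀ t, E t (r t) (r (t + 1)))
    (hacc : ∀ j ∈ Finset.Icc 1 k, (∃ n, ∀ t ≥ n, r t ∉ GG j) ∨ (∀ n, ∃ t ≥ n, r t ∈ RR j)) :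
    ∃ c t₀, (∀ t ≥ t₀, ∀ b ≤ c, ¬ Dead k N RR GG (E t) (P t) b) ∧
      ∀ n, ∃ t ≥ n, Green k N RR GG (E t) (P t) c := by
  have halive : ∀ t, P t (r t) ≠ [] := by
    intro t
    induction t with
    | zero => exact h0
    | succ t ih =>
      rw [h.next]
      exact step_ne_nil (h.tree t) h.red_zero h.green_zero ih (hE t)
  by_contra hcon
  have hroot : ∀ π : S → Branch, IsTree k π → ∀ s, π s ≠ [] → [(0, 0)] <+: π s := by
    intro π hπ s hs
    obtain ⟨e, he⟩ := (prefix_eq_or_concat (List.nil_prefix (l := π s))).resolve_left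
      (fun h => hs h.symm)
    obtain rfl := hπ.root s e he
    exact he
  have hall : ∀ l, ∃ (y : Branch) (a : ℕ × ℕ) (t₀ : ℕ), l ≤ a.2 ∧ ∀ t ≥ t₀,
      y ++ [a] <+: P t (r t) ∧ ∀ b ≤ a.2, ¬ Dead k N RR GG (E t) (P t) b := by
    intro l
    induction l with
    | zero =>
      refine ⟨[], (0, 0), 0, le_rfl, fun t _ => ⟨hroot _ (h.tree t) _ (halive t), ?_⟩⟩
      rintro b hb ⟨-, hb'⟩
      obtain rfl := Nat.le_zero.1 hb
      refine hb' (mem_names_of_prefix (x := []) (hroot _ (h.tree_advance t) (r (t + 1)) ?_))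
      exact advance_ne_nil (h.tree t) h.red_zero h.green_zero (halive t) (hE t)
    | succ l ih =>
      obtain ⟨y, a, t₀, hl, hx⟩ := ih
      obtain ⟨e, he, t₁, ht₁⟩ := h.exists_extension hE hacc (fun t ht => (hx t ht).1)
        (fun t ht => (hx t ht).2) fun hg => hcon ⟨a.2, t₀, fun t ht => (hx t ht).2, hg⟩
      exact ⟨y ++ [a], e, t₁, by omega, ht₁⟩
  obtain ⟨y, a, t₀, hl, hx⟩ := hall N
  have := h.lt t₀ _ (mem_names_of_prefix (hx t₀ le_rfl).1)
  omega

end Run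

section Count

variable {S : Type} [Fintype S]

/-- The number of names below `a` of inner nodes other than the root, where `σ` gives the names of
the leaves. -/
def innerIndex (σ : S → ℕ) (a : ℕ) : ℕ :=
  open Classical in Nat.count (fun b => b ≠ 0 ∧ ∀ t, σ t ≠ b) a

/-- The names of leaves, the parents of names, and the indices of inner nodes other than the root
of a tree. -/
structure IsCode (π : S → Branch) (σ : S → ℕ) (p l : ℕ → ℕ) : Prop where
  dead : ∀ s, π s = [] → σ s = 0
  alive : ∀ s x e, π s = x ++ [e] → x ≠ [] ∧ σ s = e.2
  parent : ∀ s x b e, x ++ [b] ++ [e] <+: π s → p e.2 = b.2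
  index : ∀ s x e, x ≠ [] → x ++ [e] <+: π s → (∀ t, σ t ≠ e.2) → l (innerIndex σ e.2) = e.1

omit [Fintype S] in
lemma IsTree.name_eq_zero_iff {k : ℕ} {π : S → Branch} (h : IsTree k π) {s : S} {x : Branch}
    {e : ℕ × ℕ} (hx : x ++ [e] <+: π s) : e.2 = 0 ↔ x = [] := by
  constructor
  · intro h0
    cases x with
    | nil => rfl
    | cons f x =>
      have := h.name_lt s _ e hx f (by simp)
      omega
  · rintro rfl
    rw [h.root s e hx]

lemma IsCode.pos_iff {k : ℕ} {π : S → Branch} (h : IsTree k π) {σ : S → ℕ} {p l : ℕ → ℕ}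
    (hC : IsCode π σ p l) (s : S) : 0 < σ s ↔ π s ≠ [] := by
  constructor
  · intro h0 h1
    have := hC.dead s h1
    omega
  · intro h1
    obtain ⟨x, e, hx⟩ := (List.eq_nil_or_concat (π s)).resolve_left h1
    rw [List.concat_eq_append] at hx
    obtain ⟨h2, h3⟩ := hC.alive s x e hx
    have := mt (h.name_eq_zero_iff (s := s) (by rw [hx])).1 h2
    omega

lemma IsCode.mem_names_iff {k : ℕ} {π : S → Branch} (h : IsTree k π) (hc : IsCompact π)
    {σ : S → ℕ} {p l : ℕ → ℕ} (hC : IsCode π σ p l) (a : ℕ) :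
    a ∈ names π ↔ ∃ s, 0 < σ s ∧ a ≤ σ s := by
  constructor
  · intro ha
    obtain ⟨s, x, j, hx⟩ := mem_names.1 ha
    have hs : π s ≠ [] := fun h0 => by simp [h0] at hx
    refine ⟨s, (hC.pos_iff h s).2 hs, ?_⟩
    obtain ⟨y, e, hy⟩ := (List.eq_nil_or_concat (π s)).resolve_left hs
    rw [List.concat_eq_append] at hy
    rw [(hC.alive s y e hy).2]
    have hm : (j, a) ∈ y ++ [e] := hy ▸ hx.subset (by simp)
    rcases List.mem_append.1 hm with hm | hm
    · exact (h.name_lt s y e (by rw [hy]) _ hm).le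
    · rw [← List.mem_singleton.1 hm]
  · rintro ⟨s, h0, ha⟩
    have hs := (hC.pos_iff h s).1 h0
    obtain ⟨y, e, hy⟩ := (List.eq_nil_or_concat (π s)).resolve_left hs
    rw [List.concat_eq_append] at hy
    rw [(hC.alive s y e hy).2] at ha
    have hm : e.2 ∈ names π := mem_names_of_prefix (s := s) (by rw [hy])
    rcases ha.lt_or_eq with ha | rfl
    · exact hc _ hm a ha
    · exact hm

omit [Fintype S] in
/-- A leaf waits for the only index available at its parent. -/
lemma IsTree.avail_parent_of_leaf {k : ℕ} {π : S → Branch} (h : IsTree k π) {s : S} {x : Branch}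
    {e : ℕ × ℕ} (hx : x ≠ []) (hs : π s = x ++ [e]) : avail k x = {e.1} := by
  have h1 := h.leaf s (by simp [hs])
  have h2 := (h.index s x e hx (by rw [hs])).1
  rw [hs] at h1
  have h3 : ∀ j ∈ avail k x, j = e.1 := by
    intro j hj
    by_contra hne
    have : j ∈ avail k (x ++ [e]) := by
      rw [mem_avail] at hj ⊢
      refine ⟨hj.1, fun f hf => ?_⟩
      rcases List.mem_append.1 hf with hf | hf
      · exact hj.2 f hf
      · rw [List.mem_singleton.1 hf]
        exact fun h' => hne h'.symm
    simp [h1] at this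
  exact (Finset.eq_singleton_iff_nonempty_unique_mem).2 ⟨h2, h3⟩

/-- Nodes of a tree are nodes of every tree with the same code. -/
lemma IsCode.node_mem {k : ℕ} {π π' : S → Branch} (h : IsTree k π) (hc : IsCompact π)
    (h' : IsTree k π') (hc' : IsCompact π') {σ : S → ℕ} {p l : ℕ → ℕ} (hC : IsCode π σ p l)
    (hC' : IsCode π' σ p l) {s : S} {x : Branch} {e : ℕ × ℕ} (hx : x ++ [e] <+: π s) :
    ∃ t, x ++ [e] <+: π' t := by
  induction hn : e.2 using Nat.strong_induction_on generalizing s x e with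
  | _ n ih =>
    have hm : e.2 ∈ names π' :=
      (hC'.mem_names_iff h' hc' _).2 ((hC.mem_names_iff h hc _).1 (mem_names_of_prefix hx))
    obtain ⟨t, y, j, hy⟩ := mem_names.1 hm
    refine ⟨t, ?_⟩
    rcases x.eq_nil_or_concat with rfl | ⟨z, b, rfl⟩
    · have h0 := (h.name_eq_zero_iff hx).2 rfl
      obtain rfl := (h'.name_eq_zero_iff hy).1 h0
      rwa [h.root s e hx, ← h'.root t _ hy]
    rw [List.concat_eq_append] at hx ⊢
    have hb : b.2 < e.2 := h.name_lt s _ e hx b (by simp)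
    rcases y.eq_nil_or_concat with rfl | ⟨z', b', rfl⟩
    · have := (h'.name_eq_zero_iff hy).2 rfl
      simp only at this
      omega
    rw [List.concat_eq_append] at hy
    have hbb : b'.2 = b.2 := by
      rw [← hC.parent s z b e hx, ← hC'.parent t z' b' _ hy]
    obtain ⟨u, hu⟩ := ih b.2 (by omega) ((List.prefix_append _ _).trans hx) rfl
    obtain ⟨rfl, rfl⟩ := h'.unique _ _ _ _ _ _ ((List.prefix_append _ _).trans hy) hu hbb
    have hj : j = e.1 := by
      by_cases hl : ∃ u, σ u = e.2
      · obtain ⟨u, hu⟩ := hl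
        have key : ∀ {π : S → Branch} (_ : IsTree k π) (_ : IsCode π σ p l) {v : S} {f : ℕ × ℕ},
            z' ++ [b'] ++ [f] <+: π v → f.2 = e.2 → avail k (z' ++ [b']) = {f.1} := by
          intro π h hC v f hv hf
          have hs := (hC.pos_iff h u).1 (by omega)
          obtain ⟨w, g, hw⟩ := (List.eq_nil_or_concat (π u)).resolve_left hs
          rw [List.concat_eq_append] at hw
          have hg := (hC.alive u w g hw).2
          obtain ⟨rfl, rfl⟩ := h.unique u v w _ g f (by rw [hw]) hv (by omega)
          exact h.avail_parent_of_leaf (by simp) hw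
        have h1 := key h hC hx rfl
        rw [key h' hC' hy rfl] at h1
        simpa using h1
      · push Not at hl
        have h1 := hC.index s _ e (by simp) hx hl
        have h2 := hC'.index t _ _ (by simp) hy hl
        exact h2.symm.trans h1
    rwa [hj] at hy

/-- A tree is determined by its code. -/
lemma IsCode.ext {k : ℕ} {π π' : S → Branch} (h : IsTree k π) (hc : IsCompact π)
    (h' : IsTree k π') (hc' : IsCompact π') {σ : S → ℕ} {p l : ℕ → ℕ} (hC : IsCode π σ p l)
    (hC' : IsCode π' σ p l) : π = π' := by
  funext s
  by_cases hs : π s = []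
  · have := (hC.pos_iff h s).not_left.2 hs
    rw [hs]
    by_contra hne
    exact this ((hC'.pos_iff h' s).2 (Ne.symm hne))
  · have hs' := (hC'.pos_iff h' s).1 ((hC.pos_iff h s).2 hs)
    obtain ⟨x, e, hx⟩ := (List.eq_nil_or_concat (π s)).resolve_left hs
    obtain ⟨y, f, hy⟩ := (List.eq_nil_or_concat (π' s)).resolve_left hs'
    rw [List.concat_eq_append] at hx hy
    obtain ⟨t, ht⟩ := hC.node_mem h hc h' hc' hC' (s := s) (x := x) (e := e) (by rw [hx])
    have h1 : e.2 = f.2 := by rw [← (hC.alive s x e hx).2, ← (hC'.alive s y f hy).2]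
    obtain ⟨rfl, rfl⟩ := h'.unique t s x y e f ht (by rw [hy]) h1
    rw [hx, hy]

omit [Fintype S] in
lemma IsTree.index_le {k : ℕ} {π : S → Branch} (h : IsTree k π) {s : S} {x : Branch} {e : ℕ × ℕ}
    (hx : x ++ [e] <+: π s) : e.1 ≤ k := by
  rcases eq_or_ne x [] with rfl | hx0
  · rw [h.root s e hx]
    exact Nat.zero_le _
  · rcases (h.index s x e hx0 hx).2 with h0 | h0
    · omega
    · exact (mem_avail.1 h0).1.2

lemma IsTree.innerIndex_lt [Nonempty S] {k : ℕ} (hk : 1 ≤ k) {π : S → Branch} (h : IsTree k π)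
    (hc : IsCompact π) {σ : S → ℕ} (hσ : ∀ s x e, π s = x ++ [e] → σ s = e.2)
    {s : S} {x : Branch} {e : ℕ × ℕ} (hx0 : x ≠ []) (hx : x ++ [e] <+: π s)
    (he : ∀ t, σ t ≠ e.2) : innerIndex σ e.2 < Fintype.card S * k - 1 := by
  classical
  set A := insert 0 ((Finset.range (e.2 + 1)).filter fun b => b ≠ 0 ∧ ∀ t, σ t ≠ b) with hA
  have hcard : A.card = innerIndex σ e.2 + 2 := by
    rw [hA, Finset.card_insert_of_notMem (by simp), innerIndex]
    simp only [ne_eq]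
    rw [← Nat.count_eq_card_filter_range, Nat.count_succ,
      if_pos ⟨mt (h.name_eq_zero_iff hx).1 hx0, he⟩]
  have hle : A.card ≤ Fintype.card S * k := by
    refine h.card_inner_le fun a ha => ?_
    have hm : e.2 ∈ names π := mem_names_of_prefix hx
    have hmem : a ∈ names π := by
      rcases Finset.mem_insert.1 ha with rfl | ha
      · rcases (Nat.zero_le e.2).lt_or_eq with h0 | h0
        · exact hc _ hm 0 h0
        · rwa [h0]
      · rcases (Nat.lt_succ_iff.1 (Finset.mem_range.1 (Finset.mem_filter.1 ha).1)).lt_or_eq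
          with h0 | rfl
        · exact hc _ hm a h0
        · exact hm
    obtain ⟨t, y, j, hy⟩ := mem_names.1 hmem
    rcases prefix_eq_or_concat hy with h1 | ⟨f, hf⟩
    · exfalso
      rcases Finset.mem_insert.1 ha with rfl | ha
      · obtain rfl := (h.name_eq_zero_iff hy).1 rfl
        have h2 := h.leaf t (by simp [← h1])
        rw [← h1] at h2
        have h3 : k ∈ avail k ([] ++ [(j, 0)]) := by
          rw [mem_avail]
          have := h.root t _ hy
          simp only [Prod.mk.injEq] at this
          simp only [List.nil_append, List.mem_singleton, forall_eq]
          omega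
        exact absurd (h2 ▸ h3) (Finset.notMem_empty k)
      · exact (Finset.mem_filter.1 ha).2.2 t (hσ t y _ h1.symm)
    · exact ⟨t, y, _, f, hf, rfl⟩
  omega

/-- The codes of trees range over a finite type. -/
lemma IsTree.exists_code [Nonempty S] {k : ℕ} (hk : 1 ≤ k) {π : S → Branch} (h : IsTree k π)
    (hc : IsCompact π) : ∃ c : (S → Fin (Fintype.card S * (k + 1))) ×
      ((i : Fin (Fintype.card S * (k + 1) - 1)) → Fin (i + 1)) ×
      (Fin (Fintype.card S * k - 1) → Fin (k + 1)),
      IsCode π (fun s => c.1 s)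
        (fun a => if h : a - 1 < Fintype.card S * (k + 1) - 1 then c.2.1 ⟨a - 1, h⟩ else 0)
        (fun q => if h : q < Fintype.card S * k - 1 then c.2.2 ⟨q, h⟩ else 0) := by
  classical
  have hpos : 0 < Fintype.card S * (k + 1) := Nat.mul_pos Fintype.card_pos (Nat.succ_pos k)
  have hσ : ∀ s, ∃ a : Fin (Fintype.card S * (k + 1)), (π s = [] → (a : ℕ) = 0) ∧
      ∀ x e, π s = x ++ [e] → (a : ℕ) = e.2 := by
    intro s
    rcases (List.eq_nil_or_concat (π s)) with h1 | ⟨x, e, hx⟩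
    · exact ⟨⟨0, hpos⟩, fun _ => rfl, fun x e hx => by simp [h1] at hx⟩
    · rw [List.concat_eq_append] at hx
      refine ⟨⟨e.2, h.name_lt_card hc (mem_names_of_prefix (s := s) (by rw [hx]))⟩,
        fun h0 => by simp [h0] at hx, fun y f hy => ?_⟩
      rw [hx] at hy
      have := (List.append_inj' hy rfl).2
      simp only [List.cons.injEq, and_true] at this
      exact congrArg Prod.snd this
  choose σ hσ0 hσ using hσ
  have hp : ∀ i : Fin (Fintype.card S * (k + 1) - 1), ∃ b : Fin (i + 1),
      ∀ s x c e, x ++ [c] ++ [e] <+: π s → e.2 - 1 = (i : ℕ) → c.2 = (b : ℕ) := by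
    intro i
    by_cases hex : ∃ s x c e, x ++ [c] ++ [e] <+: π s ∧ e.2 - 1 = (i : ℕ)
    · obtain ⟨s, x, c, e, hx, he⟩ := hex
      have hlt := h.name_lt s _ e hx c (by simp)
      refine ⟨⟨c.2, by omega⟩, fun t y d f hy hf => ?_⟩
      have hlt' := h.name_lt t _ f hy d (by simp)
      have := (h.unique s t _ _ e f hx hy (by omega)).1
      have := (List.append_inj' this rfl).2
      simp only [List.cons.injEq, and_true] at this
      exact congrArg Prod.snd this.symm
    · exact ⟨0, fun s x c e hx he => absurd ⟨s, x, c, e, hx, he⟩ hex⟩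
  choose p hp using hp
  have hl : ∀ q, ∃ j : Fin (k + 1), ∀ s x e, x ≠ [] → x ++ [e] <+: π s →
      (∀ t, (σ t : ℕ) ≠ e.2) → innerIndex (fun s => (σ s : ℕ)) e.2 = q → e.1 = (j : ℕ) := by
    intro q
    by_cases hex : ∃ s x e, x ≠ [] ∧ x ++ [e] <+: π s ∧ (∀ t, (σ t : ℕ) ≠ e.2) ∧
      innerIndex (fun s => (σ s : ℕ)) e.2 = q
    · obtain ⟨s, x, e, hx0, hx, he, hq⟩ := hex
      refine ⟨⟨e.1, Nat.lt_succ_of_le (h.index_le hx)⟩, fun t y f hy0 hy hf hq' => ?_⟩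
      have := Nat.count_injective (p := fun b => b ≠ 0 ∧ ∀ t, (σ t : ℕ) ≠ b)
        ⟨mt (h.name_eq_zero_iff hx).1 hx0, he⟩ ⟨mt (h.name_eq_zero_iff hy).1 hy0, hf⟩
        (hq.trans hq'.symm)
      exact congrArg Prod.fst (h.unique s t x y e f hx hy this).2.symm
    · exact ⟨0, fun s x e h1 h2 h3 h4 => absurd ⟨s, x, e, h1, h2, h3, h4⟩ hex⟩
  choose l hl using hl
  refine ⟨(σ, p, fun q => l q), hσ0, fun s x e hx => ⟨?_, hσ s x e hx⟩,
    fun s x b e hx => ?_, fun s x e hx0 hx he => ?_⟩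
  · rintro rfl
    have h2 := h.leaf s (by simp [hx])
    have h3 : k ∈ avail k (π s) := by
      rw [hx, mem_avail]
      have := h.root s e (by rw [hx]; simp)
      simp only [List.nil_append, List.mem_singleton, forall_eq, this]
      omega
    simp [h2] at h3
  · have h1 := h.name_lt s _ e hx b (by simp)
    have h2 := h.name_lt_card hc (mem_names_of_prefix hx)
    have h3 : e.2 - 1 < Fintype.card S * (k + 1) - 1 := by omega
    simp only [h3, dite_true]
    exact (hp ⟨_, h3⟩ s x b e hx rfl).symm
  · have h3 := h.innerIndex_lt hk hc hσ hx0 hx he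
    simp only [h3, dite_true]
    exact (hl _ s x e hx0 hx he rfl).symm

/-- The trees with compact names. -/
abbrev CompactTree (S : Type) [Fintype S] (k : ℕ) : Type :=
  {π : S → Branch // IsTree k π ∧ IsCompact π}

theorem exists_injective_code [Nonempty S] {k : ℕ} (hk : 1 ≤ k) :
    ∃ f : CompactTree S k → (S → Fin (Fintype.card S * (k + 1))) ×
      ((i : Fin (Fintype.card S * (k + 1) - 1)) → Fin (i + 1)) ×
      (Fin (Fintype.card S * k - 1) → Fin (k + 1)), Function.Injective f := by
  choose f hf using fun π : CompactTree S k => π.2.1.exists_code hk π.2.2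
  refine ⟨f, fun π π' hπ => Subtype.ext ?_⟩
  have h1 := hf π
  rw [hπ] at h1
  exact h1.ext π.2.1 π.2.2 π'.2.1 π'.2.2 (hf π')

lemma card_code_le {n k : ℕ} (hn : 1 ≤ n) (hk : 1 ≤ k) :
    (n * (k + 1)) ^ n * ((n * (k + 1) - 1).factorial * (k + 1) ^ (n * k - 1)) *
      (2 * (n * (k + 1)) + 1) ≤
      2 * n ^ n * (k + 1) ^ (n * (k + 1)) * (n * (k + 1)).factorial := by
  have hN : 1 ≤ n * (k + 1) := Nat.mul_pos hn (Nat.succ_pos k)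
  have hnk : 1 ≤ n * k := Nat.mul_pos hn hk
  have h1 : 2 * (n * (k + 1)) + 1 ≤ 2 * (n * (k + 1)) * (k + 1) := by nlinarith
  have h2 : (n * (k + 1)).factorial = n * (k + 1) * (n * (k + 1) - 1).factorial :=
    (Nat.mul_factorial_pred (by omega)).symm
  have h3 : (k + 1) ^ (n * (k + 1)) = (k + 1) ^ n * (k + 1) ^ (n * k - 1) * (k + 1) := by
    rw [mul_assoc, ← pow_succ, ← pow_add]
    congr 1
    rw [Nat.sub_add_cancel hnk]
    ring
  rw [h2, h3, mul_pow]
  calc _ ≤ n ^ n * (k + 1) ^ n * ((n * (k + 1) - 1).factorial * (k + 1) ^ (n * k - 1)) *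
      (2 * (n * (k + 1)) * (k + 1)) := Nat.mul_le_mul_left _ h1
    _ = _ := by ring

end Count

section Parity

lemma infOcc_inter_nonempty_iff {T : Type} [Finite T] {r : ℕ → T} {F : Set T} :
    (InfOcc r ∩ F).Nonempty ↔ ∀ n, ∃ t ≥ n, r t ∈ F := by
  constructor
  · rintro ⟨s, hs, hF⟩ n
    obtain ⟨t, ht, rfl⟩ := hs n
    exact ⟨t, ht, hF⟩
  · intro h
    by_contra hne
    have hb : ∀ s, ∃ n, s ∈ F → ∀ t ≥ n, r t ≠ s := by
      intro s
      by_cases hs : s ∈ InfOcc r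
      · exact ⟨0, fun hF => absurd ⟨s, hs, hF⟩ hne⟩
      · simp only [InfOcc, Set.mem_ofPred_eq, not_forall, not_exists, not_and] at hs
        obtain ⟨n, hn⟩ := hs
        exact ⟨n, fun _ => hn⟩
    choose n hn using hb
    obtain ⟨M, hM⟩ := (Set.finite_range n).bddAbove
    obtain ⟨t, ht, hF⟩ := h M
    exact hn (r t) hF t (le_trans (hM ⟨r t, rfl⟩) ht) rfl

lemma infOcc_inter_eq_empty_iff {T : Type} [Finite T] {r : ℕ → T} {F : Set T} :
    InfOcc r ∩ F = ∅ ↔ ∃ n, ∀ t ≥ n, r t ∉ F := by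
  rw [← Set.not_nonempty_iff_eq_empty, infOcc_inter_nonempty_iff]
  push Not
  rfl

lemma isPartition_fiber {T : Type} {m : ℕ} (q : T → Fin m) :
    IsPartition fun i => {s | q s = i} := by
  refine ⟨fun i j hij => ?_, ?_⟩
  · ext s
    simp only [Set.mem_inter_iff, Set.mem_ofPred_eq, Set.mem_empty_iff_false, iff_false, not_and]
    rintro rfl
    exact hij
  · ext s
    simp

/-- Acceptance depends on the parity of the least priority that occurs infinitely often. -/
lemma parityAccept_fiber_iff {T : Type} [Finite T] {m : ℕ} {q : T → Fin m} {r : ℕ → T} {i : Fin m}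
    (hi : ∀ n, ∃ t ≥ n, q (r t) = i) (hle : ∃ n, ∀ t ≥ n, i ≤ q (r t)) :
    ParityAccept (fun i => {s | q s = i}) r ↔ Even (i : ℕ) := by
  have hlt : ∀ j < i, InfOcc r ∩ {s | q s = j} = ∅ := by
    intro j hj
    obtain ⟨n, hn⟩ := hle
    refine infOcc_inter_eq_empty_iff.2 ⟨n, fun t ht h => ?_⟩
    have := hn t ht
    rw [Set.mem_ofPred_eq] at h
    omega
  have hne : (InfOcc r ∩ {s | q s = i}).Nonempty := infOcc_inter_nonempty_iff.2 hi
  constructor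
  · rintro ⟨j, hj, hj1, hj2⟩
    rcases lt_trichotomy i j with h | rfl | h
    · rw [hj2 i h] at hne
      exact absurd hne Set.not_nonempty_empty
    · exact hj
    · rw [hlt j h] at hj1
      exact absurd hj1 Set.not_nonempty_empty
  · exact fun h => ⟨i, h, hne, hlt⟩

lemma exists_least_infinitely_often {m : ℕ} (v : ℕ → Fin m) :
    ∃ i, (∀ n, ∃ t ≥ n, v t = i) ∧ ∃ n, ∀ t ≥ n, i ≤ v t := by
  have hne : {i | ∀ n, ∃ t ≥ n, v t = i}.Nonempty := by
    have := (infOcc_inter_nonempty_iff (r := v) (F := Set.univ)).2 fun n => ⟨n, le_rfl, trivial⟩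
    obtain ⟨i, hi, -⟩ := this
    exact ⟨i, hi⟩
  obtain ⟨i, hi, hmin⟩ := WellFounded.has_min (wellFounded_lt (α := Fin m)) _ hne
  refine ⟨i, hi, ?_⟩
  have : InfOcc v ∩ Set.Iio i = ∅ := by
    rw [Set.eq_empty_iff_forall_notMem]
    exact fun j hj => hmin j hj.1 hj.2
  obtain ⟨n, hn⟩ := infOcc_inter_eq_empty_iff.1 this
  exact ⟨n, fun t ht => not_lt.1 (hn t ht)⟩

end Parity

section Automaton

/-- The sets of a family of pairs, indexed by positive numbers. -/
def pairSet {S : Type} {k : ℕ} (R : Fin k → Set S) (j : ℕ) : Set S :=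
  {s | ∃ i : Fin k, j = i + 1 ∧ s ∈ R i}

lemma pairSet_zero {S : Type} {k : ℕ} (R : Fin k → Set S) : pairSet R 0 = ∅ := by
  ext s
  simp [pairSet]

lemma pairSet_succ {S : Type} {k : ℕ} (R : Fin k → Set S) (i : Fin k) :
    pairSet R (i + 1) = R i := by
  ext s
  simp only [pairSet, Nat.add_right_cancel_iff, Set.mem_ofPred_eq]
  constructor
  · rintro ⟨j, hj, hs⟩
    rwa [Fin.ext hj]
  · exact fun hs => ⟨i, rfl, hs⟩

lemma streett_iff {S : Type} [Finite S] {k : ℕ} {R G : Fin k → Set S} {r : ℕ → S} :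
    (∀ i, InfOcc r ∩ G i = ∅ ∨ (InfOcc r ∩ R i).Nonempty) ↔
      ∀ j ∈ Finset.Icc 1 k,
        (∃ n, ∀ t ≥ n, r t ∉ pairSet G j) ∨ (∀ n, ∃ t ≥ n, r t ∈ pairSet R j) := by
  simp only [infOcc_inter_eq_empty_iff, infOcc_inter_nonempty_iff]
  constructor
  · intro h j hj
    rw [Finset.mem_Icc] at hj
    have := h ⟨j - 1, by omega⟩
    rw [← pairSet_succ G, ← pairSet_succ R] at this
    rwa [show ((⟨j - 1, by omega⟩ : Fin k) : ℕ) + 1 = j by simp only; omega] at this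
  · intro h i
    rw [← pairSet_succ G, ← pairSet_succ R]
    exact h _ (Finset.mem_Icc.2 ⟨by omega, i.2⟩)

variable {S : Type} [Fintype S]

/-- The tree in which only the state `s₀` is alive. -/
noncomputable def initialTree (k N : ℕ) (s₀ : S) : S → Branch :=
  open Classical in compress fun s => if s = s₀ then expand k N k [(0, 0)] else []

lemma initialTree_ne_nil_iff {k N : ℕ} {s₀ s : S} : initialTree k N s₀ s ≠ [] ↔ s = s₀ := by
  classical
  simp only [initialTree, compress, renumber, ne_eq, List.map_eq_nil_iff]
  split_ifs with h
  · refine iff_of_true (fun h0 => ?_) h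
    have := prefix_expand k N k [(0, 0)]
    simp [h0] at this
  · simp [h]

lemma isTree_initialTree {k N : ℕ} (hN : 1 ≤ N) (s₀ : S) : IsTree k (initialTree k N s₀) := by
  classical
  have hmem : ∀ {s : S} {x : Branch} {e : ℕ × ℕ},
      x ++ [e] <+: (if s = s₀ then [(0, 0)] else []) → x = [] ∧ e = (0, 0) := by
    intro s x e h
    split_ifs at h
    · have h1 := h.length_le
      simp only [List.length_append, List.length_singleton] at h1
      obtain rfl : x = [] := List.length_eq_zero_iff.1 (by omega)
      simpa using h
    · simp at h
  refine (isTree_expand (N := N) (π := fun s => if s = s₀ then [(0, 0)] else [])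
    (τ := fun s => if s = s₀ then [(0, 0)] else []) ?_ ?_ ?_ ?_ ?_ ?_ ?_ ?_).compress
  · intro s t x y e f hx hy _
    obtain ⟨rfl, rfl⟩ := hmem hx
    obtain ⟨rfl, rfl⟩ := hmem hy
    exact ⟨rfl, rfl⟩
  · intro a ha
    obtain ⟨s, x, j, hx⟩ := mem_names.1 ha
    have := congrArg Prod.snd (hmem hx).2
    simp only at this
    omega
  · exact fun s e h => (hmem (x := []) h).2
  · exact fun s x e hx h => absurd (hmem h).1 hx
  · intro s x e h f hf
    simp [(hmem h).1] at hf
  · exact fun s x e h => Or.inl ⟨s, h⟩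
  · exact fun s x e hx h => absurd (hmem h).1 hx
  · intro s
    by_cases h : s = s₀ <;> simp [h]

/-- The priority of a step: `2 c` if `c` is the least name that is removed or green and `c` is
removed, `2 c + 1` if it is green, and `2 N` if there is no such name. -/
noncomputable def priority (k N : ℕ) (RR GG : ℕ → Set S) (E : S → S → Prop) (π : S → Branch) : ℕ :=
  sInf {v | (∃ c, Dead k N RR GG E π c ∧ v = 2 * c) ∨
    (∃ c, Green k N RR GG E π c ∧ v = 2 * c + 1) ∨ v = 2 * N}

variable {k N : ℕ} {RR GG : ℕ → Set S} {E : S → S → Prop} {π : S → Branch}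

lemma priority_mem : (∃ c, Dead k N RR GG E π c ∧ priority k N RR GG E π = 2 * c) ∨
    (∃ c, Green k N RR GG E π c ∧ priority k N RR GG E π = 2 * c + 1) ∨
      priority k N RR GG E π = 2 * N :=
  Nat.sInf_mem (s := {v | (∃ c, Dead k N RR GG E π c ∧ v = 2 * c) ∨
    (∃ c, Green k N RR GG E π c ∧ v = 2 * c + 1) ∨ v = 2 * N}) ⟨2 * N, Or.inr (Or.inr rfl)⟩

lemma priority_le : priority k N RR GG E π ≤ 2 * N :=
  Nat.sInf_le (Or.inr (Or.inr rfl))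

lemma priority_le_of_dead {c : ℕ} (h : Dead k N RR GG E π c) : priority k N RR GG E π ≤ 2 * c :=
  Nat.sInf_le (Or.inl ⟨c, h, rfl⟩)

lemma priority_le_of_green {c : ℕ} (h : Green k N RR GG E π c) :
    priority k N RR GG E π ≤ 2 * c + 1 :=
  Nat.sInf_le (Or.inr (Or.inl ⟨c, h, rfl⟩))

/-- Some name is eventually stable and infinitely often green iff the least priority that occurs
infinitely often is odd. -/
lemma exists_stable_green_iff {E : ℕ → S → S → Prop} {P : ℕ → S → Branch} {i : ℕ}
    (hi : ∀ n, ∃ t ≥ n, priority k N RR GG (E t) (P t) = i)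
    (hle : ∃ n, ∀ t ≥ n, i ≤ priority k N RR GG (E t) (P t)) :
    (∃ c t₀, (∀ t ≥ t₀, ∀ b ≤ c, ¬ Dead k N RR GG (E t) (P t) b) ∧
      ∀ n, ∃ t ≥ n, Green k N RR GG (E t) (P t) c) ↔ ¬ Even i := by
  obtain ⟨n, hn⟩ := hle
  constructor
  · rintro ⟨c, t₀, hd, hg⟩ ⟨b, rfl⟩
    obtain ⟨t, ht, hgt⟩ := hg n
    have h1 := (hn t ht).trans (priority_le_of_green hgt)
    have hcN := hgt.1
    obtain ⟨u, hu, hpu⟩ := hi t₀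
    rcases priority_mem (k := k) (N := N) (RR := RR) (GG := GG) (E := E u) (π := P u) with
      ⟨a, ha, h2⟩ | ⟨a, ha, h2⟩ | h2
    · exact hd u hu a (by omega) ha
    · omega
    · omega
  · intro hodd
    obtain ⟨c, rfl⟩ := Nat.not_even_iff_odd.1 hodd
    refine ⟨c, n, fun t ht b hb hdb => ?_, fun m => ?_⟩
    · have h1 := (hn t ht).trans (priority_le_of_dead hdb)
      omega
    · obtain ⟨t, ht, hp⟩ := hi m
      refine ⟨t, ht, ?_⟩
      rcases priority_mem (k := k) (N := N) (RR := RR) (GG := GG) (E := E t) (π := P t) with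
        ⟨a, ha, h2⟩ | ⟨a, ha, h2⟩ | h2
      · omega
      · obtain rfl : a = c := by omega
        exact ha
      · omega

end Automaton

section Translation

variable {A S : Type} [Fintype S]

/-- The complement of a Streett automaton without pairs, by the subset construction. -/
theorem exists_complement_of_no_pairs (δ : S → A → Set S) (s₀ : S) (R G : Fin 0 → Set S) :
    ∃ (T : Type) (_ : Fintype T) (δ' : T → A → T) (t₀ : T) (q : T → Fin 2),
      Fintype.card T = 2 ^ Fintype.card S ∧
      {w : ℕ → A | ParityAccept (fun i => {s | q s = i}) (DetRun δ' t₀ w)} =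
        (StreettLang δ s₀ R G)ᶜ := by
  classical
  let δ' : Set S → A → Set S := fun U a => {s | ∃ t ∈ U, s ∈ δ t a}
  let q : Set S → Fin 2 := fun U => if U.Nonempty then 1 else 0
  refine ⟨Set S, inferInstance, δ', {s₀}, q, Fintype.card_set, ?_⟩
  ext w
  set P := DetRun δ' {s₀} w with hP
  have hrun : w ∈ StreettLang δ s₀ R G ↔ ∀ t, (P t).Nonempty := by
    constructor
    · rintro ⟨r, ⟨h0, hr⟩, -⟩ t
      refine ⟨r t, ?_⟩
      induction t with
      | zero => exact h0
      | succ t ih => exact ⟨r t, ih, hr t⟩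
    · intro hne
      obtain ⟨r, hr⟩ := exists_path (U := P) (C := fun t s s' => s' ∈ δ s (w t)) hne
        fun t s' hs' => hs'
      exact ⟨r, ⟨(hr 0).1, fun t => (hr t).2⟩, fun i => i.elim0⟩
  rw [Set.mem_compl_iff, hrun]
  by_cases h : ∀ t, (P t).Nonempty
  · have hq : ∀ t, q (P t) = 1 := fun t => if_pos (h t)
    refine (parityAccept_fiber_iff (q := q) (i := 1) (fun n => ⟨n, le_rfl, hq n⟩)
      ⟨0, fun t _ => (hq t).ge⟩).trans ?_
    simp [h]
  · obtain ⟨n, hn⟩ := not_forall.1 h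
    have hempty : ∀ t ≥ n, ¬ (P t).Nonempty := by
      intro t ht
      induction t, ht using Nat.le_induction with
      | base => exact hn
      | succ t _ ih =>
        rintro ⟨s, u, hu, -⟩
        exact ih ⟨u, hu⟩
    have hq : ∀ t ≥ n, q (P t) = 0 := fun t ht => if_neg (hempty t ht)
    refine (parityAccept_fiber_iff (q := q) (i := 0)
      (fun m => ⟨max m n, le_max_left m n, hq _ (le_max_right m n)⟩)
      ⟨0, fun t _ => Fin.zero_le _⟩).trans ?_
    simp [h]

variable {k : ℕ}

/-- A run of the tree automaton is accepted iff the word is not in the Streett language. -/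
theorem even_priority_iff {δ : S → A → Set S} {s₀ : S} {R G : Fin k → Set S} {w : ℕ → A} {N : ℕ}
    {P : ℕ → S → Branch}
    (h : IsTreeRun k N (pairSet R) (pairSet G) (fun t s s' => s' ∈ δ s (w t)) P)
    (h0 : P 0 = initialTree k N s₀) {i : ℕ}
    (hi : ∀ n, ∃ t ≥ n,
      priority k N (pairSet R) (pairSet G) (fun s s' => s' ∈ δ s (w t)) (P t) = i)
    (hle : ∃ n, ∀ t ≥ n,
      i ≤ priority k N (pairSet R) (pairSet G) (fun s s' => s' ∈ δ s (w t)) (P t)) :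
    Even i ↔ w ∈ (StreettLang δ s₀ R G)ᶜ := by
  rw [Set.mem_compl_iff, ← not_iff_not, not_not, ← exists_stable_green_iff hi hle]
  constructor
  · rintro ⟨c, t₀, hd, hg⟩
    obtain ⟨r, hr0, hr, hacc⟩ := h.sound hd hg
    rw [h0, initialTree_ne_nil_iff] at hr0
    exact ⟨r, ⟨hr0, hr⟩, streett_iff.2 hacc⟩
  · rintro ⟨r, ⟨hr0, hr⟩, hacc⟩
    refine h.complete (r := r) ?_ hr (streett_iff.1 hacc)
    rw [h0, initialTree_ne_nil_iff, hr0]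

theorem card_le_of_injective_code [Nonempty S] (hk : 1 ≤ k) {T : Type} [Fintype T]
    {f : T → CompactTree S k × Fin (2 * (Fintype.card S * (k + 1)) + 1)}
    (hf : Function.Injective f) :
    Fintype.card T ≤ 2 * Fintype.card S ^ Fintype.card S *
      (k + 1) ^ (Fintype.card S * (k + 1)) * (Fintype.card S * (k + 1)).factorial := by
  classical
  obtain ⟨g, hg⟩ := exists_injective_code (S := S) hk
  refine (Fintype.card_le_of_injective _ ((hg.prodMap Function.injective_id).comp hf)).trans ?_
  refine le_trans (le_of_eq ?_) (card_code_le Fintype.card_pos hk)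
  simp only [Fintype.card_prod, Fintype.card_pi, Fintype.card_fin, Finset.prod_const,
    Finset.card_univ]
  rw [Fin.prod_univ_eq_prod_range (fun i => i + 1), Finset.prod_range_add_one_eq_factorial]

theorem exists_complement_of_pairs (hk : 1 ≤ k) (δ : S → A → Set S) (s₀ : S)
    (R G : Fin k → Set S) :
    ∃ (T : Type) (_ : Fintype T) (δ' : T → A → T) (t₀ : T)
      (q : T → Fin (2 * (Fintype.card S * (k + 1)) + 1)),
      Fintype.card T ≤ 2 * Fintype.card S ^ Fintype.card S *
        (k + 1) ^ (Fintype.card S * (k + 1)) * (Fintype.card S * (k + 1)).factorial ∧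
      {w : ℕ → A | ParityAccept (fun i => {s | q s = i}) (DetRun δ' t₀ w)} =
        (StreettLang δ s₀ R G)ᶜ := by
  classical
  have : Nonempty S := ⟨s₀⟩
  set N := Fintype.card S * (k + 1) with hN
  have hN1 : 1 ≤ N := Nat.mul_pos Fintype.card_pos k.succ_pos
  have hR := pairSet_zero R
  have hG := pairSet_zero G
  have hlt : ∀ τ : CompactTree S k, ∀ a ∈ names τ.1, a < N :=
    fun τ a ha => τ.2.1.name_lt_card τ.2.2 ha
  let next : CompactTree S k → A → CompactTree S k := fun τ a =>
    ⟨step k N (pairSet R) (pairSet G) (fun s s' => s' ∈ δ s a) τ.1,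
      isTree_step τ.2.1 (hlt τ) hR hG, isCompact_step⟩
  let out : CompactTree S k → A → Fin (2 * N + 1) := fun τ a =>
    ⟨priority k N (pairSet R) (pairSet G) (fun s s' => s' ∈ δ s a) τ.1,
      Nat.lt_succ_of_le priority_le⟩
  let δ' : CompactTree S k × Fin (2 * N + 1) → A → CompactTree S k × Fin (2 * N + 1) :=
    fun τ a => (next τ.1 a, out τ.1 a)
  let t₀ : CompactTree S k × Fin (2 * N + 1) :=
    (⟨initialTree k N s₀, isTree_initialTree hN1 s₀, isCompact_compress _⟩, 0)
  have : Finite (CompactTree S k) :=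
    let ⟨_, hf⟩ := exists_injective_code (S := S) hk
    Finite.of_injective _ hf
  let _ := Fintype.ofFinite (CompactTree S k × Fin (2 * N + 1))
  refine ⟨_, inferInstance, δ', t₀, Prod.snd,
    card_le_of_injective_code hk Function.injective_id, ?_⟩
  ext w
  obtain ⟨i, hi, hle⟩ := exists_least_infinitely_often fun t => (DetRun δ' t₀ w t).2
  refine (parityAccept_fiber_iff hi hle).trans ?_
  have hrun : IsTreeRun k N (pairSet R) (pairSet G) (fun t s s' => s' ∈ δ s (w t))
      fun t => (DetRun δ' t₀ w t).1.1 :=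
    ⟨fun t => (DetRun δ' t₀ w t).1.2.1, fun t => (DetRun δ' t₀ w t).1.2.2,
      fun t => hlt _, fun _ => rfl, hR, hG⟩
  refine even_priority_iff hrun rfl (fun n => ?_) ?_
  · obtain ⟨t, ht, hti⟩ := hi (n + 1)
    obtain ⟨t, rfl⟩ : ∃ u, t = u + 1 := ⟨t - 1, by omega⟩
    exact ⟨t, by omega, congrArg Fin.val hti⟩
  · obtain ⟨n, hn⟩ := hle
    exact ⟨n, fun t ht => hn (t + 1) (by omega)⟩

lemma two_pow_le {n : ℕ} (hn : 1 ≤ n) : 2 ^ n ≤ 2 * n ^ n * n.factorial := by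
  obtain rfl | h := hn.eq_or_lt
  · simp
  · calc 2 ^ n ≤ n ^ n := Nat.pow_le_pow_left h n
      _ ≤ 2 * n ^ n := Nat.le_mul_of_pos_left _ two_pos
      _ ≤ 2 * n ^ n * n.factorial := Nat.le_mul_of_pos_right _ n.factorial_pos

end Translation

end StreettDet

/-- For every nondeterministic Streett word automaton `S` with
`n ≥ 1` states and `k` pairs over alphabet `Σ` there exists a deterministic
parity word automaton `D` with at most `2·n^n·(k+1)^{n(k+1)}·(n(k+1))!` states
and parity index at most `2n(k+1)+1` such that `L(D) = Σ^ω ∖ L(S)`. -/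
theorem nsw_to_dpw_complement (A : Type) [Fintype A] (S : Type) [Fintype S] (n k : ℕ)
    (hn : 1 ≤ n) (hcard : Fintype.card S = n)
    (δ : S → A → Set S) (s0 : S) (R G : Fin k → Set S) :
    ∃ (T : Type) (instT : Fintype T) (δ' : T → A → T) (t0 : T)
      (m : ℕ) (F : Fin m → Set T),
      @Fintype.card T instT ≤
        2 * n ^ n * (k + 1) ^ (n * (k + 1)) * (n * (k + 1)).factorial ∧
      m ≤ 2 * (n * (k + 1)) + 1 ∧
      IsPartition F ∧
      {w : ℕ → A | ParityAccept F (DetRun δ' t0 w)} = (StreettLang δ s0 R G)ᶜ := by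
  subst hcard
  rcases Nat.eq_zero_or_pos k with rfl | hk
  · obtain ⟨T, instT, δ', t0, q, hT, hq⟩ := StreettDet.exists_complement_of_no_pairs δ s0 R G
    refine ⟨T, instT, δ', t0, 2, _, ?_, by omega, StreettDet.isPartition_fiber q, hq⟩
    rw [hT]
    simpa using StreettDet.two_pow_le hn
  · obtain ⟨T, instT, δ', t0, q, hT, hq⟩ := StreettDet.exists_complement_of_pairs hk δ s0 R G
    exact ⟨T, instT, δ', t0, _, _, hT, le_rfl, StreettDet.isPartition_fiber q, hq⟩
end
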